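/- arXiv:1502.06799 — 3 statements merged into one kernel-verified Lean document; each statement's English description precedes it below -/
import Mathlib

section
/- For fractional Gaussian noise with Hurst parameter H ∈ [1/2,1), there exists a constant c>0 and T₀ such that for all integers T≥T₀: T^{−(1−H)} (log T)^{−c} ≤ P[max_{k=1,...,T} Z_k ≤ 0] ≤ T^{−(1−H)} (log T)^{c}. -/
open MeasureTheory Filter ProbabilityTheory

/-- Coordinate expansion of a continuous linear form on a finite power of `ℝ`. -/
theorem strongDual_pi_apply_eq_sum {ι : Type*} [Fintype ι] [DecidableEq ι]
    (L : StrongDual ℝ (ι → ℝ)) (x : ι → ℝ) : L x = ∑ i, L (Pi.single i 1) * x i := by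
  have hx : x = ∑ i, x i • (Pi.single i 1 : ι → ℝ) := by
    ext j
    simp [Finset.sum_apply, Pi.single_apply]
  conv_lhs => rw [hx, map_sum]
  simp [mul_comm]

/-- A family of random variables all of whose finite linear combinations are centered Gaussian is a
Gaussian process. -/
theorem isGaussianProcess_of_forall_sum {Ω T : Type*} [MeasurableSpace Ω] {P : Measure Ω}
    [IsProbabilityMeasure P] {Y : T → Ω → ℝ} (hY : ∀ t, Measurable (Y t))
    (h : ∀ (s : Finset T) (c : T → ℝ),
      ∃ v : NNReal, P.map (fun ω => ∑ i ∈ s, c i * Y i ω) = gaussianReal 0 v) :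
    IsGaussianProcess Y P := by
  classical
  refine ⟨fun I => ⟨⟨fun L => ?_⟩⟩⟩
  have hmeas : Measurable fun ω => I.restrict (Y · ω) :=
    measurable_pi_lambda _ fun i => hY i
  let c : T → ℝ := fun t => if ht : t ∈ I then L (Pi.single ⟨t, ht⟩ 1) else 0
  have hL : ∀ ω, L (I.restrict (Y · ω)) = ∑ i ∈ I, c i * Y i ω := fun ω => by
    rw [strongDual_pi_apply_eq_sum, ← Finset.sum_coe_sort I]
    exact Finset.sum_congr rfl fun i _ => by simp [c]
  obtain ⟨v, hv⟩ := h I c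
  have hmap : (P.map fun ω => I.restrict (Y · ω)).map L = gaussianReal 0 v := by
    rw [Measure.map_map (by fun_prop) hmeas, ← hv]
    exact congrArg (fun f => P.map f) (funext hL)
  have hYint : ∫ x, L x ∂(P.map fun ω => I.restrict (Y · ω)) = 0 := by
    rw [← integral_map (φ := L) (f := fun x => x) (by fun_prop) (by fun_prop), hmap,
      integral_id_gaussianReal]
  have hvar : Var[L; P.map fun ω => I.restrict (Y · ω)] = v := by
    rw [← variance_id_map (by fun_prop), hmap, variance_id_gaussianReal]
  rw [hmap, hYint, hvar, Real.toNNReal_coe]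

/-- The law of a centered real Gaussian process is determined by its covariance. -/
theorem ProbabilityTheory.IsGaussianProcess.map_eq_of_covariance_eq {Ω T : Type*}
    [MeasurableSpace Ω] {P : Measure Ω} [IsProbabilityMeasure P] {Y Y' : T → Ω → ℝ}
    (hY : IsGaussianProcess Y P) (hY' : IsGaussianProcess Y' P)
    (hm : ∀ t, Measurable (Y t)) (hm' : ∀ t, Measurable (Y' t))
    (h0 : ∀ t, ∫ ω, Y t ω ∂P = ∫ ω, Y' t ω ∂P)
    (hcov : ∀ s t, cov[Y s, Y t; P] = cov[Y' s, Y' t; P]) :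
    P.map (fun ω t => Y t ω) = P.map (fun ω t => Y' t ω) := by
  classical
  rw [map_eq_iff_forall_finset_map_restrict_eq
    (measurable_pi_lambda _ hm).aemeasurable (measurable_pi_lambda _ hm').aemeasurable]
  intro I
  have key : ∀ (V : T → Ω → ℝ) (L : StrongDual ℝ (I → ℝ)),
      (L ∘ fun ω => I.restrict (V · ω)) = fun ω => ∑ i, L (Pi.single i 1) * V i ω :=
    fun V L => funext fun ω => strongDual_pi_apply_eq_sum L _
  have hYint : ∀ {V : T → Ω → ℝ}, IsGaussianProcess V P → ∀ t, Integrable (V t) P :=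
    fun hV t => (hV.hasGaussianLaw_eval t).integrable
  have hmem : ∀ {V : T → Ω → ℝ}, IsGaussianProcess V P → ∀ t, MemLp (V t) 2 P :=
    fun hV t => (hV.hasGaussianLaw_eval t).memLp_two
  have := (hY.hasGaussianLaw I).isGaussian_map
  have := (hY'.hasGaussianLaw I).isGaussian_map
  refine Measure.ext_of_charFunDual (funext fun L => ?_)
  rw [(hY.hasGaussianLaw I).charFunDual_map_eq, (hY'.hasGaussianLaw I).charFunDual_map_eq,
    key Y L, key Y' L]
  beta_reduce
  rw [integral_finsetSum _ fun (i : I) _ => (hYint hY i).const_mul _,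
    integral_finsetSum _ fun (i : I) _ => (hYint hY' i).const_mul _,
    variance_fun_sum fun (i : I) => (hmem hY i).const_mul _,
    variance_fun_sum fun (i : I) => (hmem hY' i).const_mul _]
  simp only [integral_const_mul, covariance_const_mul_left, covariance_const_mul_right, h0, hcov]

/-- If `U` has nonnegative correlation with each `V k` and everything is jointly Gaussian, then
`{U ≤ -1}` and `{∀ k, V k ≤ 0}` are positively correlated. -/
theorem measureReal_mul_le_of_covariance_nonneg {Ω ι : Type*} [MeasurableSpace Ω] {P : Measure Ω}
    [IsProbabilityMeasure P] [Countable ι] {U : Ω → ℝ} {V : ι → Ω → ℝ} (hU : Measurable U)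
    (hV : ∀ k, Measurable (V k))
    (hG : IsGaussianProcess (Sum.elim (fun _ : Unit => U) V) P)
    (hvar : cov[U, U; P] = 1) (hcov : ∀ k, 0 ≤ cov[U, V k; P]) :
    P.real {ω | U ω ≤ -1} * P.real {ω | ∀ k, V k ω ≤ 0} ≤
      P.real {ω | U ω ≤ -1 ∧ ∀ k, V k ω ≤ 0} := by
  classical
  set a : ι → ℝ := fun k => cov[U, V k; P]
  let W : ι → Ω → ℝ := fun k ω => V k ω - a k * U ω
  have hW : ∀ k, Measurable (W k) := fun k => (hV k).sub (hU.const_mul _)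
  have hUm : MemLp U 2 P := (hG.hasGaussianLaw_eval (Sum.inl ())).memLp_two
  have hVm : ∀ k, MemLp (V k) 2 P := fun k => (hG.hasGaussianLaw_eval (Sum.inr k)).memLp_two
  have hGW : IsGaussianProcess (Sum.elim (fun _ : Unit => U) W) P := by
    refine hG.of_isGaussianProcess ?_
    rintro (u | k)
    · exact ⟨{Sum.inl ()}, .proj ⟨Sum.inl (), by simp⟩, fun ω => rfl⟩
    · exact ⟨{Sum.inl (), Sum.inr k},
        .proj ⟨Sum.inr k, by simp⟩ - a k • .proj ⟨Sum.inl (), by simp⟩, fun ω => rfl⟩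
  have hind : IndepFun (fun ω (_ : Unit) => U ω) (fun ω k => W k ω) P := by
    refine hGW.indepFun_of_covariance_eq_zero (fun _ => hU.aemeasurable)
      (fun k => (hW k).aemeasurable) fun _ k => ?_
    simp only [W]
    rw [covariance_fun_sub_right hUm (hVm k) (hUm.const_mul _), covariance_const_mul_right, hvar]
    simp [a]
  set D : Set Ω := {ω | U ω ≤ -1}
  set B : Set Ω := {ω | ∀ k, V k ω ≤ 0}
  set E : Set Ω := {ω | ∀ k, W k ω ≤ a k}
  have hDm : MeasurableSet D := measurableSet_le hU measurable_const
  have hprod : ∀ s : Set ℝ, MeasurableSet s →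
      P.real (U ⁻¹' s ∩ E) = P.real (U ⁻¹' s) * P.real E := fun s hs => by
    have h1 : MeasurableSet {x : Unit → ℝ | x () ∈ s} := measurable_pi_apply _ hs
    have h2 : MeasurableSet {x : ι → ℝ | ∀ k, x k ≤ a k} :=
      measurableSet_setOfPred.2 <| Measurable.forall fun k =>
        measurableSet_setOfPred.1 <| measurableSet_le (measurable_pi_apply k) measurable_const
    have := hind.measure_inter_preimage_eq_mul _ _ h1 h2
    simp only [measureReal_def, ← ENNReal.toReal_mul]
    exact congrArg ENNReal.toReal this
  have e1 : P.real D * P.real E ≤ P.real (B ∩ D) := by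
    have : D = U ⁻¹' Set.Iic (-1) := rfl
    rw [this, ← hprod _ measurableSet_Iic]
    refine measureReal_mono fun ω hω => ⟨fun k => ?_, hω.1⟩
    have h1 : U ω ≤ -1 := hω.1
    have h2 : V k ω - a k * U ω ≤ a k := hω.2 k
    nlinarith [hcov k]
  have e2 : P.real (B \ D) ≤ P.real Dᶜ * P.real E := by
    have : Dᶜ = U ⁻¹' (Set.Iic (-1))ᶜ := rfl
    rw [this, ← hprod _ measurableSet_Iic.compl]
    refine measureReal_mono fun ω hω => ⟨hω.2, fun k => ?_⟩
    have h1 : ¬ U ω ≤ -1 := hω.2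
    have h2 : V k ω ≤ 0 := hω.1 k
    change V k ω - a k * U ω ≤ a k
    nlinarith [hcov k]
  have e3 : P.real (B ∩ D) + P.real (B \ D) = P.real B := measureReal_inter_add_sdiff hDm
  have e4 : P.real Dᶜ = 1 - P.real D := probReal_compl_eq_one_sub hDm
  have e5 : {ω | U ω ≤ -1 ∧ ∀ k, V k ω ≤ 0} = B ∩ D := Set.inter_comm D B
  rw [e5]
  have e6 : P.real D * P.real (B \ D) ≤ P.real Dᶜ * P.real (B ∩ D) := by
    nlinarith [measureReal_nonneg (μ := P) (s := D), measureReal_nonneg (μ := P) (s := Dᶜ)]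
  rw [e4] at e6
  rw [← e3]
  linarith

/-- `maxPartialSum n x = max_{0 ≤ l ≤ n} ∑_{i < l} x i`. -/
noncomputable def maxPartialSum : ℕ → (ℕ → ℝ) → ℝ
  | 0, _ => 0
  | n + 1, x => max 0 (x 0 + maxPartialSum n fun i => x (i + 1))

theorem maxPartialSum_le_iff (n : ℕ) (x : ℕ → ℝ) (a : ℝ) :
    maxPartialSum n x ≤ a ↔ ∀ l ≤ n, ∑ i ∈ Finset.range l, x i ≤ a := by
  induction n generalizing x a with
  | zero => simp [maxPartialSum]
  | succ n ih =>
    rw [maxPartialSum, max_le_iff, ← le_sub_iff_add_le', ih]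
    constructor
    · rintro ⟨h0, h⟩ (_ | l) hl
      · simpa using h0
      · have := h l (by omega)
        rw [Finset.sum_range_succ']
        linarith
    · refine fun h => ⟨by simpa using h 0 (by omega), fun l hl => ?_⟩
      have := h (l + 1) (by omega)
      rw [Finset.sum_range_succ'] at this
      linarith

theorem add_maxPartialSum_le_iff (n : ℕ) (x : ℕ → ℝ) (a : ℝ) :
    (x 0 + maxPartialSum n fun i => x (i + 1)) ≤ a ↔
      ∀ l ≤ n, ∑ i ∈ Finset.range (l + 1), x i ≤ a := by
  rw [← le_sub_iff_add_le', maxPartialSum_le_iff]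
  simp only [Finset.sum_range_succ', le_sub_iff_add_le]

theorem sum_range_le_maxPartialSum {l n : ℕ} (hl : l ≤ n) (x : ℕ → ℝ) :
    ∑ i ∈ Finset.range l, x i ≤ maxPartialSum n x :=
  (maxPartialSum_le_iff n x _).1 le_rfl l hl

theorem maxPartialSum_nonneg (n : ℕ) (x : ℕ → ℝ) : 0 ≤ maxPartialSum n x := by
  simpa using sum_range_le_maxPartialSum (Nat.zero_le n) x

theorem maxPartialSum_le_succ (n : ℕ) (x : ℕ → ℝ) :
    maxPartialSum n x ≤ maxPartialSum (n + 1) x :=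
  (maxPartialSum_le_iff n x _).2 fun _ hl => sum_range_le_maxPartialSum (by omega) x

theorem exists_maxPartialSum_eq (n : ℕ) (x : ℕ → ℝ) :
    ∃ l ∈ Finset.range (n + 1), maxPartialSum n x = ∑ i ∈ Finset.range l, x i := by
  induction n generalizing x with
  | zero => exact ⟨0, by simp, by simp [maxPartialSum]⟩
  | succ n ih =>
    rw [maxPartialSum]
    rcases max_choice 0 (x 0 + maxPartialSum n fun i => x (i + 1)) with h | h
    · exact ⟨0, by simp, by simpa using h⟩
    · obtain ⟨l, hl, hx⟩ := ih fun i => x (i + 1)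
      refine ⟨l + 1, by simpa using hl, ?_⟩
      rw [h, hx, Finset.sum_range_succ', add_comm]

theorem measurable_maxPartialSum (n : ℕ) : Measurable (maxPartialSum n) := by
  induction n with
  | zero => exact measurable_const
  | succ n ih =>
    have : Measurable fun (x : ℕ → ℝ) i => x (i + 1) :=
      measurable_pi_lambda _ fun i => measurable_pi_apply _
    exact measurable_const.max ((measurable_pi_apply 0).add (ih.comp this))

theorem integrable_maxPartialSum {Ω : Type*} [MeasurableSpace Ω] {P : Measure Ω}
    [IsProbabilityMeasure P] (n : ℕ) {Y : ℕ → Ω → ℝ} (hY : ∀ i, Integrable (Y i) P) :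
    Integrable (fun ω => maxPartialSum n fun i => Y i ω) P := by
  induction n generalizing Y with
  | zero => exact integrable_const 0
  | succ n ih =>
    exact (integrable_const (0 : ℝ)).sup ((hY 0).add (ih fun i => hY (i + 1)))

/-- Quantitative deduction of two-sided bounds on `q` from the growth of the partial sums `e` of an
antitone sequence `b` comparable to `q`. -/
theorem exists_log_bounds {H κ p C : ℝ} (hH : H ∈ Set.Ico (1 / 2 : ℝ) 1) (hκ : 0 < κ) (hp : 0 < p)
    {e b q : ℕ → ℝ} (he0 : e 0 = 0) (he : ∀ n, e (n + 1) = e n + b n) (hb : Antitone b)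
    (hb0 : ∀ n, 0 ≤ b n)
    (hlow : ∀ n : ℕ, κ * (n : ℝ) ^ H ≤ e n)
    (hup : ∀ n : ℕ, 1 ≤ n → e n ≤ (n : ℝ) ^ H * (Real.log (n + 1) + 2))
    (hbq : ∀ n, ∀ L : ℝ, 0 ≤ L → b n ≤ L * q n + C * Real.exp (-L))
    (hqb : ∀ n, p * q n ≤ b (n + 1)) :
    ∃ c > (0 : ℝ), ∃ T₀ : ℕ, ∀ T ≥ T₀, 1 ≤ T ∧
      (T : ℝ) ^ (-(1 - H)) * Real.log T ^ (-c) ≤ q (T - 1) ∧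
        q (T - 1) ≤ (T : ℝ) ^ (-(1 - H)) * Real.log T ^ c := by
  obtain ⟨hH1, hH2⟩ := hH
  have hmul : ∀ n : ℕ, (n : ℝ) * b n ≤ e n := by
    intro n
    induction n with
    | zero => simp [he0]
    | succ n ih =>
      rw [he]
      push_cast
      nlinarith [hb (Nat.le_succ n), hb0 n, (Nat.cast_nonneg n : (0:ℝ) ≤ n)]
  have hadd : ∀ n m : ℕ, e (n + m) ≤ e n + m * b n := by
    intro n m
    induction m with
    | zero => simp
    | succ m ih =>
      rw [← add_assoc, he]
      push_cast
      nlinarith [hb (Nat.le_add_right n m)]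
  have hlog : Tendsto (fun T : ℕ => Real.log T) atTop atTop :=
    Real.tendsto_log_atTop.comp tendsto_natCast_atTop_atTop
  have hev : ∀ᶠ T : ℕ in atTop, 2 ≤ T ∧ 4 ≤ Real.log T ∧ 2 / p ≤ Real.log T ∧
      (6 / κ) ^ 2 ≤ Real.log T ∧ Real.log T ^ 6 * |C| ≤ T := by
    refine (eventually_ge_atTop 2).and ((hlog.eventually_ge_atTop _).and
      ((hlog.eventually_ge_atTop _).and ((hlog.eventually_ge_atTop _).and ?_)))
    have hC : 0 < |C| + 1 := by positivity
    have := (Real.isLittleO_pow_log_id_atTop (n := 6)).def (inv_pos.2 hC)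
    filter_upwards [tendsto_natCast_atTop_atTop.eventually this] with T hT
    simp only [Real.norm_eq_abs, id, Nat.abs_cast, abs_pow] at hT
    rw [inv_mul_eq_div, le_div_iff₀ hC, pow_abs, abs_of_nonneg (by positivity)] at hT
    nlinarith [show 0 ≤ Real.log T ^ 6 by positivity]
  obtain ⟨T₀, hT₀⟩ := eventually_atTop.1 hev
  refine ⟨6, by norm_num, T₀, fun T hT => ?_⟩
  obtain ⟨hT2, hl4, hlp, hlκ, hTC⟩ := hT₀ T hT
  obtain ⟨n, rfl⟩ : ∃ n, T = n + 1 := ⟨T - 1, by omega⟩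
  set T := n + 1
  set l := Real.log T with hl
  have hT2' : (2 : ℝ) ≤ T := by exact_mod_cast hT2
  have hTpos : (0 : ℝ) < T := by linarith
  have hl0 : 0 < l := by linarith
  have hlog1 : Real.log (T + 1) + 2 ≤ 2 * l := by
    have h1 : Real.log (T + 1) ≤ Real.log (2 * T) := Real.log_le_log (by linarith) (by linarith)
    rw [Real.log_mul two_ne_zero hTpos.ne'] at h1
    linarith [Real.log_two_lt_d9]
  have hTH : (T : ℝ) ^ H = T ^ (-(1 - H)) * T := by
    rw [← Real.rpow_add_one hTpos.ne']; congr 1; ring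
  have hA : 0 < (T : ℝ) ^ (-(1 - H)) := Real.rpow_pos_of_pos hTpos _
  have hAT : (T : ℝ)⁻¹ ≤ (T : ℝ) ^ (-(1 - H)) := by
    rw [← Real.rpow_neg_one]
    exact Real.rpow_le_rpow_of_exponent_le (by linarith) (by linarith)
  set A := (T : ℝ) ^ (-(1 - H))
  have heT : e T ≤ A * T * (2 * l) := by
    refine (hup T (by omega)).trans ?_
    rw [hTH]
    gcongr
  have hl6 : l ^ (6 : ℝ) = l ^ 6 := by exact_mod_cast Real.rpow_natCast l 6
  have hln6 : l ^ (-(6 : ℝ)) = (l ^ 6)⁻¹ := by rw [Real.rpow_neg hl0.le, hl6]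
  rw [hl6, hln6, Nat.add_sub_cancel]
  have hl3 : 2 ≤ l ^ 3 := by
    have : (4 : ℝ) ^ 3 ≤ l ^ 3 := by gcongr
    linarith
  refine ⟨by omega, ?_, ?_⟩
  · set K := ⌈l ^ 3⌉₊
    have hK1 : l ^ 3 ≤ K := Nat.le_ceil _
    have hK2 : (K : ℝ) ≤ 2 * l ^ 3 := by
      have := Nat.ceil_lt_add_one (show 0 ≤ l ^ 3 by positivity)
      linarith
    have hK3 : 6 * l ≤ κ * ((K : ℝ) + 1) ^ H := by
      have h1 : Real.sqrt (l ^ 3) ≤ ((K : ℝ) + 1) ^ H := by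
        rw [Real.sqrt_eq_rpow]
        calc (l ^ 3) ^ (1 / 2 : ℝ) ≤ ((K : ℝ) + 1) ^ (1 / 2 : ℝ) := by gcongr; linarith
          _ ≤ ((K : ℝ) + 1) ^ H := Real.rpow_le_rpow_of_exponent_le (by simp) hH1
      have h2 : 6 / κ * l ≤ Real.sqrt (l ^ 3) := by
        refine Real.le_sqrt_of_sq_le ?_
        calc (6 / κ * l) ^ 2 = (6 / κ) ^ 2 * l ^ 2 := by ring
          _ ≤ l * l ^ 2 := by gcongr
          _ = l ^ 3 := by ring
      calc 6 * l = κ * (6 / κ * l) := by field_simp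
        _ ≤ _ := by gcongr; exact h2.trans h1
    have hb1 : κ * ((K : ℝ) + 1) ^ H * (A * T) ≤ A * T * (2 * l) + K * T * b T := by
      have h1 := (hlow (T + K * T)).trans (hadd T (K * T))
      have h2 : ((T + K * T : ℕ) : ℝ) = (K + 1) * T := by push_cast; ring
      rw [h2, Real.mul_rpow (by positivity) hTpos.le, hTH] at h1
      push_cast at h1
      nlinarith
    have hb2 : A * (4 * l) ≤ K * b T := by
      have h1 : A * T * (6 * l) ≤ A * T * (2 * l) + K * T * b T := by
        refine le_trans ?_ hb1
        rw [mul_comm]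
        gcongr
      refine le_of_mul_le_mul_right ?_ hTpos
      linarith
    have hb3 : A * (4 * l) ≤ 2 * l ^ 3 * b n :=
      hb2.trans (mul_le_mul hK2 (hb (Nat.le_succ n)) (hb0 _) (by positivity))
    have hb4 : 2 * A ≤ l ^ 2 * b n := by
      refine le_of_mul_le_mul_right ?_ hl0
      nlinarith
    have hexp : Real.exp (-(2 * l)) = (T : ℝ)⁻¹ * (T : ℝ)⁻¹ := by
      rw [two_mul, neg_add, Real.exp_add, Real.exp_neg, Real.exp_log hTpos]
    have hC1 : l ^ 2 * (C * Real.exp (-(2 * l))) ≤ A := by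
      rw [hexp]
      have h1 : l ^ 2 * C ≤ T := by
        refine le_trans ?_ hTC
        have : l ^ 2 ≤ l ^ 6 := pow_le_pow_right₀ (by linarith) (by norm_num)
        calc l ^ 2 * C ≤ l ^ 2 * |C| := by gcongr; exact le_abs_self C
          _ ≤ _ := by gcongr
      calc l ^ 2 * (C * ((T : ℝ)⁻¹ * (T : ℝ)⁻¹)) = l ^ 2 * C * (T : ℝ)⁻¹ * (T : ℝ)⁻¹ := by ring
        _ ≤ T * (T : ℝ)⁻¹ * (T : ℝ)⁻¹ := by gcongr
        _ = (T : ℝ)⁻¹ := by field_simp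
        _ ≤ A := hAT
    have hq1 : A ≤ 2 * l ^ 3 * q n := by
      have := mul_le_mul_of_nonneg_left (hbq n (2 * l) (by linarith)) (sq_nonneg l)
      nlinarith
    have hq0 : 0 ≤ q n := nonneg_of_mul_nonneg_right (hA.le.trans hq1) (by positivity)
    rw [← div_eq_mul_inv, div_le_iff₀ (by positivity), mul_comm]
    refine hq1.trans ?_
    gcongr
    calc 2 * l ^ 3 ≤ l ^ 3 * l ^ 3 := by gcongr
      _ = l ^ 6 := by ring
  · have h1 : T * (p * q n) ≤ T * (A * (2 * l)) := by
      calc T * (p * q n) ≤ T * b T := by gcongr; exact hqb n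
        _ ≤ e T := hmul T
        _ ≤ A * T * (2 * l) := heT
        _ = _ := by ring
    have h2 := le_of_mul_le_mul_left h1 hTpos
    rw [div_le_iff₀ hp] at hlp
    have h3 : p * q n ≤ p * (A * l ^ 6) := by
      have : 2 * l ≤ p * l ^ 6 := by
        have h4 : l ^ 2 ≤ l ^ 6 := pow_le_pow_right₀ (by linarith) (by norm_num)
        nlinarith
      nlinarith
    exact le_of_mul_le_mul_left h3 hp

/-- The covariance function of fractional Gaussian noise with Hurst parameter `H`. -/
noncomputable def fgnCov (H : ℝ) (j : ℕ) : ℝ :=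
  (((j : ℝ) + 1) ^ (2 * H) + |(j : ℝ) - 1| ^ (2 * H) - 2 * (j : ℝ) ^ (2 * H)) / 2

theorem fgnCov_zero {H : ℝ} (hH : 1 / 2 ≤ H) : fgnCov H 0 = 1 := by
  have : 2 * H ≠ 0 := by linarith
  simp [fgnCov, Real.zero_rpow this]

theorem fgnCov_nonneg {H : ℝ} (hH : 1 / 2 ≤ H) (j : ℕ) : 0 ≤ fgnCov H j := by
  rcases j with _ | j
  · rw [fgnCov_zero hH]; exact zero_le_one
  · have hc := convexOn_rpow (p := 2 * H) (by linarith)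
    have hj : (0 : ℝ) ≤ j := Nat.cast_nonneg j
    have h := hc.2 (Set.mem_Ici.2 hj) (Set.mem_Ici.2 (add_nonneg hj zero_le_two))
      (by norm_num : (0 : ℝ) ≤ 1 / 2) (by norm_num : (0 : ℝ) ≤ 1 / 2) (by norm_num)
    simp only [smul_eq_mul] at h
    have e1 : (1 / 2 : ℝ) * j + 1 / 2 * (j + 2) = j + 1 := by ring
    rw [e1] at h
    unfold fgnCov
    push_cast
    rw [add_sub_cancel_right, abs_of_nonneg (Nat.cast_nonneg j), add_assoc (j : ℝ) 1 1,
      one_add_one_eq_two]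
    linarith

theorem sum_fgnCov_succ {H : ℝ} (hH : 1 / 2 ≤ H) (n : ℕ) :
    2 * ∑ j ∈ Finset.range n, fgnCov H (j + 1) =
      ((n : ℝ) + 1) ^ (2 * H) - (n : ℝ) ^ (2 * H) - 1 := by
  induction n with
  | zero =>
    have : 2 * H ≠ 0 := by linarith
    simp [Real.zero_rpow this]
  | succ n ih =>
    rw [Finset.sum_range_succ, mul_add, ih]
    unfold fgnCov
    push_cast
    rw [add_sub_cancel_right, abs_of_nonneg (Nat.cast_nonneg n)]
    ring

theorem integral_max_zero_gaussianReal (v : NNReal) :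
    ∫ x, max 0 x ∂gaussianReal 0 v = Real.sqrt v * ∫ x, max 0 x ∂gaussianReal 0 1 := by
  have h : gaussianReal 0 v = (gaussianReal 0 1).map (Real.sqrt v * ·) := by
    rw [gaussianReal_map_const_mul, mul_zero, mul_one]
    congr
    ext
    simp
  rw [h, integral_map (by fun_prop) (by fun_prop), ← integral_const_mul]
  refine integral_congr_ae (ae_of_all _ fun x => ?_)
  simp [mul_max_of_nonneg _ _ (Real.sqrt_nonneg _)]

theorem gaussianReal_pos_of_volume_pos {s : Set ℝ} (hs : 0 < volume s) :
    0 < gaussianReal 0 1 s := by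
  refine pos_iff_ne_zero.2 fun h => hs.ne' ?_
  exact gaussianReal_absolutelyContinuous' 0 one_ne_zero h

theorem integrable_max_zero_gaussianReal (v : NNReal) :
    Integrable (fun x => max 0 x) (gaussianReal 0 v) :=
  (integrable_const (0 : ℝ)).sup (memLp_one_iff_integrable.1 (memLp_id_gaussianReal' 1 (by simp)))

theorem integral_max_zero_gaussianReal_pos : 0 < ∫ x, max 0 x ∂gaussianReal 0 1 := by
  rw [integral_pos_iff_support_of_nonneg (f := fun x : ℝ => max 0 x) (fun x => le_max_left _ _)
    (integrable_max_zero_gaussianReal 1)]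
  have : Function.support (fun x : ℝ => max 0 x) = Set.Ioi 0 := by
    ext x
    simp
  rw [this]
  exact gaussianReal_pos_of_volume_pos (by simp)

section Noise

variable {Ω : Type*} [MeasurableSpace Ω] {P : Measure Ω} [IsProbabilityMeasure P] {H : ℝ}
  {Y : ℕ → Ω → ℝ}

theorem variance_sum_range_of_fgnCov (hH : 1 / 2 ≤ H) (hG : IsGaussianProcess Y P)
    (hcov : ∀ k j, cov[Y k, Y (k + j); P] = fgnCov H j) (n : ℕ) :
    Var[fun ω => ∑ i ∈ Finset.range n, Y i ω; P] = (n : ℝ) ^ (2 * H) := by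
  have hmem : ∀ i, MemLp (Y i) 2 P := fun i => (hG.hasGaussianLaw_eval i).memLp_two
  induction n with
  | zero =>
    have : 2 * H ≠ 0 := by linarith
    simp [Real.zero_rpow this, variance_zero, ← Pi.zero_def]
  | succ n ih =>
    have h1 : Var[Y n; P] = 1 := by
      rw [← covariance_self (hmem n).aemeasurable, ← fgnCov_zero hH]
      exact hcov n 0
    have h2 : cov[fun ω => ∑ i ∈ Finset.range n, Y i ω, Y n; P] =
        ∑ j ∈ Finset.range n, fgnCov H (j + 1) := by
      rw [covariance_fun_sum_left' (fun i _ => hmem i) (hmem n),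
        ← Finset.sum_range_reflect (fun j => fgnCov H (j + 1))]
      refine Finset.sum_congr rfl fun i hi => ?_
      have hi' := Finset.mem_range.1 hi
      rw [← hcov i]
      congr 2
      omega
    simp only [Finset.sum_range_succ]
    rw [variance_fun_add (memLp_finsetSum _ fun i _ => hmem i) (hmem n), ih, h1, h2,
      sum_fgnCov_succ hH]
    push_cast
    ring

theorem map_sum_range_eq_gaussianReal (hH : 1 / 2 ≤ H) (hG : IsGaussianProcess Y P)
    (h0 : ∀ i, ∫ ω, Y i ω ∂P = 0)
    (hcov : ∀ k j, cov[Y k, Y (k + j); P] = fgnCov H j) (n : ℕ) :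
    P.map (fun ω => ∑ i ∈ Finset.range n, Y i ω) = gaussianReal 0 ((n : ℝ) ^ (2 * H)).toNNReal := by
  rw [hG.hasGaussianLaw_fun_sum.map_eq_gaussianReal, variance_sum_range_of_fgnCov hH hG hcov,
    integral_finsetSum _ fun i _ => (hG.hasGaussianLaw_eval i).integrable]
  simp [h0]

theorem integral_maxPartialSum_ge (hH : 1 / 2 ≤ H) (hG : IsGaussianProcess Y P)
    (h0 : ∀ i, ∫ ω, Y i ω ∂P = 0)
    (hcov : ∀ k j, cov[Y k, Y (k + j); P] = fgnCov H j) (n : ℕ) :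
    (∫ x, max 0 x ∂gaussianReal 0 1) * (n : ℝ) ^ H ≤
      ∫ ω, maxPartialSum n (fun i => Y i ω) ∂P := by
  have hlaw := map_sum_range_eq_gaussianReal hH hG h0 hcov n
  have hmeas : AEMeasurable (fun ω => ∑ i ∈ Finset.range n, Y i ω) P :=
    hG.hasGaussianLaw_fun_sum.aemeasurable
  have hsqrt : Real.sqrt ((n : ℝ) ^ (2 * H)).toNNReal = (n : ℝ) ^ H := by
    rw [Real.coe_toNNReal _ (by positivity), two_mul, Real.sqrt_eq_iff_mul_self_eq (by positivity)
      (by positivity), ← Real.rpow_add_of_nonneg (by positivity) (by linarith) (by linarith)]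
  have hYint := integrable_max_zero_gaussianReal ((n : ℝ) ^ (2 * H)).toNNReal
  have heq := integral_max_zero_gaussianReal ((n : ℝ) ^ (2 * H)).toNNReal
  rw [hsqrt, ← hlaw, integral_map hmeas (by fun_prop)] at heq
  rw [← hlaw] at hYint
  rw [mul_comm, ← heq]
  refine integral_mono (hYint.comp_aemeasurable hmeas)
    (integrable_maxPartialSum n fun i => (hG.hasGaussianLaw_eval i).integrable) fun ω => ?_
  exact max_le (maxPartialSum_nonneg n _) (sum_range_le_maxPartialSum le_rfl _)

theorem integral_maxPartialSum_le (hH : 1 / 2 ≤ H) (hG : IsGaussianProcess Y P)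
    (h0 : ∀ i, ∫ ω, Y i ω ∂P = 0)
    (hcov : ∀ k j, cov[Y k, Y (k + j); P] = fgnCov H j) {n : ℕ} (hn : 1 ≤ n) :
    ∫ ω, maxPartialSum n (fun i => Y i ω) ∂P ≤ (n : ℝ) ^ H * (Real.log (n + 1) + 2) := by
  have hnpos : (0 : ℝ) < n := by exact_mod_cast hn
  set t : ℝ := (n : ℝ) ^ (-H) with ht
  have htpos : 0 < t := Real.rpow_pos_of_pos hnpos _
  have htn : (n : ℝ) ^ H * t = 1 := by
    rw [ht, ← Real.rpow_add hnpos]; simp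
  have hlaw := map_sum_range_eq_gaussianReal hH hG h0 hcov
  have hexp : ∀ l, Integrable (fun ω => Real.exp (t * ∑ i ∈ Finset.range l, Y i ω)) P := by
    intro l
    have := integrable_exp_mul_gaussianReal (μ := 0) (v := ((l : ℝ) ^ (2 * H)).toNNReal) t
    rw [← hlaw l] at this
    exact this.comp_aemeasurable hG.hasGaussianLaw_fun_sum.aemeasurable
  have hmgf : ∀ l ∈ Finset.range (n + 1),
      ∫ ω, Real.exp (t * ∑ i ∈ Finset.range l, Y i ω) ∂P ≤ 2 := by
    intro l hl
    have hl' : (l : ℝ) ≤ n := by exact_mod_cast Nat.lt_succ_iff.1 (Finset.mem_range.1 hl)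
    have h1 := mgf_gaussianReal (hlaw l) t
    rw [mgf] at h1
    rw [h1, Real.coe_toNNReal _ (by positivity)]
    have h2 : (l : ℝ) ^ (2 * H) * t ^ 2 ≤ 1 := by
      calc (l : ℝ) ^ (2 * H) * t ^ 2 ≤ (n : ℝ) ^ (2 * H) * t ^ 2 := by gcongr
        _ = ((n : ℝ) ^ H * t) ^ 2 := by rw [two_mul, Real.rpow_add hnpos]; ring
        _ = 1 := by rw [htn, one_pow]
    calc Real.exp (0 * t + (l : ℝ) ^ (2 * H) * t ^ 2 / 2) ≤ Real.exp (Real.log 2) := by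
          gcongr
          linarith [Real.log_two_gt_d9]
      _ = 2 := Real.exp_log two_pos
  have hn1 : (0 : ℝ) < n + 1 := by positivity
  have hpt : ∀ ω, t * maxPartialSum n (fun i => Y i ω) ≤ Real.log (n + 1) +
      (∑ l ∈ Finset.range (n + 1), Real.exp (t * ∑ i ∈ Finset.range l, Y i ω)) / (n + 1) := by
    intro ω
    obtain ⟨l, hl, h⟩ := exists_maxPartialSum_eq n fun i => Y i ω
    have h1 := Finset.single_le_sum
      (f := fun l => Real.exp (t * ∑ i ∈ Finset.range l, Y i ω)) (fun _ _ => (Real.exp_pos _).le) hl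
    have h2 := Real.add_one_le_exp (t * (∑ i ∈ Finset.range l, Y i ω) - Real.log (n + 1))
    rw [Real.exp_sub, Real.exp_log hn1] at h2
    have h3 := div_le_div_of_nonneg_right h1 hn1.le
    rw [h]
    linarith
  have hmono : t * ∫ ω, maxPartialSum n (fun i => Y i ω) ∂P ≤ Real.log (n + 1) + 2 := by
    rw [← integral_const_mul]
    calc ∫ ω, t * maxPartialSum n (fun i => Y i ω) ∂P
        ≤ ∫ ω, (Real.log (n + 1) +
          (∑ l ∈ Finset.range (n + 1), Real.exp (t * ∑ i ∈ Finset.range l, Y i ω)) / (n + 1)) ∂P :=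
          integral_mono ((integrable_maxPartialSum n fun i =>
            (hG.hasGaussianLaw_eval i).integrable).const_mul _)
            ((integrable_const _).add ((integrable_finsetSum _ fun l _ => hexp l).div_const _)) hpt
      _ = Real.log (n + 1) + (∑ l ∈ Finset.range (n + 1),
          ∫ ω, Real.exp (t * ∑ i ∈ Finset.range l, Y i ω) ∂P) / (n + 1) := by
          rw [integral_add (integrable_const _)
            ((integrable_finsetSum _ fun l _ => hexp l).div_const _), integral_div,
            integral_finsetSum _ fun l _ => hexp l]
          simp
      _ ≤ Real.log (n + 1) + 2 := by
          gcongr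
          rw [div_le_iff₀ hn1]
          refine (Finset.sum_le_sum hmgf).trans ?_
          simp
          linarith
  calc ∫ ω, maxPartialSum n (fun i => Y i ω) ∂P
      = (n : ℝ) ^ H * (t * ∫ ω, maxPartialSum n (fun i => Y i ω) ∂P) := by
        rw [← mul_assoc, htn, one_mul]
    _ ≤ _ := by gcongr

end Noise

section Persistence

variable {Ω : Type*} [MeasurableSpace Ω] {P : Measure Ω} [IsProbabilityMeasure P] {H : ℝ}
  {Y : ℕ → Ω → ℝ}

theorem map_shift_eq_of_fgnCov (hG : IsGaussianProcess Y P) (hm : ∀ i, Measurable (Y i))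
    (h0 : ∀ i, ∫ ω, Y i ω ∂P = 0)
    (hcov : ∀ k j, cov[Y k, Y (k + j); P] = fgnCov H j) :
    P.map (fun ω i => Y (i + 1) ω) = P.map (fun ω i => Y i ω) := by
  refine IsGaussianProcess.map_eq_of_covariance_eq (hG.comp_right fun i => i + 1) hG
    (fun i => hm _) hm (fun i => by simp [h0]) fun s t => ?_
  have key : ∀ s t, s ≤ t → cov[Y (s + 1), Y (t + 1); P] = cov[Y s, Y t; P] := by
    intro s t hst
    obtain ⟨j, rfl⟩ := Nat.exists_eq_add_of_le hst
    rw [hcov, add_right_comm, hcov]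
  rcases le_total s t with h | h
  · exact key s t h
  · rw [covariance_comm, covariance_comm (Y s)]
    exact key t s h

/-- The probability that the first `n + 1` partial sums are nonpositive is controlled by the mean
negative part of their maximum, up to a truncation error. -/
theorem integral_max_neg_le (hG : IsGaussianProcess Y P) (hm : ∀ i, Measurable (Y i))
    (hY0 : P.map (Y 0) = gaussianReal 0 1) (n : ℕ) {L : ℝ} (hL : 0 ≤ L) :
    ∫ ω, max 0 (-(Y 0 ω + maxPartialSum n fun i => Y (i + 1) ω)) ∂P ≤
      L * P.real {ω | Y 0 ω + maxPartialSum n (fun i => Y (i + 1) ω) ≤ 0} +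
        2 * Real.exp 2 * Real.exp (-L) := by
  set D : Ω → ℝ := fun ω => Y 0 ω + maxPartialSum n fun i => Y (i + 1) ω
  have hDm : Measurable D :=
    (hm 0).add ((measurable_maxPartialSum n).comp (measurable_pi_lambda _ fun i => hm (i + 1)))
  have hYint : ∀ i, Integrable (Y i) P := fun i => (hG.hasGaussianLaw_eval i).integrable
  have hDi : Integrable D P := (hYint 0).add (integrable_maxPartialSum n fun i => hYint (i + 1))
  have hset : MeasurableSet {ω | D ω ≤ 0} := measurableSet_le hDm measurable_const
  have hexp : ∀ t : ℝ, Integrable (fun ω => Real.exp (t * Y 0 ω)) P := fun t => by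
    have := integrable_exp_mul_gaussianReal (μ := 0) (v := 1) t
    rw [← hY0] at this
    exact this.comp_measurable (hm 0)
  have hmgf : ∀ t : ℝ, ∫ ω, Real.exp (t * Y 0 ω) ∂P = Real.exp (t ^ 2 / 2) := fun t => by
    have := mgf_gaussianReal hY0 t
    rw [mgf] at this
    rw [this]
    simp
  have hpt : ∀ ω, max 0 (-D ω) ≤ {ω | D ω ≤ 0}.indicator (fun _ => L) ω +
      (Real.exp (2 * Y 0 ω) + Real.exp (-2 * Y 0 ω)) * Real.exp (-L) := by
    intro ω
    have hpos : 0 ≤ (Real.exp (2 * Y 0 ω) + Real.exp (-2 * Y 0 ω)) * Real.exp (-L) := by positivity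
    by_cases hD : D ω ≤ 0
    · rw [Set.indicator_of_mem (show ω ∈ {ω | D ω ≤ 0} from hD), max_eq_right (by linarith)]
      have h1 : -D ω ≤ -Y 0 ω := by
        have := maxPartialSum_nonneg n fun i => Y (i + 1) ω
        simp only [D]
        linarith
      rcases le_total (-Y 0 ω) L with h | h
      · linarith
      · have h2 := Real.add_one_le_exp (-Y 0 ω)
        have h3 : Real.exp (-Y 0 ω) ≤ Real.exp (-2 * Y 0 ω + -L) := by gcongr; linarith
        rw [Real.exp_add] at h3
        have h4 : 0 ≤ Real.exp (2 * Y 0 ω) * Real.exp (-L) := by positivity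
        rw [add_mul]
        linarith
    · rw [Set.indicator_of_notMem (show ω ∉ {ω | D ω ≤ 0} from hD), max_eq_left (by linarith)]
      linarith
  have hi1 : Integrable ({ω | D ω ≤ 0}.indicator fun _ => L) P :=
    (integrable_const L).indicator hset
  have hi2 : Integrable (fun ω => (Real.exp (2 * Y 0 ω) + Real.exp (-2 * Y 0 ω)) * Real.exp (-L)) P :=
    ((hexp 2).add (hexp (-2))).mul_const _
  calc ∫ ω, max 0 (-D ω) ∂P
      ≤ ∫ ω, ({ω | D ω ≤ 0}.indicator (fun _ => L) ω +
        (Real.exp (2 * Y 0 ω) + Real.exp (-2 * Y 0 ω)) * Real.exp (-L)) ∂P :=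
        integral_mono ((integrable_const (0 : ℝ)).sup hDi.neg) (hi1.add hi2) hpt
    _ = L * P.real {ω | D ω ≤ 0} + 2 * Real.exp 2 * Real.exp (-L) := by
        rw [integral_add hi1 hi2, integral_indicator_const _ hset, integral_mul_const,
          integral_add (hexp 2) (hexp (-2)), hmgf, hmgf]
        norm_num
        ring

/-- Conditioning the walk to start with a step below `-1` costs at most a constant factor. -/
theorem measureReal_mul_le_integral_max_neg (hH : 1 / 2 ≤ H) (hG : IsGaussianProcess Y P)
    (hm : ∀ i, Measurable (Y i)) (h0 : ∀ i, ∫ ω, Y i ω ∂P = 0)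
    (hcov : ∀ k j, cov[Y k, Y (k + j); P] = fgnCov H j) (n : ℕ) :
    P.real {ω | Y 0 ω ≤ -1} *
        P.real {ω | Y 0 ω + maxPartialSum n (fun i => Y (i + 1) ω) ≤ 0} ≤
      ∫ ω, max 0 (-(Y 0 ω + maxPartialSum (n + 1) fun i => Y (i + 1) ω)) ∂P := by
  have hYint : ∀ i, Integrable (Y i) P := fun i => (hG.hasGaussianLaw_eval i).integrable
  have hmem : ∀ i, MemLp (Y i) 2 P := fun i => (hG.hasGaussianLaw_eval i).memLp_two
  let V : Fin (n + 1) → Ω → ℝ := fun k ω => ∑ i ∈ Finset.range (k + 1), Y (i + 1) ω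
  have hV : ∀ ω, (∀ k, V k ω ≤ 0) ↔
      Y 1 ω + maxPartialSum n (fun i => Y (i + 1 + 1) ω) ≤ 0 := fun ω => by
    rw [add_maxPartialSum_le_iff n (fun i => Y (i + 1) ω)]
    exact ⟨fun h k hk => h ⟨k, by omega⟩, fun h k => h k (by omega)⟩
  have hshift : P.real {ω | Y 1 ω + maxPartialSum n (fun i => Y (i + 1 + 1) ω) ≤ 0} =
      P.real {ω | Y 0 ω + maxPartialSum n (fun i => Y (i + 1) ω) ≤ 0} := by
    have hs : MeasurableSet {x : ℕ → ℝ | x 0 + maxPartialSum n (fun i => x (i + 1)) ≤ 0} :=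
      measurableSet_le ((measurable_pi_apply 0).add ((measurable_maxPartialSum n).comp
        (measurable_pi_lambda _ fun i => measurable_pi_apply (i + 1)))) measurable_const
    have := congrArg (fun μ => μ.real {x : ℕ → ℝ | x 0 + maxPartialSum n (fun i => x (i + 1)) ≤ 0})
      (map_shift_eq_of_fgnCov hG hm h0 hcov)
    rwa [map_measureReal_apply (measurable_pi_lambda _ fun i => hm (i + 1)) hs,
      map_measureReal_apply (measurable_pi_lambda _ hm) hs] at this
  have hGV : IsGaussianProcess (Sum.elim (fun _ : Unit => Y 0) V) P := by
    refine hG.of_isGaussianProcess ?_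
    rintro (u | k)
    · exact ⟨{0}, .proj ⟨0, by simp⟩, fun ω => rfl⟩
    · refine ⟨(Finset.range (k + 1)).map (addRightEmbedding 1), ∑ i, .proj i, fun ω => ?_⟩
      simp only [Sum.elim_inr, V, sum_apply, ContinuousLinearMap.proj_apply,
        Finset.restrict]
      rw [Finset.sum_coe_sort _ fun i => Y i ω, Finset.sum_map]
      rfl
  have hpos := measureReal_mul_le_of_covariance_nonneg (V := V) (hm 0)
    (fun k => Finset.measurable_fun_sum _ fun i _ => hm (i + 1)) hGV
    ((hcov 0 0).trans (fgnCov_zero hH)) fun k => by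
      simp only [V]
      rw [covariance_fun_sum_right' (fun i _ => hmem (i + 1)) (hmem 0)]
      refine Finset.sum_nonneg fun i _ => ?_
      have := hcov 0 (i + 1)
      rw [zero_add] at this
      rw [this]
      exact fgnCov_nonneg hH _
  simp only [hV, hshift] at hpos
  refine hpos.trans ?_
  set F : Set Ω := {ω | Y 0 ω ≤ -1 ∧ Y 1 ω + maxPartialSum n (fun i => Y (i + 1 + 1) ω) ≤ 0}
  have hF : MeasurableSet F :=
    (measurableSet_le (hm 0) measurable_const).inter
      (measurableSet_le ((hm 1).add ((measurable_maxPartialSum n).comp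
        (measurable_pi_lambda _ fun i => hm (i + 1 + 1)))) measurable_const)
  have hF1 : ∫ ω, F.indicator (fun _ => (1 : ℝ)) ω ∂P = P.real F := by
    rw [integral_indicator_const _ hF, smul_eq_mul, mul_one]
  rw [← hF1]
  refine integral_mono ((integrable_const _).indicator hF) ((integrable_const (0 : ℝ)).sup
    ((hYint 0).add (integrable_maxPartialSum (n + 1) fun i => hYint (i + 1))).neg) fun ω => ?_
  by_cases hω : ω ∈ F
  · have h2 : maxPartialSum (n + 1) (fun i => Y (i + 1) ω) = 0 := max_eq_left hω.2
    have h3 : F.indicator (fun _ => (1 : ℝ)) ω = 1 := Set.indicator_of_mem hω _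
    rw [h3]
    refine le_max_of_le_right ?_
    simp only [h2]
    linarith [hω.1]
  · rw [Set.indicator_of_notMem hω]
    exact le_max_left _ _

/-- Persistence bounds for the partial sums of fractional Gaussian noise indexed from `0`. -/
theorem exists_persistence_bounds (hH : H ∈ Set.Ico (1 / 2 : ℝ) 1) (hG : IsGaussianProcess Y P)
    (hm : ∀ i, Measurable (Y i)) (h0 : ∀ i, ∫ ω, Y i ω ∂P = 0)
    (hcov : ∀ k j, cov[Y k, Y (k + j); P] = fgnCov H j) :
    ∃ c > (0 : ℝ), ∃ T₀ : ℕ, ∀ T ≥ T₀, 1 ≤ T ∧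
      (T : ℝ) ^ (-(1 - H)) * Real.log T ^ (-c) ≤
          P.real {ω | Y 0 ω + maxPartialSum (T - 1) (fun i => Y (i + 1) ω) ≤ 0} ∧
        P.real {ω | Y 0 ω + maxPartialSum (T - 1) (fun i => Y (i + 1) ω) ≤ 0} ≤
          (T : ℝ) ^ (-(1 - H)) * Real.log T ^ c := by
  have hYint : ∀ i, Integrable (Y i) P := fun i => (hG.hasGaussianLaw_eval i).integrable
  have hY0 : P.map (Y 0) = gaussianReal 0 1 := by
    simpa using map_sum_range_eq_gaussianReal hH.1 hG h0 hcov 1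
  have hD : ∀ n, Integrable (fun ω => Y 0 ω + maxPartialSum n fun i => Y (i + 1) ω) P :=
    fun n => (hYint 0).add (integrable_maxPartialSum n fun i => hYint (i + 1))
  have hb : ∀ n, Integrable
      (fun ω => max 0 (-(Y 0 ω + maxPartialSum n fun i => Y (i + 1) ω))) P :=
    fun n => (integrable_const (0 : ℝ)).sup (hD n).neg
  have hp : 0 < P.real {ω | Y 0 ω ≤ -1} := by
    have h1 : P.real {ω | Y 0 ω ≤ -1} = (P.map (Y 0)).real (Set.Iic (-1)) :=
      (map_measureReal_apply (hm 0) measurableSet_Iic).symm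
    rw [h1, hY0]
    exact ENNReal.toReal_pos (gaussianReal_pos_of_volume_pos (by simp)).ne' (measure_ne_top _ _)
  refine exists_log_bounds hH integral_max_zero_gaussianReal_pos hp
    (e := fun n => ∫ ω, maxPartialSum n (fun i => Y i ω) ∂P)
    (b := fun n => ∫ ω, max 0 (-(Y 0 ω + maxPartialSum n fun i => Y (i + 1) ω)) ∂P)
    (q := fun n => P.real {ω | Y 0 ω + maxPartialSum n (fun i => Y (i + 1) ω) ≤ 0})
    (by simp [maxPartialSum]) (fun n => ?_) (antitone_nat_of_succ_le fun n => ?_)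
    (fun n => integral_nonneg fun ω => le_max_left _ _)
    (integral_maxPartialSum_ge hH.1 hG h0 hcov)
    (fun n hn => integral_maxPartialSum_le hH.1 hG h0 hcov hn)
    (fun n L hL => integral_max_neg_le hG hm hY0 n hL)
    (measureReal_mul_le_integral_max_neg hH.1 hG hm h0 hcov)
  · have hshift : ∫ ω, maxPartialSum n (fun i => Y (i + 1) ω) ∂P =
        ∫ ω, maxPartialSum n (fun i => Y i ω) ∂P := by
      have := congrArg (fun μ => ∫ x, maxPartialSum n x ∂μ) (map_shift_eq_of_fgnCov hG hm h0 hcov)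
      rwa [integral_map (measurable_pi_lambda _ fun i => hm (i + 1)).aemeasurable
          (measurable_maxPartialSum n).aestronglyMeasurable,
        integral_map (measurable_pi_lambda _ hm).aemeasurable
          (measurable_maxPartialSum n).aestronglyMeasurable] at this
    have hsum : ∫ ω, (Y 0 ω + maxPartialSum n fun i => Y (i + 1) ω) ∂P =
        ∫ ω, maxPartialSum n (fun i => Y i ω) ∂P := by
      rw [integral_add (hYint 0) (integrable_maxPartialSum n fun i => hYint (i + 1)), h0, zero_add,
        hshift]
    rw [← hsum, ← integral_add (hD n) (hb n)]
    refine integral_congr_ae (ae_of_all _ fun ω => ?_)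
    have key : ∀ d : ℝ, max 0 d = d + max 0 (-d) := fun d => by
      rcases le_total d 0 with h | h <;> simp [h]
    exact key _
  · refine integral_mono (hb _) (hb _) fun ω => ?_
    have := maxPartialSum_le_succ n fun i => Y (i + 1) ω
    exact max_le_max le_rfl (by linarith)

end Persistence

/-- Fix `H ∈ [1/2, 1)`.  Let `(X_i)_{i ≥ 1}` be fractional Gaussian noise with Hurst
parameter `H`: a stationary centered Gaussian sequence with `E[X_i²] = 1` and
correlations `E[X_k X_{k+j}] = r j := ((j+1)^{2H} + |j-1|^{2H} - 2 j^{2H}) / 2`.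
Let `Z_n = ∑_{i=1}^n X_i`.  Then there are `c > 0` and `T₀` such that for all `T ≥ T₀`,
`T^{-(1-H)} (log T)^{-c} ≤ P[max_{k=1,…,T} Z_k ≤ 0] ≤ T^{-(1-H)} (log T)^c`. -/
theorem stmt3
    {Ω : Type*} [MeasurableSpace Ω] (P : Measure Ω) [IsProbabilityMeasure P]
    (H : ℝ) (hH : H ∈ Set.Ico (1 / 2 : ℝ) 1)
    (X : ℕ → Ω → ℝ) (hXmeas : ∀ i, Measurable (X i))
    (hgauss : ∀ s : Finset ℕ, (∀ i ∈ s, 1 ≤ i) → ∀ c : ℕ → ℝ,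
      ∃ v : NNReal,
        Measure.map (fun ω => ∑ i ∈ s, c i * X i ω) P = gaussianReal 0 v)
    (hXvar : ∀ i, 1 ≤ i → ∫ ω, X i ω ^ 2 ∂P = 1)
    (hrcov : ∀ k, 1 ≤ k → ∀ j : ℕ,
      ∫ ω, X k ω * X (k + j) ω ∂P =
        (((j : ℝ) + 1) ^ (2 * H) + |(j : ℝ) - 1| ^ (2 * H) - 2 * (j : ℝ) ^ (2 * H)) / 2)
    (Z : ℕ → Ω → ℝ) (hZ : ∀ n ω, Z n ω = ∑ i ∈ Finset.Icc 1 n, X i ω) :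
    ∃ c > (0 : ℝ), ∃ T₀ : ℕ, ∀ T ≥ T₀,
      (T : ℝ) ^ (-(1 - H)) * Real.log T ^ (-c) ≤
          (P {ω | ∀ k ∈ Finset.Icc 1 T, Z k ω ≤ 0}).toReal ∧
        (P {ω | ∀ k ∈ Finset.Icc 1 T, Z k ω ≤ 0}).toReal ≤
          (T : ℝ) ^ (-(1 - H)) * Real.log T ^ c := by
  have hY0 : ∀ i, 1 ≤ i → ∫ ω, X i ω ∂P = 0 := fun i hi => by
    obtain ⟨v, hv⟩ := hgauss {i} (by simpa using hi) fun _ => 1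
    simp only [Finset.sum_singleton, one_mul] at hv
    rw [← integral_map (f := fun x => x) (hXmeas i).aemeasurable (by fun_prop), hv,
      integral_id_gaussianReal]
  have hG : IsGaussianProcess (fun i => X (i + 1)) P := by
    refine isGaussianProcess_of_forall_sum (fun i => hXmeas _) fun s c => ?_
    obtain ⟨v, hv⟩ := hgauss (s.map (addRightEmbedding 1)) (by simp) fun i => c (i - 1)
    exact ⟨v, by simpa [Finset.sum_map] using hv⟩
  have hcov : ∀ k j, cov[X (k + 1), X (k + j + 1); P] = fgnCov H j := fun k j => by
    rw [covariance_eq_sub (hG.hasGaussianLaw_eval k).memLp_two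
      (hG.hasGaussianLaw_eval (k + j)).memLp_two, hY0 _ (by omega), zero_mul, sub_zero,
      add_right_comm]
    exact hrcov (k + 1) (by omega) j
  obtain ⟨c, hc, T₀, h⟩ := exists_persistence_bounds hH hG (fun i => hXmeas _)
    (fun i => hY0 _ (by omega)) hcov
  refine ⟨c, hc, T₀, fun T hT => ?_⟩
  obtain ⟨hT1, hT⟩ := h T hT
  have hset : {ω | ∀ k ∈ Finset.Icc 1 T, Z k ω ≤ 0} =
      {ω | X (0 + 1) ω + maxPartialSum (T - 1) (fun i => X (i + 1 + 1) ω) ≤ 0} := by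
    ext ω
    have hsum : ∀ k, Z (k + 1) ω = ∑ i ∈ Finset.range (k + 1), X (i + 1) ω := fun k => by
      rw [hZ, Finset.range_eq_Ico, Finset.sum_Ico_add' (fun i => X i ω) 0 (k + 1) 1]
      rfl
    simp only [Set.mem_ofPred_eq]
    rw [add_maxPartialSum_le_iff (T - 1) fun i => X (i + 1) ω]
    constructor
    · intro h k hk
      rw [← hsum]
      exact h (k + 1) (Finset.mem_Icc.2 (by omega))
    · intro h k hk
      obtain ⟨hk1, hk2⟩ := Finset.mem_Icc.1 hk
      obtain ⟨m, rfl⟩ := Nat.exists_eq_add_of_le' hk1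
      rw [hsum]
      exact h m (by omega)
  rw [hset]
  exact hT
end

section
/- Let n:ℕ→ℕ₊ satisfy log n(T)/log T → 0 as T→∞. Then for all T, P[max_{k=1,...,T} Z_k ≤ 0] ≤ P[τ_T < n(T)], and for every ε>0 there exists T₀ such that for all T≥T₀: P[τ_T < n(T)] ≤ T^{ε} · P[max_{k=1,...,T} Z_k ≤ 0]. -/
open MeasureTheory Filter ProbabilityTheory

open Matrix in
/-- A sum of linear images of two independent centered Gaussian vectors is centered Gaussian. -/
lemma map_add_prod_multivariateGaussian {ι : Type*} [Fintype ι] [DecidableEq ι]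
    {S S' : Matrix ι ι ℝ} (hS : S.PosSemidef) (hS' : S'.PosSemidef) (L L' : Matrix ι ι ℝ) :
    ((multivariateGaussian 0 S).prod (multivariateGaussian 0 S')).map
        (fun p => toEuclideanCLM (𝕜 := ℝ) L p.1 + toEuclideanCLM (𝕜 := ℝ) L' p.2)
      = multivariateGaussian 0 (L * S * Lᵀ + L' * S' * L'ᵀ) := by
  have hP : (L * S * Lᵀ + L' * S' * L'ᵀ).PosSemidef := by
    simpa [conjTranspose_eq_transpose_of_trivial] using
      (hS.mul_mul_conjTranspose_same L).add (hS'.mul_mul_conjTranspose_same L')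
  have hm : Measurable (fun p : EuclideanSpace ℝ ι × EuclideanSpace ℝ ι =>
      toEuclideanCLM (𝕜 := ℝ) L p.1 + toEuclideanCLM (𝕜 := ℝ) L' p.2) := by fun_prop
  have := Measure.isProbabilityMeasure_map hm.aemeasurable
    (μ := (multivariateGaussian 0 S).prod (multivariateGaussian 0 S'))
  have hinner (M : Matrix ι ι ℝ) (x t : EuclideanSpace ℝ ι) :
      inner ℝ (toEuclideanCLM (𝕜 := ℝ) M x) t
        = inner ℝ x (toEuclideanCLM (𝕜 := ℝ) Mᵀ t) := by
    simp [EuclideanSpace.inner_eq_star_dotProduct, dotProduct_mulVec, mulVec_transpose]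
  apply Measure.ext_of_charFun
  ext t
  rw [charFun_multivariateGaussian hP, charFun_apply, integral_map hm.aemeasurable (by fun_prop)]
  simp_rw [inner_add_left, hinner, Complex.ofReal_add, add_mul, Complex.exp_add]
  rw [integral_prod_mul (fun x => Complex.exp (↑(inner ℝ x (toEuclideanCLM (𝕜 := ℝ) Lᵀ t))
      * Complex.I)) (fun x => Complex.exp (↑(inner ℝ x (toEuclideanCLM (𝕜 := ℝ) L'ᵀ t))
      * Complex.I)), ← charFun_apply, ← charFun_apply, charFun_multivariateGaussian hS,
    charFun_multivariateGaussian hS', ← Complex.exp_add]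
  congr 1
  have hq (M N : Matrix ι ι ℝ) (t : ι → ℝ) :
      t ⬝ᵥ (M * N * Mᵀ) *ᵥ t = (Mᵀ *ᵥ t) ⬝ᵥ N *ᵥ (Mᵀ *ᵥ t) := by
    rw [mulVec_mulVec, mulVec_transpose, ← dotProduct_mulVec, mulVec_mulVec, mul_assoc]
  simp [add_mulVec, hq]
  ring

/-- The Chebyshev association inequality. -/
lemma integral_mul_integral_le_of_comonotone {Ω : Type*} [MeasurableSpace Ω] {μ : Measure Ω}
    [IsProbabilityMeasure μ] {f g : Ω → ℝ} (hf : Integrable f μ) (hg : Integrable g μ)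
    (hfg : Integrable (fun x => f x * g x) μ) (h : ∀ x y, 0 ≤ (f x - f y) * (g x - g y)) :
    (∫ x, f x ∂μ) * ∫ x, g x ∂μ ≤ ∫ x, f x * g x ∂μ := by
  have h1 (x : Ω) : (∫ y, f y ∂μ) * g x + f x * ∫ y, g y ∂μ
      ≤ f x * g x + ∫ y, f y * g y ∂μ := by
    have h0 : 0 ≤ ∫ y, (f x * g x - f x * g y - (f y * g x - f y * g y)) ∂μ :=
      integral_nonneg fun y => by
        have := h x y
        simp only [Pi.zero_apply]
        linarith
    have i1 : Integrable (fun y => f x * g x - f x * g y) μ :=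
      (integrable_const _).sub (hg.const_mul _)
    have i2 : Integrable (fun y => f y * g x - f y * g y) μ := (hf.mul_const _).sub hfg
    rw [integral_sub i1 i2, integral_sub (integrable_const _) (hg.const_mul _),
      integral_sub (hf.mul_const _) hfg, integral_mul_const (g x) f,
      integral_const_mul (f x) g] at h0
    simp at h0
    linarith
  have h2 := integral_mono ((hg.const_mul (∫ y, f y ∂μ)).add (hf.mul_const (∫ y, g y ∂μ)))
    (hfg.add (integrable_const (∫ y, f y * g y ∂μ))) h1
  simp only [Pi.add_apply] at h2
  rw [integral_add (hg.const_mul _) (hf.mul_const _), integral_add hfg (integrable_const _),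
    integral_const_mul, integral_mul_const] at h2
  simp at h2
  linarith

/-- A continuous `[0,1]`-valued function on a Euclidean space which is antitone in the
coordinates belonging to `A` and does not depend on the other ones. -/
structure IsAntitoneCutoff {ι : Type*} (A : Set ι) (F : EuclideanSpace ℝ ι → ℝ) : Prop where
  continuous : Continuous F
  nonneg : ∀ x, 0 ≤ F x
  le_one : ∀ x, F x ≤ 1
  anti : ∀ x y, (∀ i ∈ A, x i ≤ y i) → F y ≤ F x

lemma IsAntitoneCutoff.congr {ι : Type*} {A : Set ι} {F : EuclideanSpace ℝ ι → ℝ}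
    (hF : IsAntitoneCutoff A F) {x y : EuclideanSpace ℝ ι} (h : ∀ i ∈ A, x i = y i) : F x = F y :=
  le_antisymm (hF.anti _ _ fun i hi => (h i hi).ge) (hF.anti _ _ fun i hi => (h i hi).le)

lemma integrable_of_mem_unitInterval {Ω : Type*} [MeasurableSpace Ω] {μ : Measure Ω}
    [IsFiniteMeasure μ] {f : Ω → ℝ} (hm : AEStronglyMeasurable f μ) (h0 : ∀ x, 0 ≤ f x)
    (h1 : ∀ x, f x ≤ 1) : Integrable f μ :=
  Integrable.of_bound hm 1 (ae_of_all _ fun x => by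
    rw [Real.norm_eq_abs, abs_of_nonneg (h0 x)]; exact h1 x)

set_option maxHeartbeats 1000000 in
open Matrix in
/-- Replacing independent Gaussian noise on two coordinates by common noise increases
`∫ F * G`. -/
lemma integral_mul_le_add_common_noise {ι : Type*} [Fintype ι] [DecidableEq ι] {A : Set ι}
    {F G : EuclideanSpace ℝ ι → ℝ} (hF : IsAntitoneCutoff A F) (hG : IsAntitoneCutoff Aᶜ G)
    {B : Matrix ι ι ℝ} (hB : B.PosSemidef) {i j : ι} (hi : i ∈ A) (hj : j ∉ A) {s : ℝ}
    (hs : 0 ≤ s) :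
    ∫ x, F x * G x ∂multivariateGaussian 0 (B + (single i i s + single j j s))
      ≤ ∫ x, F x * G x ∂multivariateGaussian 0
          (B + (single i i s + single j j s + (single i j s + single j i s))) := by
  have h1 : (1 : Matrix ι ι ℝ).PosSemidef := PosSemidef.one
  set L := single i i √s with hL
  set L' := single j i √s with hL'
  have hs2 : √s * √s = s := Real.mul_self_sqrt hs
  have hP1 : (B + single i i s).PosSemidef := by
    have h : single i i s = diagonal (Pi.single i s) := (diagonal_single i s).symm
    rw [h]
    exact hB.add (PosSemidef.diagonal (by
      intro k; simp only [Pi.zero_apply, Pi.single_apply]; split_ifs <;> simp [hs]))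
  have e1 := map_add_prod_multivariateGaussian hB h1 1 L
  have e2 := map_add_prod_multivariateGaussian hP1 h1 1 L'
  have e3 := map_add_prod_multivariateGaussian hB h1 1 (L + L')
  have a1 : L * 1 * Lᵀ = single i i s := by simp [hL, transpose_single, hs2]
  have a2 : L' * 1 * L'ᵀ = single j j s := by simp [hL', transpose_single, hs2]
  have a3 : (L + L') * 1 * (L + L')ᵀ
      = single i i s + single j j s + (single i j s + single j i s) := by
    simp [hL, hL', transpose_single, add_mul, mul_add, hs2]
    abel
  rw [a1] at e1
  rw [a2] at e2
  rw [a3] at e3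
  simp only [map_one, one_mul, transpose_one, mul_one] at e1 e2 e3
  have hcF := hF.continuous
  have hcG := hG.continuous
  have hLi (y : EuclideanSpace ℝ ι) (k : ι) :
      toEuclideanCLM (𝕜 := ℝ) L y k = if k = i then √s * y i else 0 := by
    simp [hL, single_mulVec, Function.update_apply]
  have hLj (y : EuclideanSpace ℝ ι) (k : ι) :
      toEuclideanCLM (𝕜 := ℝ) L' y k = if k = j then √s * y i else 0 := by
    simp [hL', single_mulVec, Function.update_apply]
  rw [← add_assoc, ← e2, ← e3, integral_map (by fun_prop) (by fun_prop),
    integral_map (by fun_prop) (by fun_prop)]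
  have hint {α : Type _} [MeasurableSpace α] (μ : Measure α) [IsFiniteMeasure μ]
      {φ : α → EuclideanSpace ℝ ι} (hφ : Measurable φ) :
      Integrable (fun a => F (φ a) * G (φ a)) μ :=
    integrable_of_mem_unitInterval (by fun_prop)
      (fun a => mul_nonneg (hF.nonneg _) (hG.nonneg _))
      (fun a => mul_le_one₀ (hF.le_one _) (hG.nonneg _) (hG.le_one _))
  set ν := multivariateGaussian (0 : EuclideanSpace ℝ ι) (1 : Matrix ι ι ℝ)
  have hsL : 0 ≤ √s := Real.sqrt_nonneg s
  set g : EuclideanSpace ℝ ι → ℝ := fun w => ∫ z, G (w + toEuclideanCLM (𝕜 := ℝ) L' z) ∂ν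
  have hgm : Measurable g :=
    (StronglyMeasurable.integral_prod_right (f := fun w z => G (w + toEuclideanCLM (𝕜 := ℝ) L' z))
      (Continuous.stronglyMeasurable (by fun_prop))).measurable
  have hg0 (w) : 0 ≤ g w := integral_nonneg fun z => hG.nonneg _
  have hg1 (w) : g w ≤ 1 := by
    refine (integral_mono (integrable_of_mem_unitInterval (by fun_prop)
      (fun z => hG.nonneg _) (fun z => hG.le_one _)) (integrable_const 1)
      fun z => hG.le_one _).trans ?_
    simp
  have hFg {α : Type _} [MeasurableSpace α] (μ : Measure α) [IsFiniteMeasure μ]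
      {φ : α → EuclideanSpace ℝ ι} (hφ : Measurable φ) :
      Integrable (fun a => F (φ a) * g (φ a)) μ :=
    integrable_of_mem_unitInterval
      ((hcF.measurable.comp hφ).mul (hgm.comp hφ)).aestronglyMeasurable
      (fun a => mul_nonneg (hF.nonneg _) (hg0 _))
      (fun a => mul_le_one₀ (hF.le_one _) (hg0 _) (hg1 _))
  have lhs : ∫ p : EuclideanSpace ℝ ι × EuclideanSpace ℝ ι,
        F ((1 : EuclideanSpace ℝ ι →L[ℝ] EuclideanSpace ℝ ι) p.1
            + toEuclideanCLM (𝕜 := ℝ) L' p.2) *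
          G ((1 : EuclideanSpace ℝ ι →L[ℝ] EuclideanSpace ℝ ι) p.1
            + toEuclideanCLM (𝕜 := ℝ) L' p.2)
        ∂((multivariateGaussian 0 (B + single i i s)).prod ν)
      = ∫ x, (∫ y, F (x + toEuclideanCLM (𝕜 := ℝ) L y) ∂ν) * g x ∂multivariateGaussian 0 B := by
    have hFw (w z : EuclideanSpace ℝ ι) : F (w + toEuclideanCLM (𝕜 := ℝ) L' z) = F w := by
      refine hF.congr fun k hk => ?_
      rw [PiLp.add_apply, hLj, if_neg (ne_of_mem_of_not_mem hk hj), add_zero]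
    have hgw (x y : EuclideanSpace ℝ ι) : g (x + toEuclideanCLM (𝕜 := ℝ) L y) = g x := by
      refine integral_congr_ae (ae_of_all _ fun z => hG.congr fun k hk => ?_)
      rw [PiLp.add_apply, PiLp.add_apply, PiLp.add_apply, hLi,
        if_neg (ne_of_mem_of_not_mem hi hk).symm, add_zero]
    rw [integral_prod _ (hint _ (by fun_prop))]
    simp only [one_apply_eq_self, hFw, integral_const_mul]
    change ∫ w, F w * g w ∂_ = _
    have hFgm : Measurable (fun w => F w * g w) := hcF.measurable.mul hgm
    rw [← e1, integral_map (by fun_prop) hFgm.aestronglyMeasurable,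
      integral_prod _ (hFg _ (by fun_prop))]
    simp only [one_apply_eq_self, hgw, integral_mul_const]
  rw [lhs, integral_prod _ (hint _ (by fun_prop))]
  simp only [one_apply_eq_self]
  refine integral_mono_of_nonneg (ae_of_all _ fun x =>
    mul_nonneg (integral_nonneg fun y => hF.nonneg _) (hg0 x))
    (hint _ (φ := fun p : EuclideanSpace ℝ ι × EuclideanSpace ℝ ι =>
      p.1 + toEuclideanCLM (𝕜 := ℝ) (L + L') p.2) (by fun_prop)).integral_prod_left
    (ae_of_all _ fun x => ?_)
  have hFL (y : EuclideanSpace ℝ ι) : F (x + toEuclideanCLM (𝕜 := ℝ) (L + L') y)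
      = F (x + toEuclideanCLM (𝕜 := ℝ) L y) := by
    refine hF.congr fun k hk => ?_
    rw [map_add, _root_.add_apply, PiLp.add_apply, PiLp.add_apply, PiLp.add_apply,
      hLj, if_neg (ne_of_mem_of_not_mem hk hj), add_zero]
  have hGL (y : EuclideanSpace ℝ ι) : G (x + toEuclideanCLM (𝕜 := ℝ) (L + L') y)
      = G (x + toEuclideanCLM (𝕜 := ℝ) L' y) := by
    refine hG.congr fun k hk => ?_
    rw [map_add, _root_.add_apply, PiLp.add_apply, PiLp.add_apply, PiLp.add_apply,
      hLi, if_neg (ne_of_mem_of_not_mem hi hk).symm, zero_add]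
  simp only [hFL, hGL]
  refine integral_mul_integral_le_of_comonotone
    (integrable_of_mem_unitInterval (by fun_prop) (fun z => hF.nonneg _) (fun z => hF.le_one _))
    (integrable_of_mem_unitInterval (by fun_prop) (fun z => hG.nonneg _) (fun z => hG.le_one _))
    (integrable_of_mem_unitInterval (by fun_prop)
      (fun a => mul_nonneg (hF.nonneg _) (hG.nonneg _))
      (fun a => mul_le_one₀ (hF.le_one _) (hG.nonneg _) (hG.le_one _))) fun y z => ?_
  have hmono (y z : EuclideanSpace ℝ ι) (h : y i ≤ z i) :
      F (x + toEuclideanCLM (𝕜 := ℝ) L z) ≤ F (x + toEuclideanCLM (𝕜 := ℝ) L y) ∧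
      G (x + toEuclideanCLM (𝕜 := ℝ) L' z) ≤ G (x + toEuclideanCLM (𝕜 := ℝ) L' y) := by
    have h' := mul_le_mul_of_nonneg_left h hsL
    constructor
    · refine hF.anti _ _ fun k _ => ?_
      rw [PiLp.add_apply, PiLp.add_apply, hLi, hLi]
      split_ifs <;> linarith
    · refine hG.anti _ _ fun k _ => ?_
      rw [PiLp.add_apply, PiLp.add_apply, hLj, hLj]
      split_ifs <;> linarith
  rcases le_total (y i) (z i) with h | h
  · obtain ⟨h1, h2⟩ := hmono y z h
    exact mul_nonneg (sub_nonneg.2 h1) (sub_nonneg.2 h2)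
  · obtain ⟨h1, h2⟩ := hmono z y h
    exact mul_nonneg_of_nonpos_of_nonpos (sub_nonpos.2 h1) (sub_nonpos.2 h2)

open Matrix in
lemma integral_mul_le_add_common_noise_sum {ι : Type*} [Fintype ι] [DecidableEq ι] {A : Set ι}
    {F G : EuclideanSpace ℝ ι → ℝ} (hF : IsAntitoneCutoff A F) (hG : IsAntitoneCutoff Aᶜ G)
    (c : ι × ι → ℝ) (T : Finset (ι × ι)) (hT : ∀ p ∈ T, p.1 ∈ A ∧ p.2 ∉ A ∧ 0 ≤ c p)
    {B : Matrix ι ι ℝ} (hB : B.PosSemidef) :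
    ∫ x, F x * G x ∂multivariateGaussian 0
        (B + ∑ p ∈ T, (single p.1 p.1 (c p) + single p.2 p.2 (c p)))
      ≤ ∫ x, F x * G x ∂multivariateGaussian 0
          (B + ∑ p ∈ T, (single p.1 p.1 (c p) + single p.2 p.2 (c p)
            + (single p.1 p.2 (c p) + single p.2 p.1 (c p)))) := by
  induction T using Finset.induction_on generalizing B with
  | empty => simp
  | insert p T hp ih =>
    obtain ⟨h1, h2, h3⟩ := hT p (Finset.mem_insert_self p T)
    have hT' : ∀ q ∈ T, q.1 ∈ A ∧ q.2 ∉ A ∧ 0 ≤ c q :=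
      fun q hq => hT q (Finset.mem_insert_of_mem hq)
    have hd (i : ι) {a : ℝ} (ha : 0 ≤ a) : (single i i a).PosSemidef := by
      rw [← diagonal_single]
      exact PosSemidef.diagonal (by
        intro k; simp only [Pi.zero_apply, Pi.single_apply]; split_ifs <;> simp [ha])
    have hpair (q : ι × ι) {a : ℝ} (ha : 0 ≤ a) : (single q.1 q.1 a + single q.2 q.2 a
        + (single q.1 q.2 a + single q.2 q.1 a)).PosSemidef := by
      have hs : √a * √a = a := Real.mul_self_sqrt ha
      have h := posSemidef_self_mul_conjTranspose
        (single q.1 q.1 √a + single q.2 q.1 √a : Matrix ι ι ℝ)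
      convert h using 1
      simp [conjTranspose_eq_transpose_of_trivial, transpose_single, add_mul, mul_add, hs]
      abel
    rw [Finset.sum_insert hp, Finset.sum_insert hp, ← add_assoc]
    refine (ih hT' (hB.add ((hd p.1 h3).add (hd p.2 h3)))).trans ?_
    have hB' : (B + ∑ q ∈ T, (single q.1 q.1 (c q) + single q.2 q.2 (c q)
        + (single q.1 q.2 (c q) + single q.2 q.1 (c q)))).PosSemidef :=
      hB.add (posSemidef_sum _ fun q hq => hpair q (hT' q hq).2.2)
    have := integral_mul_le_add_common_noise hF hG hB' h1 h2 h3
    convert! this using 3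
    · rw [add_right_comm]
    · rw [← add_assoc, add_right_comm]

open Matrix Topology in
lemma tendsto_integral_multivariateGaussian_add_smul_one {ι : Type*} [Fintype ι] [DecidableEq ι]
    {S : Matrix ι ι ℝ} (hS : S.PosSemidef) {f : EuclideanSpace ℝ ι → ℝ} (hf : Continuous f)
    (h0 : ∀ x, 0 ≤ f x) (h1 : ∀ x, f x ≤ 1) :
    Tendsto (fun n : ℕ => ∫ x, f x ∂multivariateGaussian 0 (((n : ℝ) + 1)⁻¹ • 1 + S)) atTop
      (𝓝 (∫ x, f x ∂multivariateGaussian 0 S)) := by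
  have hn (n : ℕ) : ((((n : ℝ) + 1)⁻¹ • 1 : Matrix ι ι ℝ) + S).PosSemidef :=
    (PosSemidef.one.smul (by positivity)).add hS
  let μ (M : Matrix ι ι ℝ) : ProbabilityMeasure (EuclideanSpace ℝ ι) :=
    ⟨multivariateGaussian 0 M, inferInstance⟩
  have key : Tendsto (fun n : ℕ => μ (((n : ℝ) + 1)⁻¹ • 1 + S)) atTop (𝓝 (μ S)) := by
    refine ProbabilityMeasure.tendsto_iff_tendsto_charFun.2 fun t => ?_
    simp only [μ, ProbabilityMeasure.coe_mk, charFun_multivariateGaussian (hn _),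
      charFun_multivariateGaussian hS]
    refine (Complex.continuous_exp.tendsto _).comp (Tendsto.sub tendsto_const_nhds
      (Tendsto.div_const ((Complex.continuous_ofReal.tendsto _).comp ?_) 2))
    have hlim : Tendsto (fun n : ℕ => ((n : ℝ) + 1)⁻¹) atTop (𝓝 0) := by
      simpa using tendsto_one_div_add_atTop_nhds_zero_nat (𝕜 := ℝ)
    have := (hlim.mul_const (t.ofLp ⬝ᵥ t.ofLp)).add_const (t.ofLp ⬝ᵥ S *ᵥ t.ofLp)
    simpa [add_mulVec, smul_mulVec] using this
  have := (ProbabilityMeasure.tendsto_iff_forall_integral_tendsto.1 key)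
    (BoundedContinuousFunction.ofNormedAddCommGroup f hf 1
      (fun x => by rw [Real.norm_eq_abs, abs_of_nonneg (h0 x)]; exact h1 x))
  simpa [μ] using this

open Matrix Topology in
/-- Positively correlated blocks of a centered Gaussian vector are associated. -/
theorem integral_mul_integral_le_multivariateGaussian {ι : Type*} [Fintype ι] [DecidableEq ι]
    {A : Set ι} {F G : EuclideanSpace ℝ ι → ℝ} (hF : IsAntitoneCutoff A F)
    (hG : IsAntitoneCutoff Aᶜ G) {S : Matrix ι ι ℝ} (hS : S.PosSemidef)
    (hpos : ∀ i j, 0 ≤ S i j) :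
    (∫ x, F x ∂multivariateGaussian 0 S) * ∫ x, G x ∂multivariateGaussian 0 S
      ≤ ∫ x, F x * G x ∂multivariateGaussian 0 S := by
  classical
  have hcF := hF.continuous
  have hcG := hG.continuous
  set P : Matrix ι ι ℝ := diagonal (fun i => if i ∈ A then 1 else 0) with hP
  set Q : Matrix ι ι ℝ := diagonal (fun i => if i ∈ A then 0 else 1) with hQ
  set S₀ := P * S * Pᵀ + Q * S * Qᵀ with hS₀
  have hS₀pos : S₀.PosSemidef := by
    simpa [conjTranspose_eq_transpose_of_trivial] using
      (hS.mul_mul_conjTranspose_same P).add (hS.mul_mul_conjTranspose_same Q)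
  have hfactor : ∫ x, F x * G x ∂multivariateGaussian 0 S₀
      = (∫ x, F x ∂multivariateGaussian 0 S) * ∫ x, G x ∂multivariateGaussian 0 S := by
    rw [hS₀, ← map_add_prod_multivariateGaussian hS hS P Q, integral_map (by fun_prop)
      (by fun_prop), ← integral_prod_mul]
    refine integral_congr_ae (ae_of_all _ fun p => ?_)
    refine congrArg₂ (· * ·) ?_ ?_
    · refine hF.congr fun i hi => ?_
      simp [hP, hQ, mulVec_diagonal, hi]
    · refine hG.congr fun i hi => ?_
      have hi' : i ∉ A := hi
      simp [hP, hQ, mulVec_diagonal, hi']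
  set T : Finset (ι × ι) := Finset.univ.filter fun p => p.1 ∈ A ∧ p.2 ∉ A with hT
  set O : Matrix ι ι ℝ :=
    ∑ p ∈ T, (single p.1 p.2 (S p.1 p.2) + single p.2 p.1 (S p.1 p.2)) with hO
  set D : Matrix ι ι ℝ :=
    ∑ p ∈ T, (single p.1 p.1 (S p.1 p.2) + single p.2 p.2 (S p.1 p.2)) with hD
  have hsplit : S₀ + O = S := by
    have hsymm (a b : ι) : S b a = S a b := by simpa using hS.isHermitian.apply a b
    have hOab (a b : ι) : O a b = (if a ∈ A ∧ b ∉ A then S a b else 0)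
        + (if b ∈ A ∧ a ∉ A then S b a else 0) := by
      have h1 : ∀ p : ι × ι, (if p.1 ∈ A ∧ p.2 ∉ A then
          (if p.1 = a ∧ p.2 = b then S p.1 p.2 else 0) else 0)
          = if p = (a, b) then (if a ∈ A ∧ b ∉ A then S a b else 0) else 0 := by
        rintro ⟨x, y⟩
        by_cases h : (x, y) = (a, b)
        · obtain ⟨rfl, rfl⟩ := Prod.mk.inj h
          simp
        · have : ¬ (x = a ∧ y = b) := fun h' => h (by rw [h'.1, h'.2])
          simp [h, this]
      have h2 : ∀ p : ι × ι, (if p.1 ∈ A ∧ p.2 ∉ A then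
          (if p.2 = a ∧ p.1 = b then S p.1 p.2 else 0) else 0)
          = if p = (b, a) then (if b ∈ A ∧ a ∉ A then S b a else 0) else 0 := by
        rintro ⟨x, y⟩
        by_cases h : (x, y) = (b, a)
        · obtain ⟨rfl, rfl⟩ := Prod.mk.inj h
          simp
        · have : ¬ (y = a ∧ x = b) := fun h' => h (by rw [h'.1, h'.2])
          simp [h, this]
      rw [hO, Finset.sum_add_distrib, Matrix.add_apply, Matrix.sum_apply, Matrix.sum_apply, hT,
        Finset.sum_filter, Finset.sum_filter]
      simp only [single_apply, h1, h2, Finset.sum_ite_eq', Finset.mem_univ, if_true]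
    ext a b
    rw [Matrix.add_apply, hOab, hS₀]
    by_cases ha : a ∈ A <;> by_cases hb : b ∈ A <;>
      simp [hP, hQ, ha, hb, hsymm a b]
  obtain ⟨d, hd⟩ : ∃ d : ι → ℝ, D = diagonal d := by
    refine ⟨∑ p ∈ T, (Pi.single p.1 (S p.1 p.2) + Pi.single p.2 (S p.1 p.2)), ?_⟩
    rw [hD, ← diagonalAddMonoidHom_apply, map_sum]
    refine Finset.sum_congr rfl fun p _ => ?_
    rw [diagonalAddMonoidHom_apply, ← diagonal_single, ← diagonal_single, diagonal_add]
    rfl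
  have hreg (η : ℝ) (hη : 0 < η) :
      ∫ x, F x * G x ∂multivariateGaussian 0 (η • 1 + S₀)
        ≤ ∫ x, F x * G x ∂multivariateGaussian 0 (η • 1 + S) := by
    obtain ⟨N, hN⟩ := exists_nat_gt ((∑ i, |d i|) / η)
    have hsum : 0 ≤ ∑ i, |d i| := Finset.sum_nonneg fun i _ => abs_nonneg _
    have hN0 : (0 : ℝ) < N := lt_of_le_of_lt (by positivity) hN
    have hdiag : (η • 1 - (N : ℝ)⁻¹ • D).PosSemidef := by
      have : η • 1 - (N : ℝ)⁻¹ • D = diagonal (fun i => η - (N : ℝ)⁻¹ * d i) := by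
        rw [hd, ← diagonal_one, ← diagonal_smul, ← diagonal_smul, diagonal_sub]
        congr 1
        ext i
        simp
      rw [this]
      refine PosSemidef.diagonal fun i => ?_
      have h1 : d i ≤ ∑ i, |d i| := (le_abs_self _).trans
        (Finset.single_le_sum (f := fun i => |d i|) (fun i _ => abs_nonneg _) (Finset.mem_univ i))
      have h2 : ∑ i, |d i| ≤ N * η := ((div_lt_iff₀ hη).1 hN).le
      have h3 : (N : ℝ)⁻¹ * d i ≤ η := by
        rw [inv_mul_le_iff₀ hN0]
        exact h1.trans h2
      simpa using h3
    have hstep : ∀ k ≤ N, ∫ x, F x * G x ∂multivariateGaussian 0 (η • 1 + S₀)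
        ≤ ∫ x, F x * G x ∂multivariateGaussian 0 (η • 1 + S₀ + ((k : ℝ) * (N : ℝ)⁻¹) • O) := by
      intro k
      induction k with
      | zero => intro _; simp
      | succ k ih =>
        intro hk
        refine (ih (by omega)).trans ?_
        have hk' : (k : ℝ) * (N : ℝ)⁻¹ ≤ 1 := by
          rw [mul_inv_le_iff₀ hN0, one_mul]
          exact_mod_cast (by omega : k ≤ N)
        have hconv : (S₀ + ((k : ℝ) * (N : ℝ)⁻¹) • O).PosSemidef := by
          have h := (hS₀pos.smul (sub_nonneg.2 hk')).add
            (hS.smul (by positivity : 0 ≤ (k : ℝ) * (N : ℝ)⁻¹))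
          convert h using 1
          rw [← hsplit]
          module
        have h := integral_mul_le_add_common_noise_sum hF hG
          (fun p => (N : ℝ)⁻¹ * S p.1 p.2) T (fun p hp => by
            have := (Finset.mem_filter.1 hp).2
            exact ⟨this.1, this.2, mul_nonneg (by positivity) (hpos _ _)⟩) (hdiag.add hconv)
        have e1 : ∑ p ∈ T, (single p.1 p.1 ((N : ℝ)⁻¹ * S p.1 p.2)
            + single p.2 p.2 ((N : ℝ)⁻¹ * S p.1 p.2)) = (N : ℝ)⁻¹ • D := by
          simp [hD, Finset.smul_sum]
        have e2 : ∑ p ∈ T, (single p.1 p.2 ((N : ℝ)⁻¹ * S p.1 p.2)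
            + single p.2 p.1 ((N : ℝ)⁻¹ * S p.1 p.2)) = (N : ℝ)⁻¹ • O := by
          simp [hO, Finset.smul_sum]
        rw [Finset.sum_add_distrib (s := T)
          (f := fun p => single p.1 p.1 ((N : ℝ)⁻¹ * S p.1 p.2)
            + single p.2 p.2 ((N : ℝ)⁻¹ * S p.1 p.2)), e1, e2] at h
        convert! h using 3
        · module
        · push_cast
          module
    have := hstep N le_rfl
    rwa [mul_inv_cancel₀ hN0.ne', one_smul, add_assoc, hsplit] at this
  rw [← hfactor]
  have hb0 (x) : 0 ≤ F x * G x := mul_nonneg (hF.nonneg _) (hG.nonneg _)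
  have hb1 (x) : F x * G x ≤ 1 := mul_le_one₀ (hF.le_one _) (hG.nonneg _) (hG.le_one _)
  exact le_of_tendsto_of_tendsto'
    (tendsto_integral_multivariateGaussian_add_smul_one hS₀pos (by fun_prop) hb0 hb1)
    (tendsto_integral_multivariateGaussian_add_smul_one hS (by fun_prop) hb0 hb1)
    fun n => hreg _ (by positivity)

open Topology in
lemma tendsto_integral_of_tendsto_indicator {Ω : Type*} [MeasurableSpace Ω] {μ : Measure Ω}
    [IsProbabilityMeasure μ] {f : ℕ → Ω → ℝ} {E : Set Ω} (hf : ∀ n, AEStronglyMeasurable (f n) μ)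
    (h0 : ∀ n x, 0 ≤ f n x) (h1 : ∀ n x, f n x ≤ 1) (hE : MeasurableSet E)
    (h : ∀ x, Tendsto (fun n => f n x) atTop (𝓝 (E.indicator 1 x))) :
    Tendsto (fun n => ∫ x, f n x ∂μ) atTop (𝓝 (μ.real E)) := by
  rw [← integral_indicator_one hE]
  exact tendsto_integral_of_dominated_convergence (fun _ => 1) hf (integrable_const 1)
    (fun n => ae_of_all _ fun x => by
      rw [Real.norm_eq_abs, abs_of_nonneg (h0 n x)]; exact h1 n x)
    (ae_of_all _ h)

/-- An exponential cutoff approximating the indicator of the event that the sums over `s l`,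
`l ∈ κ`, are all nonpositive. -/
noncomputable def expCutoff {ι : Type*} (κ : Finset ℕ) (s : ℕ → Finset ι) (n : ℕ)
    (x : EuclideanSpace ℝ ι) : ℝ :=
  Real.exp (-((n : ℝ) * ∑ l ∈ κ, max 0 (∑ i ∈ s l, x i)))

lemma isAntitoneCutoff_expCutoff {ι : Type*} [Fintype ι] {κ : Finset ℕ} {s : ℕ → Finset ι}
    {A : Set ι} (h : ∀ l ∈ κ, ∀ i ∈ s l, i ∈ A) (n : ℕ) :
    IsAntitoneCutoff A (expCutoff κ s n) where
  continuous := by unfold expCutoff; fun_prop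
  nonneg x := Real.exp_nonneg _
  le_one x := Real.exp_le_one_iff.2 (neg_nonpos.2
    (mul_nonneg (Nat.cast_nonneg n) (Finset.sum_nonneg fun l _ => le_max_left _ _)))
  anti x y hxy := by
    refine Real.exp_le_exp.2 (neg_le_neg (mul_le_mul_of_nonneg_left ?_ (Nat.cast_nonneg n)))
    exact Finset.sum_le_sum fun l hl => max_le_max_left 0
      (Finset.sum_le_sum fun i hi => hxy i (h l hl i hi))

open Topology in
lemma tendsto_expCutoff {ι : Type*} (κ : Finset ℕ) (s : ℕ → Finset ι) (x : EuclideanSpace ℝ ι) :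
    Tendsto (fun n => expCutoff κ s n x) atTop
      (𝓝 ({x : EuclideanSpace ℝ ι | ∀ l ∈ κ, ∑ i ∈ s l, x i ≤ 0}.indicator 1 x)) := by
  by_cases hx : ∀ l ∈ κ, ∑ i ∈ s l, x i ≤ 0
  · rw [Set.indicator_of_mem (show x ∈ {x : EuclideanSpace ℝ ι | ∀ l ∈ κ, ∑ i ∈ s l, x i ≤ 0}
      from hx)]
    have : ∑ l ∈ κ, max 0 (∑ i ∈ s l, x i) = 0 :=
      Finset.sum_eq_zero fun l hl => max_eq_left (hx l hl)
    simp [expCutoff, this]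
  · rw [Set.indicator_of_notMem (show x ∉ {x : EuclideanSpace ℝ ι | ∀ l ∈ κ, ∑ i ∈ s l, x i ≤ 0}
      from hx)]
    push Not at hx
    obtain ⟨l, hl, hlx⟩ := hx
    have hpos : 0 < ∑ l ∈ κ, max 0 (∑ i ∈ s l, x i) :=
      Finset.sum_pos' (fun l _ => le_max_left _ _) ⟨l, hl, lt_max_of_lt_right hlx⟩
    exact Real.tendsto_exp_neg_atTop_nhds_zero.comp
      (tendsto_natCast_atTop_atTop.atTop_mul_const hpos)

lemma measurableSet_sums_nonpos {ι : Type*} [Fintype ι] (κ : Finset ℕ) (s : ℕ → Finset ι) :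
    MeasurableSet {x : EuclideanSpace ℝ ι | ∀ l ∈ κ, ∑ i ∈ s l, x i ≤ 0} := by
  simp only [Set.ofPred_forall]
  exact Finset.measurableSet_biInter κ fun l _ =>
    measurableSet_le (by fun_prop) measurable_const

/-- Persistence events for disjoint blocks of a Gaussian vector with nonnegative covariances are
positively correlated. -/
theorem multivariateGaussian_real_mul_le_real_inter {ι : Type*} [Fintype ι] [DecidableEq ι]
    {A : Set ι} {κ κ' : Finset ℕ} {s t : ℕ → Finset ι} (hs : ∀ l ∈ κ, ∀ i ∈ s l, i ∈ A)
    (ht : ∀ l ∈ κ', ∀ i ∈ t l, i ∉ A) {S : Matrix ι ι ℝ} (hS : S.PosSemidef)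
    (hpos : ∀ i j, 0 ≤ S i j) :
    (multivariateGaussian 0 S).real {x | ∀ l ∈ κ, ∑ i ∈ s l, x i ≤ 0}
        * (multivariateGaussian 0 S).real {x | ∀ l ∈ κ', ∑ i ∈ t l, x i ≤ 0}
      ≤ (multivariateGaussian 0 S).real ({x | ∀ l ∈ κ, ∑ i ∈ s l, x i ≤ 0}
          ∩ {x | ∀ l ∈ κ', ∑ i ∈ t l, x i ≤ 0}) := by
  have hF := isAntitoneCutoff_expCutoff hs
  have hG := isAntitoneCutoff_expCutoff (A := Aᶜ) ht
  refine le_of_tendsto_of_tendsto'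
    ((tendsto_integral_of_tendsto_indicator
      (fun n => (hF n).continuous.aestronglyMeasurable) (fun n => (hF n).nonneg)
      (fun n => (hF n).le_one) (measurableSet_sums_nonpos κ s) (tendsto_expCutoff κ s)).mul
     (tendsto_integral_of_tendsto_indicator
      (fun n => (hG n).continuous.aestronglyMeasurable) (fun n => (hG n).nonneg)
      (fun n => (hG n).le_one) (measurableSet_sums_nonpos κ' t) (tendsto_expCutoff κ' t)))
    (tendsto_integral_of_tendsto_indicator
      (fun n => ((hF n).continuous.mul (hG n).continuous).aestronglyMeasurable)
      (fun n x => mul_nonneg ((hF n).nonneg x) ((hG n).nonneg x))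
      (fun n x => mul_le_one₀ ((hF n).le_one x) ((hG n).nonneg x) ((hG n).le_one x))
      ((measurableSet_sums_nonpos κ s).inter (measurableSet_sums_nonpos κ' t)) fun x => ?_)
    fun n => integral_mul_integral_le_multivariateGaussian (hF n) (hG n) hS hpos
  rw [Set.inter_indicator_one]
  exact (tendsto_expCutoff κ s x).mul (tendsto_expCutoff κ' t x)

/-- A stationary centered Gaussian sequence `(X_i)_{i ≥ 1}` with nonnegative correlations `r`. -/
structure IsStationaryGaussianSeq {Ω : Type*} [MeasurableSpace Ω] (P : Measure Ω)
    (X : ℕ → Ω → ℝ) (r : ℕ → ℝ) : Prop where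
  measurable : ∀ i, Measurable (X i)
  gaussian : ∀ s : Finset ℕ, (∀ i ∈ s, 1 ≤ i) → ∀ c : ℕ → ℝ,
    ∃ v : NNReal, Measure.map (fun ω => ∑ i ∈ s, c i * X i ω) P = gaussianReal 0 v
  nonneg : ∀ j, 0 ≤ r j
  cov : ∀ k, 1 ≤ k → ∀ j, ∫ ω, X k ω * X (k + j) ω ∂P = r j

namespace IsStationaryGaussianSeq

variable {Ω : Type*} [MeasurableSpace Ω] {P : Measure Ω} {X : ℕ → Ω → ℝ} {r : ℕ → ℝ}

lemma memLp_two (hX : IsStationaryGaussianSeq P X r) {i : ℕ} (hi : 1 ≤ i) : MemLp (X i) 2 P := by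
  obtain ⟨v, hv⟩ := hX.gaussian {i} (by simpa using hi) 1
  have hv' : P.map (X i) = gaussianReal 0 v := by simpa using hv
  have h := memLp_id_gaussianReal (μ := 0) (v := v) 2
  rw [← hv', memLp_map_measure_iff (by fun_prop) (hX.measurable i).aemeasurable] at h
  simpa using h

lemma integral_mul (hX : IsStationaryGaussianSeq P X r) {i j : ℕ} (hi : 1 ≤ i) (hj : 1 ≤ j) :
    ∫ ω, X i ω * X j ω ∂P = r ((i : ℤ) - j).natAbs := by
  rcases le_total i j with h | h
  · obtain ⟨k, rfl⟩ := Nat.exists_eq_add_of_le h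
    rw [hX.cov i hi k]
    congr 1
    omega
  · obtain ⟨k, rfl⟩ := Nat.exists_eq_add_of_le h
    simp_rw [mul_comm (X (j + k) _)]
    rw [hX.cov j hj k]
    congr 1
    omega

open Matrix in
lemma map_linearCombination (hX : IsStationaryGaussianSeq P X r) {m : ℕ} {σ : Fin m → ℕ}
    (hσ : Function.Injective σ) (hσ1 : ∀ i, 1 ≤ σ i) (t : Fin m → ℝ) :
    ∃ v : NNReal, P.map (fun ω => ∑ i, t i * X (σ i) ω) = gaussianReal 0 v ∧
      (v : ℝ) = t ⬝ᵥ (of fun i j => r ((σ i : ℤ) - σ j).natAbs) *ᵥ t := by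
  obtain ⟨v, hv⟩ := hX.gaussian (Finset.univ.image σ) (by simpa using hσ1) (Function.extend σ t 0)
  have hsum (ω : Ω) : ∑ i ∈ Finset.univ.image σ, Function.extend σ t 0 i * X i ω
      = ∑ i, t i * X (σ i) ω := by
    rw [Finset.sum_image (fun a _ b _ h => hσ h)]
    simp [hσ.extend_apply]
  simp_rw [hsum] at hv
  refine ⟨v, hv, ?_⟩
  have hm : Measurable (fun ω => ∑ i, t i * X (σ i) ω) := by
    have := hX.measurable
    fun_prop
  have h2 : ∫ x, x ^ 2 ∂(gaussianReal 0 v) = v := by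
    have := variance_id_gaussianReal (μ := 0) (v := v)
    rw [variance_eq_sub (by simpa using memLp_id_gaussianReal (μ := 0) (v := v) 2)] at this
    simpa using this
  rw [← h2, ← hv, integral_map hm.aemeasurable (by fun_prop)]
  have hint (i j : Fin m) : Integrable (fun ω => t i * t j * (X (σ i) ω * X (σ j) ω)) P :=
    ((hX.memLp_two (hσ1 i)).integrable_mul (hX.memLp_two (hσ1 j))).const_mul _
  have hexp (ω : Ω) : (∑ i, t i * X (σ i) ω) ^ 2
      = ∑ i, ∑ j, t i * t j * (X (σ i) ω * X (σ j) ω) := by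
    rw [sq, Finset.sum_mul_sum]
    exact Finset.sum_congr rfl fun i _ => Finset.sum_congr rfl fun j _ => by ring
  simp_rw [hexp]
  rw [integral_finsetSum _ fun i _ => integrable_finsetSum _ fun j _ => hint i j]
  simp_rw [dotProduct, mulVec, dotProduct, Finset.mul_sum]
  refine Finset.sum_congr rfl fun i _ => ?_
  rw [integral_finsetSum _ fun j _ => hint i j]
  refine Finset.sum_congr rfl fun j _ => ?_
  rw [integral_const_mul, hX.integral_mul (hσ1 i) (hσ1 j), of_apply]
  ring

open Matrix in
lemma posSemidef (hX : IsStationaryGaussianSeq P X r) (m : ℕ) :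
    (of fun i j : Fin m => r ((i : ℤ) - j).natAbs).PosSemidef := by
  refine PosSemidef.of_dotProduct_mulVec_nonneg ?_ fun t => ?_
  · ext i j
    simp only [conjTranspose_apply, of_apply, star_trivial]
    congr 1
    omega
  · obtain ⟨v, -, hv⟩ := hX.map_linearCombination (σ := fun i : Fin m => (i : ℕ) + 1)
      (fun a b h => Fin.ext (by simpa using h)) (fun i => by omega) t
    simp only [Nat.cast_add, Nat.cast_one, add_sub_add_right_eq_sub] at hv
    rw [star_trivial, ← hv]
    exact v.2

open Matrix in
lemma map_eq_multivariateGaussian [IsProbabilityMeasure P] (hX : IsStationaryGaussianSeq P X r)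
    {m : ℕ} {σ : ℕ → ℕ}
    (hσ : ∀ i < m, ∀ j < m, ((σ i : ℤ) - σ j).natAbs = ((i : ℤ) - j).natAbs)
    (hσ1 : ∀ i < m, 1 ≤ σ i) {c : ℝ} (hc : c * c = 1) :
    P.map (fun ω => WithLp.toLp 2 (fun i : Fin m => c * X (σ i) ω))
      = multivariateGaussian 0 (of fun i j : Fin m => r ((i : ℤ) - j).natAbs) := by
  have := hX.measurable
  have hm : Measurable (fun ω => WithLp.toLp 2 (fun i : Fin m => c * X (σ i) ω)) := by
    fun_prop
  have := Measure.isProbabilityMeasure_map hm.aemeasurable (μ := P)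
  apply Measure.ext_of_charFun
  ext t
  rw [charFun_multivariateGaussian (hX.posSemidef m), charFun_apply,
    integral_map hm.aemeasurable (by fun_prop)]
  obtain ⟨v, hv, hv'⟩ := hX.map_linearCombination (σ := fun i : Fin m => σ i)
    (fun a b h => Fin.ext (by have := hσ a a.2 b b.2; simp only at h; rw [h] at this; omega))
    (fun i => hσ1 i i.2) (fun i => c * t i)
  have hcf := charFun_gaussianReal (μ := 0) (v := v) 1
  rw [← hv, charFun_apply, integral_map (by fun_prop) (by fun_prop)] at hcf
  have hq : (v : ℝ) = t.ofLp ⬝ᵥ (of fun i j : Fin m => r ((i : ℤ) - j).natAbs) *ᵥ t.ofLp := by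
    rw [hv']
    simp only [dotProduct, mulVec, of_apply, Finset.mul_sum]
    refine Finset.sum_congr rfl fun i _ => Finset.sum_congr rfl fun j _ => ?_
    rw [hσ i i.2 j j.2]
    linear_combination (t i * r ((i : ℤ) - j).natAbs * t j) * hc
  rw [← hq]
  convert! hcf using 1
  · refine integral_congr_ae (ae_of_all _ fun ω => ?_)
    simp [PiLp.inner_apply, mul_comm, mul_left_comm, mul_assoc]
  · simp

lemma sum_filter_fin_lt {m l : ℕ} (hl : l ≤ m) (f : ℕ → ℝ) :
    ∑ i ∈ ({i : Fin m | (i : ℕ) < l} : Finset (Fin m)), f i = ∑ i ∈ Finset.range l, f i := by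
  rw [Finset.sum_filter, Fin.sum_univ_eq_sum_range (fun i => if i < l then f i else 0) m,
    ← Finset.sum_filter]
  congr 1
  ext i
  simp only [Finset.mem_filter, Finset.mem_range]
  omega

lemma sum_filter_fin_le_lt {m n l : ℕ} (hl : l ≤ n) (f : ℕ → ℝ) :
    ∑ i ∈ ({i : Fin (m + n) | m ≤ (i : ℕ) ∧ (i : ℕ) < m + l} : Finset (Fin (m + n))), f i
      = ∑ i ∈ Finset.range l, f (m + i) := by
  rw [Finset.sum_filter,
    Fin.sum_univ_eq_sum_range (fun i => if m ≤ i ∧ i < m + l then f i else 0) (m + n),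
    Finset.sum_range_add, Finset.sum_eq_zero, zero_add]
  · simp only [le_add_iff_nonneg_right, zero_le, true_and, add_lt_add_iff_left]
    rw [← Finset.sum_filter]
    congr 1
    ext i
    simp only [Finset.mem_filter, Finset.mem_range]
    omega
  · intro i hi
    rw [if_neg]
    simp only [Finset.mem_range] at hi
    omega

/-- The persistence probability only depends on the covariance structure. -/
lemma prob_partialSums_nonpos [IsProbabilityMeasure P] (hX : IsStationaryGaussianSeq P X r)
    {m : ℕ} {σ : ℕ → ℕ}
    (hσ : ∀ i < m, ∀ j < m, ((σ i : ℤ) - σ j).natAbs = ((i : ℤ) - j).natAbs)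
    (hσ1 : ∀ i < m, 1 ≤ σ i) {c : ℝ} (hc : c * c = 1) :
    P {ω | ∀ l ∈ Finset.Icc 1 m, ∑ i ∈ Finset.range l, c * X (σ i) ω ≤ 0}
      = P {ω | ∀ l ∈ Finset.Icc 1 m, ∑ i ∈ Finset.range l, X (i + 1) ω ≤ 0} := by
  have hmeas := hX.measurable
  have key {σ : ℕ → ℕ} (hσ : ∀ i < m, ∀ j < m, ((σ i : ℤ) - σ j).natAbs = ((i : ℤ) - j).natAbs)
      (hσ1 : ∀ i < m, 1 ≤ σ i) {c : ℝ} (hc : c * c = 1) :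
      P {ω | ∀ l ∈ Finset.Icc 1 m, ∑ i ∈ Finset.range l, c * X (σ i) ω ≤ 0}
        = multivariateGaussian 0 (Matrix.of fun i j : Fin m => r ((i : ℤ) - j).natAbs)
          {x | ∀ l ∈ Finset.Icc 1 m,
            ∑ i ∈ ({i : Fin m | (i : ℕ) < l} : Finset (Fin m)), x i ≤ 0} := by
    rw [← hX.map_eq_multivariateGaussian hσ hσ1 hc, Measure.map_apply (by fun_prop)
      (measurableSet_sums_nonpos (Finset.Icc 1 m) fun l => {i : Fin m | (i : ℕ) < l})]
    congr 1
    ext ω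
    refine forall₂_congr fun l hl => ?_
    rw [← sum_filter_fin_lt (Finset.mem_Icc.1 hl).2 (fun i => c * X (σ i) ω)]
  rw [key hσ hσ1 hc, ← key (σ := fun i => i + 1) (c := 1) (by intros; push_cast; congr 1; ring)
    (by intros; omega) (one_mul 1)]
  simp

/-- Supermultiplicativity of the persistence probability. -/
lemma prob_mul_le_prob_add [IsProbabilityMeasure P] (hX : IsStationaryGaussianSeq P X r)
    (m n : ℕ) :
    P.real {ω | ∀ l ∈ Finset.Icc 1 m, ∑ i ∈ Finset.range l, X (i + 1) ω ≤ 0}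
        * P.real {ω | ∀ l ∈ Finset.Icc 1 n, ∑ i ∈ Finset.range l, X (i + 1) ω ≤ 0}
      ≤ P.real {ω | ∀ l ∈ Finset.Icc 1 (m + n), ∑ i ∈ Finset.range l, X (i + 1) ω ≤ 0} := by
  have hmeas := hX.measurable
  have hlaw := hX.map_eq_multivariateGaussian (m := m + n) (σ := fun i => i + 1) (c := 1)
    (by intros; push_cast; congr 1; ring) (by intros; omega) (one_mul 1)
  simp only [one_mul] at hlaw
  have hms := measurableSet_sums_nonpos (Finset.Icc 1 m)
    fun l => {i : Fin (m + n) | (i : ℕ) < l}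
  have hmt := measurableSet_sums_nonpos (Finset.Icc 1 n)
    fun l => {i : Fin (m + n) | m ≤ (i : ℕ) ∧ (i : ℕ) < m + l}
  have h := multivariateGaussian_real_mul_le_real_inter
    (A := {i : Fin (m + n) | (i : ℕ) < m}) (κ := Finset.Icc 1 m) (κ' := Finset.Icc 1 n)
    (s := fun l => {i : Fin (m + n) | (i : ℕ) < l})
    (t := fun l => {i : Fin (m + n) | m ≤ (i : ℕ) ∧ (i : ℕ) < m + l})
    (fun l hl i hi => by
      simp only [Finset.mem_filter, Finset.mem_univ, true_and] at hi
      exact lt_of_lt_of_le hi (Finset.mem_Icc.1 hl).2)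
    (fun l hl i hi => by
      simp only [Finset.mem_filter, Finset.mem_univ, true_and] at hi
      exact not_lt.2 hi.1)
    (hX.posSemidef (m + n)) (fun i j => hX.nonneg _)
  have hshift := hX.prob_partialSums_nonpos (m := n) (σ := fun i => m + i + 1) (c := 1)
    (by intros; push_cast; congr 1; ring) (by intros; omega) (one_mul 1)
  simp only [one_mul] at hshift
  rw [← hlaw, map_measureReal_apply (by fun_prop) hms, map_measureReal_apply (by fun_prop) hmt,
    map_measureReal_apply (by fun_prop) (hms.inter hmt)] at h
  have e1 : (fun ω => WithLp.toLp 2 (fun i : Fin (m + n) => X ((i : ℕ) + 1) ω)) ⁻¹'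
      {x | ∀ l ∈ Finset.Icc 1 m,
        ∑ i ∈ ({i : Fin (m + n) | (i : ℕ) < l} : Finset (Fin (m + n))), x i ≤ 0}
      = {ω | ∀ l ∈ Finset.Icc 1 m, ∑ i ∈ Finset.range l, X (i + 1) ω ≤ 0} := by
    ext ω
    refine forall₂_congr fun l hl => ?_
    rw [← sum_filter_fin_lt (m := m + n) ((Finset.mem_Icc.1 hl).2.trans (by omega))
      (fun i => X (i + 1) ω)]
  have e2 : (fun ω => WithLp.toLp 2 (fun i : Fin (m + n) => X ((i : ℕ) + 1) ω)) ⁻¹'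
      {x | ∀ l ∈ Finset.Icc 1 n,
        ∑ i ∈ ({i : Fin (m + n) | m ≤ (i : ℕ) ∧ (i : ℕ) < m + l} : Finset (Fin (m + n))), x i ≤ 0}
      = {ω | ∀ l ∈ Finset.Icc 1 n, ∑ i ∈ Finset.range l, X (m + i + 1) ω ≤ 0} := by
    ext ω
    refine forall₂_congr fun l hl => ?_
    rw [← sum_filter_fin_le_lt (Finset.mem_Icc.1 hl).2 (fun i => X (i + 1) ω)]
  rw [Set.preimage_inter, e1, e2, measureReal_def P {ω | ∀ l ∈ Finset.Icc 1 n, _}, hshift] at h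
  refine h.trans (measureReal_mono ?_)
  rintro ω ⟨h1, h2⟩ l hl
  obtain ⟨hl1, hl2⟩ := Finset.mem_Icc.1 hl
  rcases le_or_gt l m with hlm | hlm
  · exact h1 l (Finset.mem_Icc.2 ⟨hl1, hlm⟩)
  · obtain ⟨k, rfl⟩ := Nat.exists_eq_add_of_le hlm.le
    rw [Finset.sum_range_add]
    refine add_nonpos ?_ (h2 k (Finset.mem_Icc.2 ⟨by omega, by omega⟩))
    rcases Nat.eq_zero_or_pos m with rfl | hm
    · simp
    · exact h1 m (Finset.mem_Icc.2 ⟨hm, le_rfl⟩)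

end IsStationaryGaussianSeq

lemma sum_range_sub_tail (f : ℕ → ℝ) {k j : ℕ} (hj : j ≤ k) :
    ∑ i ∈ Finset.range j, f (k - i) = ∑ i ∈ Finset.range k, f (i + 1)
      - ∑ i ∈ Finset.range (k - j), f (i + 1) := by
  induction j with
  | zero => simp
  | succ j ih =>
    rw [Finset.sum_range_succ, ih (by omega)]
    have : k - j = (k - (j + 1)) + 1 := by omega
    rw [this, Finset.sum_range_succ]
    ring

namespace IsStationaryGaussianSeq

variable {Ω : Type*} [MeasurableSpace Ω] {P : Measure Ω} {X : ℕ → Ω → ℝ} {r : ℕ → ℝ}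

/-- The event that the walk restarted at time `k` stays nonpositive for `m` steps. -/
lemma prob_forward_nonpos [IsProbabilityMeasure P] (hX : IsStationaryGaussianSeq P X r)
    {Z : ℕ → Ω → ℝ} (hZ : ∀ n ω, Z n ω = ∑ i ∈ Finset.range n, X (i + 1) ω) (k m : ℕ) :
    P {ω | ∀ l ∈ Finset.Icc 1 m, Z (k + l) ω ≤ Z k ω}
      = P {ω | ∀ l ∈ Finset.Icc 1 m, Z l ω ≤ 0} := by
  have h := hX.prob_partialSums_nonpos (m := m) (σ := fun i => k + i + 1) (c := 1)
    (by intros; push_cast; congr 1; ring) (by intros; omega) (one_mul 1)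
  simp only [one_mul, ← hZ] at h
  rw [← h]
  congr 1
  ext ω
  refine forall₂_congr fun l _ => ?_
  rw [hZ, hZ, Finset.sum_range_add, add_le_iff_nonpos_right]

/-- The event that the walk at time `k` is at least its values at the `m` preceding times. -/
lemma prob_backward_nonneg [IsProbabilityMeasure P] (hX : IsStationaryGaussianSeq P X r)
    {Z : ℕ → Ω → ℝ} (hZ : ∀ n ω, Z n ω = ∑ i ∈ Finset.range n, X (i + 1) ω) {k m : ℕ}
    (hm : m ≤ k) :
    P {ω | ∀ l ∈ Finset.Icc 1 m, Z (k - l) ω ≤ Z k ω}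
      = P {ω | ∀ l ∈ Finset.Icc 1 m, Z l ω ≤ 0} := by
  have h := hX.prob_partialSums_nonpos (m := m) (σ := fun i => k - i) (c := -1)
    (by intro i hi j hj; omega) (by intros; omega) (by norm_num)
  simp only [← hZ] at h
  rw [← h]
  congr 1
  ext ω
  refine forall₂_congr fun l hl => ?_
  rw [← Finset.mul_sum, sum_range_sub_tail (fun i => X i ω) ((Finset.mem_Icc.1 hl).2.trans hm),
    ← hZ, ← hZ]
  constructor <;> intro h <;> linarith

/-- Polynomial lower bound for the persistence probability. -/
lemma one_le_mul_prob [IsProbabilityMeasure P] (hX : IsStationaryGaussianSeq P X r)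
    {Z : ℕ → Ω → ℝ} (hZ : ∀ n ω, Z n ω = ∑ i ∈ Finset.range n, X (i + 1) ω)
    {τ : Ω → ℕ} {m : ℕ} (hτ : ∀ ω, τ ω ≤ 2 * m ∧ ∀ j ≤ 2 * m, Z j ω ≤ Z (τ ω) ω) :
    1 ≤ (2 * m + 1) * P.real {ω | ∀ l ∈ Finset.Icc 1 m, Z l ω ≤ 0} := by
  have hcover : Set.univ ⊆ ⋃ k ∈ Finset.range (2 * m + 1), {ω | τ ω = k} := by
    intro ω _
    simpa using Nat.lt_succ_of_le (hτ ω).1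
  have hk (k : ℕ) (hk : k ∈ Finset.range (2 * m + 1)) :
      P.real {ω | τ ω = k} ≤ P.real {ω | ∀ l ∈ Finset.Icc 1 m, Z l ω ≤ 0} := by
    rw [Finset.mem_range] at hk
    rcases le_total k m with hkm | hkm
    · rw [measureReal_def P {ω | ∀ l ∈ _, _}, ← hX.prob_forward_nonpos hZ k m, ← measureReal_def]
      refine measureReal_mono fun ω hω l hl => ?_
      obtain rfl : τ ω = k := hω
      exact (hτ ω).2 _ (by have := (Finset.mem_Icc.1 hl).2; omega)
    · rw [measureReal_def P {ω | ∀ l ∈ _, _}, ← hX.prob_backward_nonneg hZ hkm, ← measureReal_def]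
      refine measureReal_mono fun ω hω l hl => ?_
      obtain rfl : τ ω = k := hω
      exact (hτ ω).2 _ (by omega)
  calc (1 : ℝ) = P.real Set.univ := by simp
    _ ≤ P.real (⋃ k ∈ Finset.range (2 * m + 1), {ω | τ ω = k}) :=
        measureReal_mono hcover (measure_ne_top _ _)
    _ ≤ ∑ k ∈ Finset.range (2 * m + 1), P.real {ω | τ ω = k} := measureReal_biUnion_finset_le _ _
    _ ≤ ∑ k ∈ Finset.range (2 * m + 1), P.real {ω | ∀ l ∈ Finset.Icc 1 m, Z l ω ≤ 0} :=
        Finset.sum_le_sum hk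
    _ = _ := by simp

/-- Comparison of an early maximum with persistence. -/
lemma prob_argmax_lt_le [IsProbabilityMeasure P] (hX : IsStationaryGaussianSeq P X r)
    {Z : ℕ → Ω → ℝ} (hZ : ∀ n ω, Z n ω = ∑ i ∈ Finset.range n, X (i + 1) ω)
    {tau : ℕ → Ω → ℕ} (htau : ∀ T ω, tau T ω ≤ T ∧ ∀ j ≤ T, Z j ω ≤ Z (tau T ω) ω)
    {T n : ℕ} (hn : n ≤ T) :
    P.real {ω | tau T ω < n}
      ≤ n * (2 * n + 1) * P.real {ω | ∀ l ∈ Finset.Icc 1 T, Z l ω ≤ 0} := by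
  have hcover : {ω | tau T ω < n} ⊆ ⋃ k ∈ Finset.range n, {ω | tau T ω = k} := by
    intro ω hω
    simpa using hω
  have hk (k : ℕ) (hk : k ∈ Finset.range n) : P.real {ω | tau T ω = k}
      ≤ P.real {ω | ∀ l ∈ Finset.Icc 1 (T - n), Z l ω ≤ 0} := by
    rw [Finset.mem_range] at hk
    rw [measureReal_def P {ω | ∀ l ∈ _, _}, ← hX.prob_forward_nonpos hZ k (T - n),
      ← measureReal_def]
    refine measureReal_mono fun ω hω l hl => ?_
    obtain rfl : tau T ω = k := hω
    exact (htau T ω).2 _ (by have := (Finset.mem_Icc.1 hl).2; omega)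
  have h1 : P.real {ω | tau T ω < n}
      ≤ n * P.real {ω | ∀ l ∈ Finset.Icc 1 (T - n), Z l ω ≤ 0} :=
    calc P.real {ω | tau T ω < n}
        ≤ P.real (⋃ k ∈ Finset.range n, {ω | tau T ω = k}) :=
        measureReal_mono hcover (measure_ne_top _ _)
      _ ≤ ∑ k ∈ Finset.range n, P.real {ω | tau T ω = k} := measureReal_biUnion_finset_le _ _
      _ ≤ ∑ k ∈ Finset.range n, P.real {ω | ∀ l ∈ Finset.Icc 1 (T - n), Z l ω ≤ 0} :=
          Finset.sum_le_sum hk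
      _ = _ := by simp
  have h2 := hX.one_le_mul_prob hZ (htau (2 * n))
  have h3 := hX.prob_mul_le_prob_add (T - n) n
  simp only [← hZ, Nat.sub_add_cancel hn] at h3
  set a := P.real {ω | ∀ l ∈ Finset.Icc 1 (T - n), Z l ω ≤ 0}
  set b := P.real {ω | ∀ l ∈ Finset.Icc 1 n, Z l ω ≤ 0}
  have ha : 0 ≤ a := measureReal_nonneg
  calc P.real {ω | tau T ω < n} ≤ n * a := h1
    _ ≤ n * (a * ((2 * n + 1) * b)) := by
        gcongr
        exact le_mul_of_one_le_right ha h2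
    _ = n * (2 * n + 1) * (a * b) := by ring
    _ ≤ _ := by gcongr

end IsStationaryGaussianSeq

/-- If `log n(T) / log T → 0`, then `n(T)` is eventually at most any positive power of `T`. -/
lemma eventually_le_rpow_of_log_div_log_tendsto_zero {n : ℕ → ℕ} (hn1 : ∀ T, 1 ≤ n T)
    (hn : Tendsto (fun T : ℕ => Real.log (n T) / Real.log T) atTop (nhds 0)) {δ : ℝ}
    (hδ : 0 < δ) : ∀ᶠ T : ℕ in atTop, (n T : ℝ) ≤ (T : ℝ) ^ δ := by
  filter_upwards [hn.eventually (gt_mem_nhds hδ), eventually_ge_atTop 2] with T hT hT2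
  have hT1 : (1 : ℝ) < T := by exact_mod_cast hT2
  have hlog : 0 < Real.log T := Real.log_pos hT1
  have hn0 : (0 : ℝ) < n T := by exact_mod_cast hn1 T
  rw [Real.le_rpow_iff_log_le hn0 (by linarith)]
  exact ((div_lt_iff₀ hlog).1 hT).le

/-- Let `(X_i)_{i ≥ 1}` be a stationary centered Gaussian sequence with `E[X_i²] = 1`,
nonnegative correlations `r j = E[X_k X_{k+j}]` satisfying
`∑_{i,j=1}^n r(i-j) ~ K n^{2H} ℓ(n)` with `H ∈ [1/2, 1)`, `K > 0` and `ℓ` slowly varying,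
and let `Z_n = ∑_{i=1}^n X_i`.  Let `τ_T` be the smallest index `k ∈ {0,…,T}` where
`max_{j=0,…,T} Z_j` is attained, and let `n : ℕ → ℕ₊` satisfy `log n(T) / log T → 0`.
Then `P[max_{k=1,…,T} Z_k ≤ 0] ≤ P[τ_T < n(T)]` for all `T`, and for every `ε > 0` there
is `T₀` such that `P[τ_T < n(T)] ≤ T^ε P[max_{k=1,…,T} Z_k ≤ 0]` for all `T ≥ T₀`. -/
theorem stmt7
    {Ω : Type*} [MeasurableSpace Ω] (P : Measure Ω) [IsProbabilityMeasure P]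
    (X : ℕ → Ω → ℝ) (hXmeas : ∀ i, Measurable (X i))
    (hgauss : ∀ s : Finset ℕ, (∀ i ∈ s, 1 ≤ i) → ∀ c : ℕ → ℝ,
      ∃ v : NNReal,
        Measure.map (fun ω => ∑ i ∈ s, c i * X i ω) P = gaussianReal 0 v)
    (r : ℕ → ℝ) (hrnonneg : ∀ j, 0 ≤ r j) (hr0 : r 0 = 1)
    (hrcov : ∀ k, 1 ≤ k → ∀ j, ∫ ω, X k ω * X (k + j) ω ∂P = r j)
    (H : ℝ) (hH : H ∈ Set.Ico (1 / 2 : ℝ) 1) (K : ℝ) (hK : 0 < K)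
    (ℓ : ℝ → ℝ) (hℓpos : ∀ x > (0 : ℝ), 0 < ℓ x)
    (hℓslow : ∀ lam > (0 : ℝ),
      Tendsto (fun x : ℝ => ℓ (lam * x) / ℓ x) atTop (nhds 1))
    (hlrd : Tendsto
      (fun n : ℕ =>
        (∑ i ∈ Finset.Icc 1 n, ∑ j ∈ Finset.Icc 1 n, r ((i : ℤ) - j).natAbs) /
          (K * (n : ℝ) ^ (2 * H) * ℓ n))
      atTop (nhds 1))
    (Z : ℕ → Ω → ℝ) (hZ : ∀ n ω, Z n ω = ∑ i ∈ Finset.Icc 1 n, X i ω)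
    (tau : ℕ → Ω → ℕ)
    (htau : ∀ T ω, tau T ω ≤ T ∧ (∀ j ≤ T, Z j ω ≤ Z (tau T ω) ω) ∧
      ∀ k < tau T ω, Z k ω < Z (tau T ω) ω)
    (n : ℕ → ℕ) (hn1 : ∀ T, 1 ≤ n T)
    (hn : Tendsto (fun T : ℕ => Real.log (n T) / Real.log T) atTop (nhds 0)) :
    (∀ T : ℕ,
      P {ω | ∀ k ∈ Finset.Icc 1 T, Z k ω ≤ 0} ≤ P {ω | tau T ω < n T}) ∧
      ∀ ε > (0 : ℝ), ∃ T₀ : ℕ, ∀ T ≥ T₀,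
        (P {ω | tau T ω < n T}).toReal ≤
          (T : ℝ) ^ ε * (P {ω | ∀ k ∈ Finset.Icc 1 T, Z k ω ≤ 0}).toReal := by
  have hX : IsStationaryGaussianSeq P X r := ⟨hXmeas, hgauss, hrnonneg, hrcov⟩
  have hZ' : ∀ n ω, Z n ω = ∑ i ∈ Finset.range n, X (i + 1) ω := by
    intro n ω
    rw [hZ, Finset.range_eq_Ico, Finset.sum_Ico_add' (fun i => X i ω) 0 n 1]
    rfl
  refine ⟨fun T => measure_mono fun ω hω => ?_, fun ε hε => ?_⟩
  · by_contra hlt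
    have hpos : 0 < tau T ω := lt_of_lt_of_le (hn1 T) (not_lt.1 hlt)
    have h0 := (htau T ω).2.2 0 hpos
    have h1 := hω (tau T ω) (Finset.mem_Icc.2 ⟨hpos, (htau T ω).1⟩)
    have h2 : Z 0 ω = 0 := by simp [hZ]
    linarith
  · have hlarge : ∀ᶠ T : ℕ in atTop, (3 : ℝ) ≤ (T : ℝ) ^ (ε / 2) :=
      ((tendsto_rpow_atTop (half_pos hε)).comp tendsto_natCast_atTop_atTop).eventually_ge_atTop 3
    have h1 := eventually_le_rpow_of_log_div_log_tendsto_zero hn1 hn one_pos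
    have h2 := eventually_le_rpow_of_log_div_log_tendsto_zero hn1 hn
      (show 0 < ε / 4 by positivity)
    obtain ⟨T₀, hT₀⟩ := eventually_atTop.1 (hlarge.and (h1.and (h2.and (eventually_ge_atTop 1))))
    refine ⟨T₀, fun T hT => ?_⟩
    obtain ⟨hT3, hT1, hT2, hTpos⟩ := hT₀ T hT
    rw [Real.rpow_one] at hT1
    have hTpos' : (0 : ℝ) < T := by exact_mod_cast hTpos
    refine (hX.prob_argmax_lt_le hZ' (fun T ω => ⟨(htau T ω).1, (htau T ω).2.1⟩)
      (by exact_mod_cast hT1 : n T ≤ T)).trans ?_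
    refine mul_le_mul_of_nonneg_right ?_ measureReal_nonneg
    have hn1' : (1 : ℝ) ≤ n T := by exact_mod_cast hn1 T
    calc (n T : ℝ) * (2 * n T + 1) ≤ 3 * (n T * n T) := by nlinarith
      _ ≤ (T : ℝ) ^ (ε / 2) * ((T : ℝ) ^ (ε / 4) * (T : ℝ) ^ (ε / 4)) := by gcongr
      _ = (T : ℝ) ^ ε := by
          rw [← Real.rpow_add hTpos', ← Real.rpow_add hTpos']
          congr 1
          ring
end

section
/- Let n:ℕ→ℕ₊ satisfy log n(T)/log T → 0 as T→∞. Then for all T, P[max_{k=1,...,T} Z_k ≤ 0] ≤ P[N_T < n(T)], and for every ε>0 there exists T₀ such that for all T≥T₀: P[N_T < n(T)] ≤ T^{ε} · P[max_{k=1,...,T} Z_k ≤ 0]. -/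
open MeasureTheory Filter ProbabilityTheory
open scoped Classical

namespace GaussianPersistence

/-- The quadratic form of the covariance matrix `(r |i - j|)_{i, j < n}`. -/
noncomputable def covForm (r : ℕ → ℝ) (n : ℕ) (c : ℕ → ℝ) : ℝ :=
  ∑ i ∈ Finset.range n, ∑ j ∈ Finset.range n, c i * c j * r ((i : ℤ) - j).natAbs

/-- `μ` is the law of a stationary centered Gaussian sequence with correlations `r`. -/
structure IsStationaryGaussian (r : ℕ → ℝ) (μ : Measure (ℕ → ℝ)) : Prop where
  prob : IsProbabilityMeasure μ
  law : ∀ n (c : ℕ → ℝ), ∃ v : NNReal, (v : ℝ) = covForm r n c ∧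
    μ.map (fun x => ∑ i ∈ Finset.range n, c i * x i) = gaussianReal 0 v

/-- Two probability measures on sequences with the same finite Laplace transforms of the
coordinates are equal. -/
lemma measure_ext_of_integral_exp {μ ν : Measure (ℕ → ℝ)} [IsProbabilityMeasure μ]
    [IsProbabilityMeasure ν]
    (hint : ∀ n (c : ℕ → ℝ),
      Integrable (fun x => Real.exp (∑ i ∈ Finset.range (n + 1), c i * x i)) μ)
    (heq : ∀ n (c : ℕ → ℝ),
      ∫ x, Real.exp (∑ i ∈ Finset.range (n + 1), c i * x i) ∂μ =
        ∫ x, Real.exp (∑ i ∈ Finset.range (n + 1), c i * x i) ∂ν) : μ = ν := by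
  have key : ∀ n (c : ℕ → ℝ),
      complexMGF (fun x : ℕ → ℝ => ∑ i ∈ Finset.range (n + 1), c i * x i) μ Complex.I =
        complexMGF (fun x : ℕ → ℝ => ∑ i ∈ Finset.range (n + 1), c i * x i) ν Complex.I := by
    intro n c
    have hmul : ∀ t : ℝ, ∀ x : ℕ → ℝ, t * ∑ i ∈ Finset.range (n + 1), c i * x i =
        ∑ i ∈ Finset.range (n + 1), (t * c i) * x i := by
      intro t x
      rw [Finset.mul_sum]
      exact Finset.sum_congr rfl fun i _ => by ring
    have hset : integrableExpSet
        (fun x : ℕ → ℝ => ∑ i ∈ Finset.range (n + 1), c i * x i) μ = Set.univ := by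
      ext t
      simp only [integrableExpSet, Set.mem_ofPred_eq, Set.mem_univ, iff_true, hmul]
      exact hint n fun i => t * c i
    refine eqOn_complexMGF_of_mgf ?_ ?_
    · ext t
      simp only [mgf, hmul]
      exact heq n fun i => t * c i
    · rw [hset]
      simp
  have hfin : ∀ I : Finset ℕ, μ.map I.restrict = ν.map I.restrict := by
    intro I
    have : IsProbabilityMeasure (μ.map I.restrict) :=
      Measure.isProbabilityMeasure_map (Finset.measurable_restrict I).aemeasurable
    have : IsProbabilityMeasure (ν.map I.restrict) :=
      Measure.isProbabilityMeasure_map (Finset.measurable_restrict I).aemeasurable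
    refine Measure.ext_of_charFunDual (funext fun L => ?_)
    set n := I.sup id with hn
    set c : ℕ → ℝ := fun i => if h : i ∈ I then L (Pi.single ⟨i, h⟩ 1) else 0 with hc
    have hsub : I ⊆ Finset.range (n + 1) := fun i hi =>
      Finset.mem_range.2 (Nat.lt_succ_of_le (Finset.le_sup (f := id) hi))
    have hL : ∀ x : ℕ → ℝ, L (I.restrict x) = ∑ i ∈ Finset.range (n + 1), c i * x i := by
      intro x
      rw [← Finset.sum_subset hsub (fun i _ hi => by simp [hc, hi]), ← Finset.sum_coe_sort I]
      conv_lhs => rw [← Finset.univ_sum_single (I.restrict x)]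
      rw [map_sum]
      refine Finset.sum_congr rfl fun i _ => ?_
      have : (Pi.single i (I.restrict x i) : I → ℝ) = x i • Pi.single i (1 : ℝ) := by
        rw [← Pi.single_smul]; simp
      rw [this, map_smul]
      simp [hc, mul_comm]
    rw [charFunDual_apply, charFunDual_apply,
      integral_map (Finset.measurable_restrict I).aemeasurable
        (Measurable.aestronglyMeasurable (by fun_prop)),
      integral_map (Finset.measurable_restrict I).aemeasurable
        (Measurable.aestronglyMeasurable (by fun_prop))]
    simp only [hL]
    have := key n c
    simp only [complexMGF] at this
    simpa only [mul_comm] using this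
  refine IsProjectiveLimit.unique (P := fun I => μ.map I.restrict) (fun I => rfl)
    (fun I => (hfin I).symm)

lemma gaussian_exp {Ω : Type*} [MeasurableSpace Ω] {P : Measure Ω} {U : Ω → ℝ} {v : NNReal}
    (h : P.map U = gaussianReal 0 v) (t : ℝ) :
    Integrable (fun ω => Real.exp (t * U ω)) P ∧
      ∫ ω, Real.exp (t * U ω) ∂P = Real.exp (v * t ^ 2 / 2) := by
  have hm := mgf_gaussianReal h t
  rw [zero_mul, zero_add] at hm
  refine ⟨?_, hm⟩
  by_contra hni
  rw [mgf_undef hni] at hm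
  exact (Real.exp_pos _).ne hm

namespace IsStationaryGaussian

variable {r : ℕ → ℝ} {μ : Measure (ℕ → ℝ)}

lemma exp_linear (h : IsStationaryGaussian r μ) (n : ℕ) (c : ℕ → ℝ) :
    Integrable (fun x => Real.exp (∑ i ∈ Finset.range n, c i * x i)) μ ∧
      ∫ x, Real.exp (∑ i ∈ Finset.range n, c i * x i) ∂μ = Real.exp (covForm r n c / 2) := by
  obtain ⟨v, hv, hlaw⟩ := h.law n c
  simpa [hv] using gaussian_exp hlaw 1

lemma unique {ν : Measure (ℕ → ℝ)} (h : IsStationaryGaussian r μ)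
    (h' : IsStationaryGaussian r ν) : μ = ν := by
  have := h.prob
  have := h'.prob
  exact measure_ext_of_integral_exp (fun n c => (h.exp_linear _ c).1)
    (fun n c => by rw [(h.exp_linear _ c).2, (h'.exp_linear _ c).2])

/-- Cameron–Martin formula for the shift in the direction `(r k)_k`. -/
lemma map_sub (h : IsStationaryGaussian r μ) (hr0 : r 0 = 1) :
    μ.map (fun x k => x k - r k) =
      μ.withDensity (fun x => ENNReal.ofReal (Real.exp (-x 0 - 1 / 2))) := by
  have := h.prob
  have hmeas : Measurable fun (x : ℕ → ℝ) k => x k - r k := by fun_prop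
  have hdm : Measurable fun x : ℕ → ℝ => Real.exp (-x 0 - 1 / 2) := by fun_prop
  have : IsProbabilityMeasure (μ.map (fun x k => x k - r k)) :=
    Measure.isProbabilityMeasure_map hmeas.aemeasurable
  have hexp : ∀ n (c : ℕ → ℝ) (x : ℕ → ℝ),
      Real.exp (-x 0 - 1 / 2) * Real.exp (∑ i ∈ Finset.range (n + 1), c i * x i) =
        Real.exp (-(1 / 2)) * Real.exp (∑ i ∈ Finset.range (n + 1),
          (c i - if i = 0 then 1 else 0) * x i) := by
    intro n c x
    rw [← Real.exp_add, ← Real.exp_add]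
    congr 1
    simp [sub_mul, Finset.sum_sub_distrib]
    ring
  have hQ : ∀ n (c : ℕ → ℝ), covForm r (n + 1) (fun i => c i - if i = 0 then 1 else 0) =
      covForm r (n + 1) c - 2 * ∑ i ∈ Finset.range (n + 1), c i * r i + 1 := by
    intro n c
    have hij : ∀ i j : ℕ, (c i - if i = 0 then 1 else 0) * (c j - if j = 0 then 1 else 0) *
        r ((i : ℤ) - j).natAbs = c i * c j * r ((i : ℤ) - j).natAbs
          - (if j = 0 then c i * r i else 0) - (if i = 0 then c j * r j else 0)
          + if i = 0 then (if j = 0 then 1 else 0) else 0 := by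
      intro i j
      by_cases hi : i = 0 <;> by_cases hj : j = 0 <;> simp [hi, hj, hr0] <;> ring
    unfold covForm
    simp only [hij, Finset.sum_add_distrib, Finset.sum_sub_distrib]
    have h1 : ∑ i ∈ Finset.range (n + 1), ∑ j ∈ Finset.range (n + 1),
        (if j = 0 then c i * r i else 0) = ∑ i ∈ Finset.range (n + 1), c i * r i :=
      Finset.sum_congr rfl fun i _ => by simp
    have h2 : ∑ i ∈ Finset.range (n + 1), ∑ j ∈ Finset.range (n + 1),
        (if i = 0 then c j * r j else 0) = ∑ i ∈ Finset.range (n + 1), c i * r i := by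
      rw [Finset.sum_comm]
      exact Finset.sum_congr rfl fun i _ => by simp
    have h3 : ∑ i ∈ Finset.range (n + 1), ∑ j ∈ Finset.range (n + 1),
        (if i = 0 then (if j = 0 then (1 : ℝ) else 0) else 0) = 1 := by
      rw [Finset.sum_comm]
      simp
    rw [h1, h2, h3]
    ring
  have hprob : IsProbabilityMeasure
      (μ.withDensity (fun x => ENNReal.ofReal (Real.exp (-x 0 - 1 / 2)))) := by
    refine ⟨?_⟩
    have he := h.exp_linear 1 fun i => (0 : ℝ) - if i = 0 then 1 else 0
    have hval : ∀ x : ℕ → ℝ, Real.exp (-x 0 - 1 / 2) = Real.exp (-(1 / 2)) *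
        Real.exp (∑ i ∈ Finset.range 1, ((0 : ℝ) - if i = 0 then 1 else 0) * x i) := by
      intro x
      simpa using hexp 0 (fun _ => 0) x
    rw [withDensity_apply _ MeasurableSet.univ, Measure.restrict_univ,
      ← ofReal_integral_eq_lintegral_ofReal]
    · simp only [hval]
      rw [integral_const_mul, he.2, hQ 0 fun _ => 0, ← Real.exp_add]
      simp [covForm]
    · simp only [hval]
      exact he.1.const_mul _
    · exact ae_of_all _ fun x => (Real.exp_pos _).le
  have hsub : ∀ n (c x : ℕ → ℝ), Real.exp (∑ i ∈ Finset.range (n + 1), c i * (x i - r i)) =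
      Real.exp (-∑ i ∈ Finset.range (n + 1), c i * r i) *
        Real.exp (∑ i ∈ Finset.range (n + 1), c i * x i) := by
    intro n c x
    rw [← Real.exp_add]
    congr 1
    simp [mul_sub, Finset.sum_sub_distrib]
    ring
  refine measure_ext_of_integral_exp (fun n c => ?_) (fun n c => ?_)
  · rw [integrable_map_measure (Measurable.aestronglyMeasurable (by fun_prop)) hmeas.aemeasurable]
    simp only [Function.comp_def, hsub]
    exact (h.exp_linear _ c).1.const_mul _
  · rw [integral_map hmeas.aemeasurable (Measurable.aestronglyMeasurable (by fun_prop)),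
      integral_withDensity_eq_integral_toReal_smul (by fun_prop) (by simp)]
    simp only [hsub, ENNReal.toReal_ofReal (Real.exp_pos _).le, smul_eq_mul, hexp]
    rw [integral_const_mul, integral_const_mul, (h.exp_linear _ _).2, (h.exp_linear _ _).2, hQ,
      ← Real.exp_add, ← Real.exp_add]
    congr 1
    ring

end IsStationaryGaussian

/-- Every time shift of a stationary Gaussian sequence has a law determined by `r`. -/
lemma isStationaryGaussian_map {Ω : Type*} [MeasurableSpace Ω] {P : Measure Ω}
    [IsProbabilityMeasure P] {X : ℕ → Ω → ℝ} (hXmeas : ∀ i, Measurable (X i))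
    (hgauss : ∀ s : Finset ℕ, (∀ i ∈ s, 1 ≤ i) → ∀ c : ℕ → ℝ,
      ∃ v : NNReal, P.map (fun ω => ∑ i ∈ s, c i * X i ω) = gaussianReal 0 v)
    {r : ℕ → ℝ} (hrcov : ∀ k, 1 ≤ k → ∀ j, ∫ ω, X k ω * X (k + j) ω ∂P = r j) (m : ℕ) :
    IsStationaryGaussian r (P.map fun ω k => X (m + 1 + k) ω) := by
  have hmeas : Measurable fun ω k => X (m + 1 + k) ω := by fun_prop
  refine ⟨Measure.isProbabilityMeasure_map hmeas.aemeasurable, fun n c => ?_⟩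
  have hmem : ∀ i, 1 ≤ i → MemLp (X i) 2 P := by
    intro i hi
    obtain ⟨v, hv⟩ := hgauss {i} (by simpa using hi) fun _ => 1
    simp only [Finset.sum_singleton, one_mul] at hv
    have := memLp_id_gaussianReal' (μ := 0) (v := v) 2 (by simp)
    rw [← hv, memLp_map_measure_iff aestronglyMeasurable_id (hXmeas i).aemeasurable] at this
    exact this
  have hcov : ∀ i j, 1 ≤ i → 1 ≤ j → ∫ ω, X i ω * X j ω ∂P = r ((i : ℤ) - j).natAbs := by
    intro i j hi hj
    rcases le_total i j with hij | hij
    · obtain ⟨d, rfl⟩ := Nat.exists_eq_add_of_le hij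
      rw [hrcov i hi d]
      congr 1
      omega
    · obtain ⟨d, rfl⟩ := Nat.exists_eq_add_of_le hij
      simp_rw [mul_comm (X (j + d) _)]
      rw [hrcov j hj d]
      congr 1
      omega
  obtain ⟨v, hv⟩ := hgauss ((Finset.range n).map (addLeftEmbedding (m + 1)))
    (by simp; intros; omega) fun k => c (k - (m + 1))
  simp only [Finset.sum_map, addLeftEmbedding_apply, Nat.add_sub_cancel_left] at hv
  refine ⟨v, ?_, ?_⟩
  · have hUm : Measurable fun ω => ∑ i ∈ Finset.range n, c i * X (m + 1 + i) ω := by fun_prop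
    have h0 : ∫ ω, ∑ i ∈ Finset.range n, c i * X (m + 1 + i) ω ∂P = 0 := by
      have := integral_id_gaussianReal (μ := 0) (v := v)
      rwa [← hv, integral_map hUm.aemeasurable (by fun_prop)] at this
    have hvar := variance_id_gaussianReal (μ := 0) (v := v)
    rw [← hv, variance_id_map hUm.aemeasurable, variance_of_integral_eq_zero hUm.aemeasurable h0]
      at hvar
    rw [← hvar]
    simp_rw [sq, Finset.sum_mul_sum]
    have hint : ∀ i j, Integrable (fun ω => c i * X (m + 1 + i) ω * (c j * X (m + 1 + j) ω)) P :=
      fun i j => ((hmem (m + 1 + i) (by omega)).const_mul (c i)).integrable_mul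
        ((hmem (m + 1 + j) (by omega)).const_mul (c j))
    rw [integral_finsetSum _ fun i _ => integrable_finsetSum _ fun j _ => hint i j]
    refine Finset.sum_congr rfl fun i _ => ?_
    rw [integral_finsetSum _ fun j _ => hint i j]
    refine Finset.sum_congr rfl fun j _ => ?_
    have := hcov (m + 1 + i) (m + 1 + j) (by omega) (by omega)
    have hnat : (((m + 1 + i : ℕ) : ℤ) - ((m + 1 + j : ℕ) : ℤ)).natAbs =
        ((i : ℤ) - j).natAbs := by congr 1; push_cast; ring
    rw [hnat] at this
    rw [← this, ← integral_const_mul]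
    congr 1
    ext ω
    ring
  · rw [Measure.map_map (by fun_prop) hmeas]
    exact hv

/-- Partial sums of a sequence. -/
def psum (x : ℕ → ℝ) (k : ℕ) : ℝ := ∑ i ∈ Finset.range k, x i

/-- The time shift of a sequence. -/
def shift (m : ℕ) (x : ℕ → ℝ) : ℕ → ℝ := fun k => x (m + k)

lemma psum_shift (m : ℕ) (x : ℕ → ℝ) (k : ℕ) :
    psum (shift m x) k = psum x (m + k) - psum x m := by
  simp only [psum, shift, Finset.sum_range_add]
  ring

lemma measurable_psum (k : ℕ) : Measurable fun x : ℕ → ℝ => psum x k := by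
  unfold psum
  fun_prop

lemma measurable_shift (m : ℕ) : Measurable (shift m) := by
  unfold shift
  fun_prop

/-- The variance of the `n`-th partial sum. -/
noncomputable def sumVar (r : ℕ → ℝ) (n : ℕ) : ℝ :=
  covForm r n fun _ => 1

namespace IsStationaryGaussian

variable {r : ℕ → ℝ} {μ : Measure (ℕ → ℝ)}

lemma map_shift (h : IsStationaryGaussian r μ) (m : ℕ) : μ.map (shift m) = μ := by
  have := h.prob
  refine unique ⟨Measure.isProbabilityMeasure_map (measurable_shift m).aemeasurable,
    fun n c => ?_⟩ h
  obtain ⟨v, hv, hlaw⟩ := h.law (m + n) fun i => if i < m then 0 else c (i - m)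
  have hzero : ∀ f : ℕ → ℝ, (∀ i < m, f i = 0) →
      ∑ i ∈ Finset.range (m + n), f i = ∑ i ∈ Finset.range n, f (m + i) := by
    intro f hf
    rw [Finset.sum_range_add, Finset.sum_eq_zero fun i hi => hf i (Finset.mem_range.1 hi),
      zero_add]
  refine ⟨v, ?_, ?_⟩
  · rw [hv, covForm, hzero _ fun i hi => by simp [hi]]
    refine Finset.sum_congr rfl fun i _ => ?_
    rw [hzero _ fun j hj => by simp [hj]]
    simp
  · rw [Measure.map_map (by fun_prop) (measurable_shift m), ← hlaw]
    congr 1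
    ext x
    rw [hzero _ fun i hi => by simp [hi]]
    simp [shift]

lemma law_psum (h : IsStationaryGaussian r μ) (n : ℕ) :
    ∃ v : NNReal, (v : ℝ) = sumVar r n ∧ μ.map (fun x => psum x n) = gaussianReal 0 v := by
  simpa [psum, sumVar] using h.law n fun _ => 1

end IsStationaryGaussian

lemma sumVar_mono {r : ℕ → ℝ} (hr : ∀ j, 0 ≤ r j) : Monotone (sumVar r) := by
  intro m n hmn
  simp only [sumVar, covForm, one_mul]
  have hsub : Finset.range m ⊆ Finset.range n := Finset.range_subset_range.2 hmn
  calc _ ≤ ∑ i ∈ Finset.range m, ∑ j ∈ Finset.range n, r ((i : ℤ) - j).natAbs :=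
        Finset.sum_le_sum fun i _ => Finset.sum_le_sum_of_subset_of_nonneg hsub
          fun j _ _ => hr _
    _ ≤ _ := Finset.sum_le_sum_of_subset_of_nonneg hsub
          fun i _ _ => Finset.sum_nonneg fun j _ => hr _

lemma one_le_sumVar {r : ℕ → ℝ} (hr : ∀ j, 0 ≤ r j) (hr0 : r 0 = 1) {n : ℕ} (hn : 1 ≤ n) :
    1 ≤ sumVar r n := by
  refine le_trans (le_of_eq ?_) (sumVar_mono hr hn)
  simp [sumVar, covForm, hr0]

/-- The running maximum of the absolute partial sums. -/
noncomputable def maxAbs (T : ℕ) (x : ℕ → ℝ) : ℝ :=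
  (Finset.range (T + 1)).sup' Finset.nonempty_range_add_one fun k => |psum x k|

lemma measurable_maxAbs (T : ℕ) : Measurable (maxAbs T) := by
  unfold maxAbs
  have := Finset.measurable_sup' (s := Finset.range (T + 1)) Finset.nonempty_range_add_one
    (f := fun k (x : ℕ → ℝ) => |psum x k|) fun k _ => (measurable_psum k).norm
  convert! this using 1
  ext x
  rw [Finset.sup'_apply]

lemma le_maxAbs {T k : ℕ} (hk : k ≤ T) (x : ℕ → ℝ) : |psum x k| ≤ maxAbs T x :=
  Finset.le_sup' (fun k => |psum x k|) (Finset.mem_range.2 (Nat.lt_succ_of_le hk))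

lemma maxAbs_nonneg (T : ℕ) (x : ℕ → ℝ) : 0 ≤ maxAbs T x :=
  (abs_nonneg _).trans (le_maxAbs (Nat.zero_le T) x)

/-- Exponential moments bound the expectation of the running maximum. -/
lemma IsStationaryGaussian.integral_maxAbs {r : ℕ → ℝ} {μ : Measure (ℕ → ℝ)}
    (h : IsStationaryGaussian r μ) (hr : ∀ j, 0 ≤ r j) (hr0 : r 0 = 1) {T : ℕ} (hT : 1 ≤ T) :
    Integrable (maxAbs T) μ ∧
      ∫ x, maxAbs T x ∂μ ≤ √(sumVar r T) * (Real.log (T + 1) + 4) := by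
  have := h.prob
  set σ := √(sumVar r T) with hσ
  have hV := one_le_sumVar hr hr0 hT
  have hσpos : 0 < σ := Real.sqrt_pos.2 (by linarith)
  have hσsq : σ ^ 2 = sumVar r T := Real.sq_sqrt (by linarith)
  have hexp : ∀ k ≤ T, ∀ s : ℝ, s ^ 2 = 1 →
      Integrable (fun x => Real.exp (s / σ * psum x k)) μ ∧
        ∫ x, Real.exp (s / σ * psum x k) ∂μ ≤ 2 := by
    intro k hk s hs
    obtain ⟨v, hv, hlaw⟩ := h.law_psum k
    refine ⟨(gaussian_exp hlaw _).1, ?_⟩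
    rw [(gaussian_exp hlaw _).2, hv, div_pow, hs, hσsq]
    have h1 : sumVar r k * (1 / sumVar r T) / 2 ≤ 1 / 2 := by
      have : sumVar r k * (1 / sumVar r T) ≤ 1 := by
        rw [mul_one_div]
        exact (div_le_one (by linarith)).2 (sumVar_mono hr hk)
      linarith
    refine (Real.exp_le_exp.2 h1).trans ?_
    rw [← Real.le_log_iff_exp_le (by norm_num)]
    linarith [Real.log_two_gt_d9]
  set G : (ℕ → ℝ) → ℝ := fun x => ∑ k ∈ Finset.range (T + 1),
    (Real.exp (1 / σ * psum x k) + Real.exp (-1 / σ * psum x k)) with hG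
  have hGint : Integrable G μ := integrable_finsetSum _ fun k hk =>
    (hexp k (by simpa [Nat.lt_succ_iff] using hk) 1 (by norm_num)).1.add
      (hexp k (by simpa [Nat.lt_succ_iff] using hk) (-1) (by norm_num)).1
  have hGle : ∫ x, G x ∂μ ≤ (T + 1) * 4 := by
    have hsum : ∫ x, G x ∂μ = ∑ k ∈ Finset.range (T + 1),
        ∫ x, (Real.exp (1 / σ * psum x k) + Real.exp (-1 / σ * psum x k)) ∂μ :=
      integral_finsetSum _ fun k hk =>
        (hexp k (by simpa [Nat.lt_succ_iff] using hk) 1 (by norm_num)).1.add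
          (hexp k (by simpa [Nat.lt_succ_iff] using hk) (-1) (by norm_num)).1
    rw [hsum]
    refine (Finset.sum_le_card_nsmul _ _ 4 fun k hk => ?_).trans (by simp)
    have hk' : k ≤ T := by simpa [Nat.lt_succ_iff] using hk
    have h1 := hexp k hk' 1 (by norm_num)
    have h2 := hexp k hk' (-1) (by norm_num)
    rw [integral_add h1.1 h2.1]
    linarith
  have hT1 : (0 : ℝ) < T + 1 := by positivity
  have hpt : ∀ x, maxAbs T x ≤ σ * (Real.log (T + 1) + G x / (T + 1)) := by
    intro x
    refine Finset.sup'_le _ _ fun k hk => ?_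
    have hy : ∀ y : ℝ, y ≤ Real.log (T + 1) + Real.exp y / (T + 1) := by
      intro y
      have := Real.add_one_le_exp (y - Real.log (T + 1))
      rw [Real.exp_sub, Real.exp_log hT1] at this
      linarith
    have hle : Real.exp (|psum x k| / σ) ≤ G x := by
      refine le_trans ?_ (Finset.single_le_sum (f := fun k =>
        Real.exp (1 / σ * psum x k) + Real.exp (-1 / σ * psum x k))
        (fun i _ => by positivity) hk)
      rcases abs_cases (psum x k) with ⟨h1, -⟩ | ⟨h1, -⟩ <;> rw [h1]
      · have : psum x k / σ = 1 / σ * psum x k := by ring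
        rw [this]
        linarith [Real.exp_pos (-1 / σ * psum x k)]
      · have : -psum x k / σ = -1 / σ * psum x k := by ring
        rw [this]
        linarith [Real.exp_pos (1 / σ * psum x k)]
    have h2 : |psum x k| / σ ≤ Real.log (T + 1) + G x / (T + 1) := by
      refine (hy _).trans ?_
      gcongr
    rw [div_le_iff₀ hσpos] at h2
    linarith
  have hbint : Integrable (fun x => σ * (Real.log (T + 1) + G x / (T + 1))) μ :=
    ((integrable_const _).add (hGint.div_const _)).const_mul _
  have hint : Integrable (maxAbs T) μ :=
    hbint.mono' (measurable_maxAbs T).aestronglyMeasurable (ae_of_all _ fun x => by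
      rw [Real.norm_of_nonneg (maxAbs_nonneg T x)]
      exact hpt x)
  refine ⟨hint, (integral_mono hint hbint hpt).trans ?_⟩
  rw [integral_const_mul, integral_add (integrable_const _) (hGint.div_const _), integral_div]
  have : (∫ x, G x ∂μ) / (T + 1) ≤ 4 := by
    rw [div_le_iff₀ hT1]
    linarith
  simp only [integral_const, probReal_univ, smul_eq_mul, one_mul]
  gcongr

/-- The sequences spending fewer than `n` of the times `1, …, T` above the level `a`. -/
def fewAbove (a : ℝ) (T n : ℕ) : Set (ℕ → ℝ) :=
  {x | ((Finset.Icc 1 T).filter fun k => a < psum x k).card < n}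

lemma measurableSet_fewAbove (a : ℝ) (T n : ℕ) : MeasurableSet (fewAbove a T n) := by
  have : Measurable fun x : ℕ → ℝ => ((Finset.Icc 1 T).filter fun k => a < psum x k).card := by
    simp only [Finset.card_filter]
    refine Finset.measurable_sum _ fun k _ => ?_
    exact Measurable.ite (measurableSet_lt measurable_const (measurable_psum k))
      measurable_const measurable_const
  exact measurableSet_lt this measurable_const

/-- A path with few returns above the level one below its current value, at every time of a
set `S`, has to spread over at least `S.card / n` unit levels. -/
lemma card_le_of_few_returns {f : ℕ → ℝ} {R : ℝ} {T n : ℕ} (S : Finset ℕ) (hR0 : 0 ≤ R)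
    (hST : ∀ k ∈ S, k < T) (hR : ∀ k ∈ S, |f k| ≤ R)
    (hS : ∀ k ∈ S, ((Finset.Icc 1 T).filter fun j => -1 < f (k + j) - f k).card < n) :
    (S.card : ℝ) ≤ n * (2 * R + 2) := by
  have hfiber : ∀ a ∈ S.image fun k => ⌊f k⌋, (S.filter fun k => ⌊f k⌋ = a).card ≤ n := by
    intro a ha
    set F := S.filter fun k => ⌊f k⌋ = a with hF
    rcases F.eq_empty_or_nonempty with hFe | hFn
    · simp [hFe]
    set k := F.min' hFn with hk
    have hkF : k ∈ F := F.min'_mem hFn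
    have hkS : k ∈ S ∧ ⌊f k⌋ = a := by simpa [hF] using hkF
    have hcard : (F.erase k).card ≤
        ((Finset.Icc 1 T).filter fun j => -1 < f (k + j) - f k).card := by
      refine Finset.card_le_card_of_injOn (fun j => j - k) ?_ ?_
      · intro j hj
        have hj' := Finset.mem_erase.1 (Finset.mem_coe.1 hj)
        have hle : k ≤ j := F.min'_le j hj'.2
        have hjS : j ∈ S ∧ ⌊f j⌋ = a := by simpa [hF] using hj'.2
        have hjT := hST j hjS.1
        have hne := hj'.1
        have h1 := Int.lt_floor_add_one (f k)
        have h2 := Int.floor_le (f j)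
        rw [hkS.2] at h1
        rw [hjS.2] at h2
        simp only [Finset.coe_filter, Set.mem_ofPred_eq, Finset.mem_Icc, Nat.add_sub_cancel' hle]
        refine ⟨⟨by omega, by omega⟩, by linarith⟩
      · intro i hi j hj hij
        have hi' : k ≤ i := F.min'_le i (Finset.mem_erase.1 (Finset.mem_coe.1 hi)).2
        have hj' : k ≤ j := F.min'_le j (Finset.mem_erase.1 (Finset.mem_coe.1 hj)).2
        simp only at hij
        omega
    rw [Finset.card_erase_of_mem hkF] at hcard
    have := hS k hkS.1
    omega
  have h1 := Finset.card_le_mul_card_image S n hfiber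
  have h2 : (S.image fun k => ⌊f k⌋) ⊆ Finset.Icc ⌊-R⌋ ⌊R⌋ := by
    intro a ha
    obtain ⟨k, hk, rfl⟩ := Finset.mem_image.1 ha
    have := abs_le.1 (hR k hk)
    exact Finset.mem_Icc.2 ⟨Int.floor_le_floor this.1, Int.floor_le_floor this.2⟩
  have h3 : ((S.image fun k => ⌊f k⌋).card : ℝ) ≤ 2 * R + 2 := by
    have h4 := Finset.card_le_card h2
    rw [Int.card_Icc] at h4
    have h5 : ((⌊R⌋ + 1 - ⌊-R⌋).toNat : ℤ) = ⌊R⌋ + 1 - ⌊-R⌋ :=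
      Int.toNat_of_nonneg (by
        have : ⌊-R⌋ ≤ ⌊R⌋ := Int.floor_le_floor (by linarith)
        omega)
    have h6 : (((S.image fun k => ⌊f k⌋).card : ℤ) : ℝ) ≤ ((⌊R⌋ + 1 - ⌊-R⌋ : ℤ) : ℝ) := by
      exact_mod_cast (by omega : ((S.image fun k => ⌊f k⌋).card : ℤ) ≤ ⌊R⌋ + 1 - ⌊-R⌋)
    push_cast at h6
    linarith [Int.floor_le R, Int.lt_floor_add_one (-R)]
  calc (S.card : ℝ) ≤ n * ((S.image fun k => ⌊f k⌋).card : ℝ) := by exact_mod_cast h1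
    _ ≤ _ := by gcongr

/-- The sequences whose partial sums stay nonpositive up to time `T`. -/
def persist (T : ℕ) : Set (ℕ → ℝ) := {x | ∀ k ∈ Finset.Icc 1 T, psum x k ≤ 0}

lemma measurableSet_persist (T : ℕ) : MeasurableSet (persist T) := by
  have : persist T = ⋂ k ∈ Finset.Icc 1 T, {x | psum x k ≤ 0} := by
    ext x
    simp [persist]
  rw [this]
  exact Finset.measurableSet_biInter _ fun k _ =>
    measurableSet_le (measurable_psum k) measurable_const

/-- A path can only decrease its sliding-window maximum at times from which it persists. -/
lemma sliding_max_bound {T : ℕ} (hT : 1 ≤ T) (x : ℕ → ℝ) (m : ℕ) :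
    0 ≤ psum x m + maxAbs T (shift m x) +
      ∑ i ∈ Finset.range m, (persist T).indicator (fun y => |y 0|) (shift i x) := by
  set U : ℕ → ℝ := fun i =>
    (Finset.range (T + 1)).sup' Finset.nonempty_range_add_one fun k => psum x (i + k) with hU
  have hle : ∀ i k, k ≤ T → psum x (i + k) ≤ U i := fun i k hk =>
    Finset.le_sup' (fun k => psum x (i + k)) (Finset.mem_range.2 (Nat.lt_succ_of_le hk))
  have hstep : ∀ i, U i ≤ U (i + 1) + (persist T).indicator (fun y => |y 0|) (shift i x) := by
    intro i
    have hind : 0 ≤ (persist T).indicator (fun y => |y 0|) (shift i x) :=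
      Set.indicator_nonneg (fun _ _ => abs_nonneg _) _
    refine Finset.sup'_le _ _ fun k hk => ?_
    have hkT : k ≤ T := by simpa [Nat.lt_succ_iff] using hk
    have hpos : ∀ j, 1 ≤ j → j ≤ T → psum x (i + j) ≤ U (i + 1) := by
      intro j hj hjT
      have := hle (i + 1) (j - 1) (by omega)
      rwa [show i + 1 + (j - 1) = i + j by omega] at this
    rcases Nat.eq_zero_or_pos k with rfl | hk1
    · by_cases hB : shift i x ∈ persist T
      · rw [Set.indicator_of_mem hB]
        have h1 := hpos 1 le_rfl hT
        have h2 : psum x (i + 1) = psum x i + x i := Finset.sum_range_succ _ _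
        have h3 : shift i x 0 = x i := rfl
        rw [h3, add_zero]
        linarith [neg_abs_le (x i)]
      · simp only [persist, Set.mem_ofPred_eq, not_forall, not_le, Finset.mem_Icc] at hB
        obtain ⟨j, ⟨hj1, hjT⟩, hj⟩ := hB
        rw [psum_shift] at hj
        have := hpos j hj1 hjT
        rw [add_zero]
        linarith
    · linarith [hpos k hk1 hkT]
  have hsum : ∀ m, U 0 ≤ U m +
      ∑ i ∈ Finset.range m, (persist T).indicator (fun y => |y 0|) (shift i x) := by
    intro m
    induction m with
    | zero => simp
    | succ m ih =>
      rw [Finset.sum_range_succ]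
      linarith [hstep m]
  have h0 : 0 ≤ U 0 := by simpa [psum] using hle 0 0 (Nat.zero_le T)
  have hUm : U m ≤ psum x m + maxAbs T (shift m x) := by
    refine Finset.sup'_le _ _ fun k hk => ?_
    have h1 := le_maxAbs (T := T) (k := k) (by simpa [Nat.lt_succ_iff] using hk) (shift m x)
    rw [psum_shift] at h1
    linarith [le_abs_self (psum x (m + k) - psum x m)]
  linarith [hsum m]

/-- The first absolute moment of a centered Gaussian variable is comparable to its standard
deviation. -/
lemma gaussian_abs_lower {v : NNReal} (hv : 0 < v) :
    √(v : ℝ) * (1 - Real.exp (-1 / 2)) ≤ ∫ y, |y| ∂(gaussianReal 0 v) := by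
  have hσ : 0 < √(v : ℝ) := Real.sqrt_pos.2 (by exact_mod_cast hv)
  set t := (√(v : ℝ))⁻¹ with ht
  have htpos : 0 < t := inv_pos.2 hσ
  have hvt : (v : ℝ) * t ^ 2 = 1 := by
    rw [ht, inv_pow, Real.sq_sqrt v.coe_nonneg]
    exact mul_inv_cancel₀ (by exact_mod_cast hv.ne')
  have hI : Integrable (fun y : ℝ => |y|) (gaussianReal 0 v) :=
    ((memLp_id_gaussianReal' 1 (by simp)).integrable le_rfl).abs
  have hint : Integrable (fun y : ℝ => Complex.exp (t * y * Complex.I)) (gaussianReal 0 v) := by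
    refine Integrable.of_bound (Measurable.aestronglyMeasurable (by fun_prop)) 1
      (ae_of_all _ fun y => ?_)
    rw [← Complex.ofReal_mul, Complex.norm_exp_ofReal_mul_I]
  have hchar := charFun_gaussianReal (μ := 0) (v := v) t
  rw [charFun_apply_real] at hchar
  have h1 : ‖∫ y, (Complex.exp (t * y * Complex.I) - 1) ∂(gaussianReal 0 v)‖ ≤
      ∫ y, t * |y| ∂(gaussianReal 0 v) := by
    refine norm_integral_le_of_norm_le (hI.const_mul t) (ae_of_all _ fun y => ?_)
    have := Real.norm_exp_I_mul_ofReal_sub_one_le (x := t * y)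
    rw [Real.norm_eq_abs, abs_mul, abs_of_pos htpos, mul_comm Complex.I] at this
    exact_mod_cast this
  rw [integral_sub hint (integrable_const _), hchar, integral_const_mul] at h1
  have h2 : Complex.exp (t * (0 : ℝ) * Complex.I - v * t ^ 2 / 2) =
      ((Real.exp (-1 / 2) : ℝ) : ℂ) := by
    rw [Complex.ofReal_exp]
    congr 1
    have : ((v : ℝ) : ℂ) * (t : ℂ) ^ 2 = 1 := by exact_mod_cast hvt
    push_cast
    rw [this]
    ring
  have h3 : 1 - Real.exp (-1 / 2) ≤ t * ∫ y, |y| ∂(gaussianReal 0 v) := by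
    refine le_trans ?_ h1
    rw [h2]
    simp only [integral_const, probReal_univ, one_smul]
    rw [← Complex.ofReal_one, ← Complex.ofReal_sub, Complex.norm_real, Real.norm_eq_abs,
      abs_sub_comm]
    exact le_abs_self _
  calc √(v : ℝ) * (1 - Real.exp (-1 / 2))
      ≤ √(v : ℝ) * (t * ∫ y, |y| ∂(gaussianReal 0 v)) := by gcongr
    _ = _ := by rw [← mul_assoc, ht, mul_inv_cancel₀ hσ.ne', one_mul]

namespace IsStationaryGaussian

variable {r : ℕ → ℝ} {μ : Measure (ℕ → ℝ)}

lemma measurePreserving_shift (h : IsStationaryGaussian r μ) (m : ℕ) :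
    MeasurePreserving (shift m) μ μ :=
  ⟨measurable_shift m, h.map_shift m⟩

/-- Counting the times after which the path makes few returns bounds the probability of
spending little time above `-1`. -/
lemma mul_fewAbove_neg_one_le (h : IsStationaryGaussian r μ) (hr : ∀ j, 0 ≤ r j) (hr0 : r 0 = 1)
    {T : ℕ} (hT : 1 ≤ T) (n : ℕ) :
    T * μ.real (fewAbove (-1) T n) ≤
      n * (2 * (√(sumVar r T) * (Real.log (T + 1) + 4)) + 2) := by
  have := h.prob
  obtain ⟨hint, hle⟩ := h.integral_maxAbs hr hr0 hT
  set A := fewAbove (-1) T n with hA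
  have hAm : MeasurableSet A := measurableSet_fewAbove _ _ _
  have hpt : ∀ x, ∑ k ∈ Finset.range T, A.indicator (fun _ => (1 : ℝ)) (shift k x) ≤
      n * (2 * maxAbs T x + 2) := by
    intro x
    have hcard : ∑ k ∈ Finset.range T, A.indicator (fun _ => (1 : ℝ)) (shift k x) =
        ((Finset.range T).filter fun k => shift k x ∈ A).card := by
      rw [Finset.card_filter]
      push_cast
      exact Finset.sum_congr rfl fun k _ => by simp [Set.indicator_apply]
    rw [hcard]
    refine card_le_of_few_returns (f := psum x) (T := T) _ (maxAbs_nonneg T x) ?_ ?_ ?_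
    · intro k hk
      exact Finset.mem_range.1 (Finset.mem_filter.1 hk).1
    · intro k hk
      exact le_maxAbs (Finset.mem_range.1 (Finset.mem_filter.1 hk).1).le x
    · intro k hk
      have := (Finset.mem_filter.1 hk).2
      simpa only [hA, fewAbove, Set.mem_ofPred_eq, psum_shift] using this
  have hI : ∀ k, Integrable (fun x => A.indicator (fun _ => (1 : ℝ)) (shift k x)) μ ∧
      ∫ x, A.indicator (fun _ => (1 : ℝ)) (shift k x) ∂μ = μ.real A := by
    intro k
    have hi : Integrable (A.indicator fun _ => (1 : ℝ)) μ := (integrable_const 1).indicator hAm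
    refine ⟨(h.measurePreserving_shift k).integrable_comp_of_integrable hi, ?_⟩
    have := integral_map (measurable_shift k).aemeasurable (μ := μ)
      (f := A.indicator fun _ => (1 : ℝ)) (by rw [h.map_shift]; exact hi.aestronglyMeasurable)
    rw [← this, h.map_shift, integral_indicator_const _ hAm]
    simp
  have hmono := integral_mono (μ := μ)
    (integrable_finsetSum (Finset.range T) fun k _ => (hI k).1)
    (((hint.const_mul 2).add (integrable_const 2)).const_mul (n : ℝ)) hpt
  rw [integral_finsetSum _ fun k _ => (hI k).1, integral_const_mul,
    integral_add' (hint.const_mul 2) (integrable_const 2), integral_const_mul] at hmono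
  simp only [(hI _).2, Finset.sum_const, Finset.card_range, nsmul_eq_mul, integral_const,
    probReal_univ, smul_eq_mul, one_mul] at hmono
  refine hmono.trans ?_
  gcongr

lemma exp_coord (h : IsStationaryGaussian r μ) (hr0 : r 0 = 1) (t : ℝ) :
    Integrable (fun x => Real.exp (t * x 0)) μ ∧
      ∫ x, Real.exp (t * x 0) ∂μ = Real.exp (t ^ 2 / 2) := by
  simpa [covForm, hr0, sq] using h.exp_linear 1 fun _ => t

/-- Lowering the level from `0` to `-1` costs little. -/
lemma fewAbove_zero_le (h : IsStationaryGaussian r μ) (hr : ∀ j, 0 ≤ r j) (hr0 : r 0 = 1)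
    (T n : ℕ) {q : ℝ} (hq : 0 ≤ q) (w : ℝ) :
    μ.real (fewAbove 0 T n) ≤
      Real.exp w * μ.real (fewAbove (-1) T n) + Real.exp ((q + 1) ^ 2 / 2) * Real.exp (-q * w) := by
  have := h.prob
  set A := fewAbove (-1) T n with hA
  have hAm : MeasurableSet A := measurableSet_fewAbove _ _ _
  have hsub : fewAbove 0 T n ⊆ (fun (x : ℕ → ℝ) k => x k - r k) ⁻¹' A := by
    intro x hx
    refine lt_of_le_of_lt (Finset.card_le_card fun k hk => ?_) hx
    rw [Finset.mem_filter] at hk ⊢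
    refine ⟨hk.1, ?_⟩
    have hk1 : 1 ≤ k := (Finset.mem_Icc.1 hk.1).1
    have h1 : psum (fun k => x k - r k) k = psum x k - psum r k := by
      simp [psum, Finset.sum_sub_distrib]
    have h2 : 1 ≤ psum r k := by
      rw [← hr0]
      exact Finset.single_le_sum (f := r) (fun i _ => hr i) (Finset.mem_range.2 (by omega))
    have h3 := hk.2
    rw [h1] at h3
    linarith
  have hdens : ∀ x : ℕ → ℝ, Real.exp (-x 0 - 1 / 2) = Real.exp (-(1 / 2)) *
      Real.exp (-1 * x 0) := by
    intro x
    rw [← Real.exp_add]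
    congr 1
    ring
  have hdi : Integrable (fun x : ℕ → ℝ => Real.exp (-x 0 - 1 / 2)) μ := by
    simp only [hdens]
    exact (h.exp_coord hr0 _).1.const_mul _
  have h1 : μ.real (fewAbove 0 T n) ≤ ∫ x in A, Real.exp (-x 0 - 1 / 2) ∂μ := by
    have h2 : μ (fewAbove 0 T n) ≤ ENNReal.ofReal (∫ x in A, Real.exp (-x 0 - 1 / 2) ∂μ) := by
      rw [ofReal_integral_eq_lintegral_ofReal hdi.integrableOn
        (ae_of_all _ fun x => (Real.exp_pos _).le), ← withDensity_apply _ hAm,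
        ← h.map_sub hr0, Measure.map_apply (by fun_prop) hAm]
      exact measure_mono hsub
    exact ENNReal.toReal_le_of_le_ofReal
      (integral_nonneg fun x => (Real.exp_pos _).le) h2
  refine h1.trans ?_
  have hpt : ∀ x : ℕ → ℝ, A.indicator (fun x => Real.exp (-x 0 - 1 / 2)) x ≤
      A.indicator (fun _ => Real.exp w) x +
        Real.exp (-q * w) * Real.exp (-(q + 1) * x 0) := by
    intro x
    by_cases hx : x ∈ A
    · rw [Set.indicator_of_mem hx, Set.indicator_of_mem hx]
      rcases le_total (-x 0 - 1 / 2) w with hw | hw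
      · linarith [Real.exp_le_exp.2 hw,
          mul_pos (Real.exp_pos (-q * w)) (Real.exp_pos (-(q + 1) * x 0))]
      · rw [← Real.exp_add]
        have : -x 0 - 1 / 2 ≤ -q * w + -(q + 1) * x 0 := by nlinarith
        linarith [Real.exp_le_exp.2 this, Real.exp_pos w]
    · rw [Set.indicator_of_notMem hx, Set.indicator_of_notMem hx]
      positivity
  have hE := h.exp_coord hr0 (-(q + 1))
  have hmono := integral_mono (hdi.indicator hAm)
    (((integrable_const (Real.exp w)).indicator hAm).add (hE.1.const_mul (Real.exp (-q * w)))) hpt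
  rw [integral_indicator hAm] at hmono
  refine hmono.trans (le_of_eq ?_)
  rw [integral_add' ((integrable_const (Real.exp w)).indicator hAm)
    (hE.1.const_mul (Real.exp (-q * w))), integral_indicator_const _ hAm, integral_const_mul, hE.2]
  rw [smul_eq_mul, neg_sq]
  ring

/-- The persistence probability is bounded below through the growth of the variance. -/
lemma persist_lower (h : IsStationaryGaussian r μ) (hr : ∀ j, 0 ≤ r j) (hr0 : r 0 = 1)
    {T m : ℕ} (hT : 1 ≤ T) (hm : 1 ≤ m) {w : ℝ} (hw : 0 ≤ w) :
    (1 - Real.exp (-1 / 2)) / 2 * √(sumVar r m) ≤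
      m * (w * μ.real (persist T) + 2 * Real.exp 2 * Real.exp (-w)) +
        √(sumVar r T) * (Real.log (T + 1) + 4) := by
  have := h.prob
  obtain ⟨hint, hle⟩ := h.integral_maxAbs hr hr0 hT
  set B := persist T with hB
  have hBm : MeasurableSet B := measurableSet_persist T
  set D : (ℕ → ℝ) → ℝ := B.indicator fun y => |y 0| with hD
  have hDpt : ∀ y, D y ≤ B.indicator (fun _ => w) y +
      Real.exp (-w) * (Real.exp (2 * y 0) + Real.exp (-2 * y 0)) := by
    intro y
    by_cases hy : y ∈ B
    · rw [hD, Set.indicator_of_mem hy, Set.indicator_of_mem hy]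
      have hexp : Real.exp (2 * |y 0|) ≤ Real.exp (2 * y 0) + Real.exp (-2 * y 0) := by
        rcases abs_cases (y 0) with ⟨h1, -⟩ | ⟨h1, -⟩ <;> rw [h1]
        · linarith [Real.exp_pos (-2 * y 0)]
        · rw [mul_neg, ← neg_mul]
          linarith [Real.exp_pos (2 * y 0)]
      rcases le_total (|y 0|) w with hyw | hyw
      · have : 0 ≤ Real.exp (-w) * (Real.exp (2 * y 0) + Real.exp (-2 * y 0)) := by positivity
        linarith
      · calc |y 0| ≤ Real.exp (-w) * Real.exp (2 * |y 0|) := by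
              rw [← Real.exp_add]
              linarith [Real.add_one_le_exp (-w + 2 * |y 0|)]
          _ ≤ Real.exp (-w) * (Real.exp (2 * y 0) + Real.exp (-2 * y 0)) := by gcongr
          _ ≤ _ := by linarith
    · rw [hD, Set.indicator_of_notMem hy, Set.indicator_of_notMem hy]
      positivity
  have hE2 := h.exp_coord hr0 2
  have hE2' := h.exp_coord hr0 (-2)
  have hEs : Integrable (fun y : ℕ → ℝ => Real.exp (2 * y 0) + Real.exp (-2 * y 0)) μ :=
    hE2.1.add hE2'.1
  have hbi : Integrable (fun y => B.indicator (fun _ => w) y +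
      Real.exp (-w) * (Real.exp (2 * y 0) + Real.exp (-2 * y 0))) μ :=
    ((integrable_const w).indicator hBm).add (hEs.const_mul _)
  have hDnn : ∀ y, 0 ≤ D y := fun y => Set.indicator_nonneg (fun _ _ => abs_nonneg _) y
  have hDm : Measurable D := Measurable.indicator (by fun_prop) hBm
  have hDi : Integrable D μ := hbi.mono' hDm.aestronglyMeasurable (ae_of_all _ fun y => by
    rw [Real.norm_of_nonneg (hDnn y)]
    exact hDpt y)
  have hDle : ∫ y, D y ∂μ ≤ w * μ.real B + 2 * Real.exp 2 * Real.exp (-w) := by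
    refine (integral_mono hDi hbi hDpt).trans (le_of_eq ?_)
    rw [integral_add ((integrable_const w).indicator hBm) (hEs.const_mul _),
      integral_indicator_const _ hBm, integral_const_mul, integral_add hE2.1 hE2'.1, hE2.2, hE2'.2]
    rw [smul_eq_mul]
    norm_num
    ring
  obtain ⟨v, hv, hlaw⟩ := h.law_psum m
  have hvpos : 0 < v := by
    have := one_le_sumVar hr hr0 hm
    rw [← hv] at this
    exact_mod_cast (by linarith : (0 : ℝ) < v)
  have hZabs : ∫ x, |psum x m| ∂μ = ∫ y, |y| ∂(gaussianReal 0 v) := by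
    rw [← hlaw, integral_map (measurable_psum m).aemeasurable (by fun_prop)]
  have hZint : Integrable (fun x => psum x m) μ := by
    have := (memLp_id_gaussianReal' (μ := 0) (v := v) 1 (by simp)).integrable le_rfl
    rw [← hlaw] at this
    exact this.comp_measurable (measurable_psum m)
  have hZ0 : ∫ x, psum x m ∂μ = 0 := by
    have := integral_id_gaussianReal (μ := 0) (v := v)
    rwa [← hlaw, integral_map (measurable_psum m).aemeasurable (by fun_prop)] at this
  have hpt : ∀ x, (|psum x m| - psum x m) / 2 ≤
      maxAbs T (shift m x) + ∑ i ∈ Finset.range m, D (shift i x) := by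
    intro x
    have h1 := sliding_max_bound hT x m
    have h2 : 0 ≤ ∑ i ∈ Finset.range m, D (shift i x) := Finset.sum_nonneg fun i _ => hDnn _
    have h3 := maxAbs_nonneg T (shift m x)
    rw [hD, hB] at h2 ⊢
    rcases abs_cases (psum x m) with ⟨h4, -⟩ | ⟨h4, -⟩ <;> rw [h4] <;> linarith
  have hcomp : ∀ i (f : (ℕ → ℝ) → ℝ), Integrable f μ →
      Integrable (fun x => f (shift i x)) μ ∧ ∫ x, f (shift i x) ∂μ = ∫ x, f x ∂μ := by
    intro i f hf
    refine ⟨(h.measurePreserving_shift i).integrable_comp_of_integrable hf, ?_⟩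
    have := integral_map (measurable_shift i).aemeasurable (μ := μ) (f := f)
      (by rw [h.map_shift]; exact hf.aestronglyMeasurable)
    rw [← this, h.map_shift]
  have hmono := integral_mono ((hZint.abs.sub hZint).div_const 2)
    ((hcomp m _ hint).1.add
      (integrable_finsetSum (Finset.range m) fun i _ => (hcomp i _ hDi).1)) hpt
  simp only [Pi.add_apply] at hmono
  rw [integral_div, integral_sub' hZint.abs hZint, hZ0, hZabs,
    integral_add (hcomp m _ hint).1
      (integrable_finsetSum (Finset.range m) fun i _ => (hcomp i _ hDi).1),
    integral_finsetSum _ fun i _ => (hcomp i _ hDi).1, (hcomp m _ hint).2] at hmono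
  simp only [(hcomp _ _ hDi).2, Finset.sum_const, Finset.card_range, nsmul_eq_mul] at hmono
  have hlow := gaussian_abs_lower hvpos
  rw [hv] at hlow
  have hmD : (m : ℝ) * ∫ y, D y ∂μ ≤ m * (w * μ.real B + 2 * Real.exp 2 * Real.exp (-w)) := by
    gcongr
  linarith

end IsStationaryGaussian

lemma pow_two_step {a : ℕ → ℝ} {n₀ : ℕ} {L : ℝ} (hL : 0 ≤ L)
    (h : ∀ n ≥ n₀, a (2 * n) ≤ L * a n) (k : ℕ) : a (2 ^ k * n₀) ≤ L ^ k * a n₀ := by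
  induction k with
  | zero => simp
  | succ k ih =>
    have h1 := h (2 ^ k * n₀) (Nat.le_mul_of_pos_left _ (by positivity))
    rw [pow_succ' 2, mul_assoc, pow_succ' L, mul_assoc]
    exact h1.trans (mul_le_mul_of_nonneg_left ih hL)

lemma growth_upper {a : ℕ → ℝ} (hmono : Monotone a) (hpos : ∀ n, 1 ≤ n → 0 < a n) {α β : ℝ}
    (hlim : Tendsto (fun n => a (2 * n) / a n) atTop (nhds ((2 : ℝ) ^ α))) (hβ : α < β)
    (hβ0 : 0 ≤ β) : ∃ C > 0, ∀ n : ℕ, 1 ≤ n → a n ≤ C * (n : ℝ) ^ β := by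
  have hlt : (2 : ℝ) ^ α < 2 ^ β := Real.rpow_lt_rpow_of_exponent_lt (by norm_num) hβ
  obtain ⟨n₁, hn₁⟩ := eventually_atTop.1 (hlim.eventually (gt_mem_nhds hlt))
  set n₀ := max n₁ 1 with hn₀
  have hn₀1 : 1 ≤ n₀ := le_max_right _ _
  have hstep : ∀ n ≥ n₀, a (2 * n) ≤ 2 ^ β * a n := by
    intro n hn
    have h1 := hn₁ n ((le_max_left _ _).trans hn)
    exact ((div_lt_iff₀ (hpos n (hn₀1.trans hn))).1 h1).le
  refine ⟨2 ^ β * a n₀, mul_pos (by positivity) (hpos _ hn₀1), fun n hn => ?_⟩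
  set k := Nat.clog 2 n with hk
  have hk1 : n ≤ 2 ^ k := Nat.le_pow_clog (by norm_num) n
  have hk2 : (2 : ℝ) ^ k ≤ 2 * n := by
    rcases Nat.lt_or_ge 1 n with h1 | h1
    · have h2 := Nat.pow_pred_clog_lt_self (b := 2) (by norm_num) h1
      have h3 : 0 < k := Nat.clog_pos (by norm_num) h1
      have h4 : 2 ^ k = 2 * 2 ^ (k - 1) := by
        rw [← pow_succ']
        congr 1
        omega
      have h5 : 2 ^ k ≤ 2 * n := by
        rw [h4]
        exact Nat.mul_le_mul_left 2 h2.le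
      exact_mod_cast h5
    · have : n = 1 := le_antisymm h1 hn
      simp [hk, this]
  calc a n ≤ a (2 ^ k * n₀) := hmono (hk1.trans (Nat.le_mul_of_pos_right _ hn₀1))
    _ ≤ (2 ^ β) ^ k * a n₀ := pow_two_step (by positivity) hstep k
    _ = ((2 : ℝ) ^ k) ^ β * a n₀ := by
      rw [← Real.rpow_natCast, ← Real.rpow_mul (by norm_num), mul_comm β,
        Real.rpow_mul (by norm_num), Real.rpow_natCast]
    _ ≤ (2 * n : ℝ) ^ β * a n₀ := by
      have := (hpos _ hn₀1).le
      gcongr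
    _ = _ := by
      rw [Real.mul_rpow (by norm_num) (by positivity)]
      ring

lemma growth_lower {a : ℕ → ℝ} (hmono : Monotone a) (hpos : ∀ n, 1 ≤ n → 0 < a n) {α β : ℝ}
    (hlim : Tendsto (fun n => a (2 * n) / a n) atTop (nhds ((2 : ℝ) ^ α))) (hβ : β < α)
    (hβ0 : 0 ≤ β) : ∃ c > 0, ∀ᶠ n : ℕ in atTop, c * (n : ℝ) ^ β ≤ a n := by
  have hlt : (2 : ℝ) ^ β < 2 ^ α := Real.rpow_lt_rpow_of_exponent_lt (by norm_num) hβ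
  obtain ⟨n₁, hn₁⟩ := eventually_atTop.1 (hlim.eventually (lt_mem_nhds hlt))
  set n₀ := max n₁ 1 with hn₀
  have hn₀1 : 1 ≤ n₀ := le_max_right _ _
  have hstep : ∀ n ≥ n₀, (-a) (2 * n) ≤ 2 ^ β * (-a) n := by
    intro n hn
    have h1 := hn₁ n ((le_max_left _ _).trans hn)
    have h2 := (lt_div_iff₀ (hpos n (hn₀1.trans hn))).1 h1
    simp only [Pi.neg_apply]
    linarith
  refine ⟨(4 * n₀ : ℝ) ^ (-β) * a n₀, mul_pos (by positivity) (hpos _ hn₀1), ?_⟩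
  filter_upwards [eventually_ge_atTop n₀] with n hn
  set q := n / n₀ with hq
  have hq1 : 1 ≤ q := (Nat.one_le_div_iff hn₀1).2 hn
  set k := Nat.log 2 q with hk
  have hk1 : 2 ^ k ≤ q := Nat.pow_log_le_self 2 (by omega)
  have hk2 : q < 2 ^ (k + 1) := Nat.lt_pow_succ_log_self (by norm_num) q
  have hn2 : n ≤ 4 * n₀ * 2 ^ k := by
    have h1 : n < n₀ * (q + 1) := Nat.lt_mul_div_succ n hn₀1
    have h2 : q + 1 ≤ 2 * 2 ^ k := by
      rw [pow_succ'] at hk2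
      omega
    calc n ≤ n₀ * (q + 1) := h1.le
      _ ≤ n₀ * (2 * 2 ^ k) := Nat.mul_le_mul_left _ h2
      _ ≤ 4 * n₀ * 2 ^ k := by nlinarith [Nat.zero_le (n₀ * 2 ^ k)]
  have hn3 : 2 ^ k * n₀ ≤ n := (Nat.mul_le_mul_right _ hk1).trans (Nat.div_mul_le_self n n₀)
  have hmain := pow_two_step (by positivity) hstep k
  simp only [Pi.neg_apply] at hmain
  have ha0 := (hpos _ hn₀1).le
  have hn₀pos : (0 : ℝ) < n₀ := by exact_mod_cast hn₀1
  calc (4 * n₀ : ℝ) ^ (-β) * a n₀ * (n : ℝ) ^ β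
      ≤ (4 * n₀ : ℝ) ^ (-β) * a n₀ * (4 * n₀ * 2 ^ k : ℝ) ^ β := by
        gcongr
        exact_mod_cast hn2
    _ = ((2 : ℝ) ^ k) ^ β * a n₀ := by
      have h4 : (4 * n₀ : ℝ) ^ (-β) * (4 * n₀ : ℝ) ^ β = 1 := by
        rw [← Real.rpow_add (by positivity)]
        simp
      rw [Real.mul_rpow (x := (4 * n₀ : ℝ)) (by positivity) (by positivity)]
      linear_combination ((2 : ℝ) ^ k) ^ β * a n₀ * h4
    _ = (2 ^ β) ^ k * a n₀ := by
      rw [← Real.rpow_natCast, ← Real.rpow_mul (by norm_num), mul_comm,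
        mul_comm (k : ℝ), Real.rpow_mul (by norm_num), Real.rpow_natCast, mul_comm]
    _ ≤ a (2 ^ k * n₀) := by linarith
    _ ≤ a n := hmono hn3

/-- Regular variation of the variance along dyadic scales. -/
lemma tendsto_sumVar_two_mul {r : ℕ → ℝ} {H K : ℝ} (hK : 0 < K) {ℓ : ℝ → ℝ}
    (hℓpos : ∀ x > (0 : ℝ), 0 < ℓ x)
    (hℓslow : ∀ lam > (0 : ℝ), Tendsto (fun x : ℝ => ℓ (lam * x) / ℓ x) atTop (nhds 1))
    (hlrd : Tendsto (fun n : ℕ => sumVar r n / (K * (n : ℝ) ^ (2 * H) * ℓ n)) atTop (nhds 1)) :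
    Tendsto (fun n => sumVar r (2 * n) / sumVar r n) atTop (nhds ((2 : ℝ) ^ (2 * H))) := by
  have h2 : Tendsto (fun n : ℕ => 2 * n) atTop atTop :=
    tendsto_id.const_mul_atTop' (by norm_num)
  have hA := hlrd.comp h2
  have hB := (hℓslow 2 (by norm_num)).comp tendsto_natCast_atTop_atTop
  have hprod := ((hA.mul hB).div hlrd one_ne_zero).mul_const ((2 : ℝ) ^ (2 * H))
  simp only [mul_one, div_one, one_mul] at hprod
  refine hprod.congr' ?_
  filter_upwards [eventually_ge_atTop 1] with n hn
  have hn0 : (0 : ℝ) < n := by exact_mod_cast hn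
  have hl1 := hℓpos n hn0
  have hl2 := hℓpos (2 * n) (by positivity)
  have hp : (0 : ℝ) < (n : ℝ) ^ (2 * H) := by positivity
  have hp2 : (0 : ℝ) < (2 : ℝ) ^ (2 * H) := by positivity
  simp only [Function.comp_apply, Pi.div_apply, Nat.cast_mul, Nat.cast_ofNat]
  rw [Real.mul_rpow (by norm_num) hn0.le]
  by_cases hV : sumVar r n = 0
  · simp [hV]
  · field_simp

lemma eventually_const_le_rpow (C : ℝ) {γ : ℝ} (hγ : 0 < γ) :
    ∀ᶠ T : ℕ in atTop, C ≤ (T : ℝ) ^ γ :=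
  ((tendsto_rpow_atTop hγ).comp tendsto_natCast_atTop_atTop).eventually_ge_atTop C

lemma eventually_log_le_rpow (C : ℝ) {γ : ℝ} (hγ : 0 < γ) :
    ∀ᶠ T : ℕ in atTop, C * (Real.log (T + 1) + 4) ≤ (T : ℝ) ^ γ := by
  filter_upwards [eventually_const_le_rpow (|C| * (2 / γ + 5)) (half_pos hγ),
    eventually_ge_atTop 1] with T hT hT1
  have hT0 : (1 : ℝ) ≤ T := by exact_mod_cast hT1
  have hTpos : (0 : ℝ) < T := by linarith
  have h1 : Real.log (T + 1) ≤ Real.log T + 1 := by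
    have h2 : Real.log (T + 1) ≤ Real.log (2 * T) := Real.log_le_log (by linarith) (by linarith)
    rw [Real.log_mul (by norm_num) hTpos.ne'] at h2
    linarith [Real.log_two_lt_d9]
  have h3 : Real.log T ≤ (T : ℝ) ^ (γ / 2) * (2 / γ) := by
    refine (Real.log_le_rpow_div hTpos.le (half_pos hγ)).trans (le_of_eq ?_)
    field_simp
  have h4 : (1 : ℝ) ≤ (T : ℝ) ^ (γ / 2) := Real.one_le_rpow hT0 (half_pos hγ).le
  have h5 : 0 ≤ Real.log (T + 1) + 4 := by linarith [Real.log_nonneg (by linarith : (1 : ℝ) ≤ T + 1)]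
  calc C * (Real.log (T + 1) + 4) ≤ |C| * (Real.log (T + 1) + 4) := by
        gcongr
        exact le_abs_self C
    _ ≤ |C| * ((T : ℝ) ^ (γ / 2) * (2 / γ + 5)) := by
        gcongr
        linarith
    _ = |C| * (2 / γ + 5) * (T : ℝ) ^ (γ / 2) := by ring
    _ ≤ (T : ℝ) ^ (γ / 2) * (T : ℝ) ^ (γ / 2) := by gcongr
    _ = (T : ℝ) ^ γ := by rw [← Real.rpow_add hTpos]; congr 1; ring

lemma eventually_occupation_le {V a b : ℕ → ℝ} {n : ℕ → ℕ} {H δ : ℝ} (hH : 1 / 2 ≤ H)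
    (hδ : 0 < δ) {C : ℝ} (hC : 0 < C) (hup : ∀ m : ℕ, 1 ≤ m → √(V m) ≤ C * (m : ℝ) ^ (H + δ))
    (hn : Tendsto (fun T : ℕ => Real.log (n T) / Real.log T) atTop (nhds 0))
    (hn1 : ∀ T, 1 ≤ n T)
    (hab : ∀ T (q w : ℝ), 0 ≤ q →
      a T ≤ Real.exp w * b T + Real.exp ((q + 1) ^ 2 / 2) * Real.exp (-q * w))
    (hb : ∀ T : ℕ, 1 ≤ T → T * b T ≤ n T * (2 * (√(V T) * (Real.log (T + 1) + 4)) + 2)) :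
    ∀ᶠ T : ℕ in atTop, a T ≤ (T : ℝ) ^ (H - 1 + 5 * δ) := by
  set C' := Real.exp ((2 / δ + 1) ^ 2 / 2) with hC'
  filter_upwards [eventually_const_le_rpow (2 * C + 2 + C') hδ, eventually_log_le_rpow 1 hδ,
    eventually_ge_atTop 2, hn.eventually (gt_mem_nhds hδ)] with T hTC hTlog hT2 hTn
  have hT1 : (1 : ℝ) < T := by exact_mod_cast hT2
  have hT0 : (0 : ℝ) < T := by linarith
  have hlog : 0 < Real.log T := Real.log_pos hT1
  have hnT : (n T : ℝ) ≤ (T : ℝ) ^ δ := by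
    have hpos : (0 : ℝ) < n T := by exact_mod_cast hn1 T
    rw [div_lt_iff₀ hlog] at hTn
    rw [← Real.exp_log hpos, Real.rpow_def_of_pos hT0, mul_comm]
    exact Real.exp_le_exp.2 hTn.le
  have hb' : b T ≤ (2 * C + 2) * (T : ℝ) ^ (H - 1 + 3 * δ) := by
    have h0 : 0 ≤ Real.log (T + 1) + 4 := by
      linarith [Real.log_nonneg (by linarith : (1 : ℝ) ≤ T + 1)]
    have h1 : T * b T ≤ (T : ℝ) ^ δ * ((2 * C + 2) * (T : ℝ) ^ (H + 2 * δ)) := by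
      refine (hb T (by omega)).trans ?_
      have h2 : √(V T) * (Real.log (T + 1) + 4) ≤ C * (T : ℝ) ^ (H + 2 * δ) := by
        calc _ ≤ C * (T : ℝ) ^ (H + δ) * (T : ℝ) ^ δ := by
              gcongr
              · exact hup T (by omega)
              · linarith
          _ = _ := by
              rw [mul_assoc, ← Real.rpow_add hT0]
              congr 2
              ring
      have h3 : (1 : ℝ) ≤ (T : ℝ) ^ (H + 2 * δ) := Real.one_le_rpow hT1.le (by linarith)
      gcongr
      linarith
    have h4 : T * ((2 * C + 2) * (T : ℝ) ^ (H - 1 + 3 * δ)) =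
        (T : ℝ) ^ δ * ((2 * C + 2) * (T : ℝ) ^ (H + 2 * δ)) := by
      have h5 : (T : ℝ) * (T : ℝ) ^ (H - 1 + 3 * δ) = (T : ℝ) ^ δ * (T : ℝ) ^ (H + 2 * δ) := by
        rw [← Real.rpow_one_add' hT0.le (by linarith), ← Real.rpow_add hT0]
        congr 1
        ring
      linear_combination (2 * C + 2) * h5
    rw [← h4] at h1
    exact le_of_mul_le_mul_left h1 hT0
  have hmain := hab T (2 / δ) (δ * Real.log T) (by positivity)
  have he1 : Real.exp (δ * Real.log T) = (T : ℝ) ^ δ := by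
    rw [Real.rpow_def_of_pos hT0, mul_comm]
  have he2 : Real.exp (-(2 / δ) * (δ * Real.log T)) = (T : ℝ) ^ (-2 : ℝ) := by
    rw [Real.rpow_def_of_pos hT0]
    congr 1
    field_simp
  rw [he1, he2, ← hC'] at hmain
  have h6 : (T : ℝ) ^ (-2 : ℝ) ≤ (T : ℝ) ^ (H - 1 + 4 * δ) :=
    Real.rpow_le_rpow_of_exponent_le hT1.le (by linarith)
  calc a T ≤ (T : ℝ) ^ δ * ((2 * C + 2) * (T : ℝ) ^ (H - 1 + 3 * δ)) +
        C' * (T : ℝ) ^ (H - 1 + 4 * δ) := by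
        refine hmain.trans ?_
        gcongr
    _ = (2 * C + 2 + C') * (T : ℝ) ^ (H - 1 + 4 * δ) := by
        have h7 : (T : ℝ) ^ δ * (T : ℝ) ^ (H - 1 + 3 * δ) = (T : ℝ) ^ (H - 1 + 4 * δ) := by
          rw [← Real.rpow_add hT0]
          congr 1
          ring
        linear_combination (2 * C + 2) * h7
    _ ≤ (T : ℝ) ^ δ * (T : ℝ) ^ (H - 1 + 4 * δ) := by gcongr
    _ = _ := by
        rw [← Real.rpow_add hT0]
        congr 1
        ring

lemma eventually_persist_ge {V p : ℕ → ℝ} {H δ : ℝ} (hH : 1 / 2 ≤ H) (hH1 : H < 1)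
    (hδ : 0 < δ) (hδ1 : δ ≤ 1 / 40) {C : ℝ}
    (hup : ∀ m : ℕ, 1 ≤ m → √(V m) ≤ C * (m : ℝ) ^ (H + δ)) {c : ℝ} (hc : 0 < c)
    (hlow : ∀ᶠ m : ℕ in atTop, c * (m : ℝ) ^ (H - δ) ≤ √(V m)) {κ C₁ : ℝ} (hκ : 0 < κ)
    (hC₁ : 0 ≤ C₁) (hp0 : ∀ T, 0 ≤ p T)
    (hp : ∀ T m : ℕ, 1 ≤ T → 1 ≤ m → ∀ w : ℝ, 0 ≤ w → κ * √(V m) ≤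
      m * (w * p T + C₁ * Real.exp (-w)) + √(V T) * (Real.log (T + 1) + 4)) :
    ∀ᶠ T : ℕ in atTop, (T : ℝ) ^ (H - 1 - 16 * δ) ≤ p T := by
  obtain ⟨m₀, hm₀⟩ := eventually_atTop.1 hlow
  filter_upwards [eventually_log_le_rpow C hδ, eventually_log_le_rpow 4 hδ,
    eventually_const_le_rpow (2 / (κ * c)) hδ, eventually_const_le_rpow (8 / (κ * c) * (1 + C₁)) hδ,
    eventually_ge_atTop 2, eventually_ge_atTop m₀] with T hTC hT4 hTk hTk1 hT2 hTm
  have hT1 : (1 : ℝ) < T := by exact_mod_cast hT2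
  have hT0 : (0 : ℝ) < T := by linarith
  have hlog : 0 < Real.log T := Real.log_pos hT1
  have hlog1 : Real.log T ≤ Real.log (T + 1) := Real.log_le_log hT0 (by linarith)
  set m := ⌈(T : ℝ) ^ (1 + 13 * δ)⌉₊ with hm
  have hTpow : (T : ℝ) ≤ (T : ℝ) ^ (1 + 13 * δ) := by
    conv_lhs => rw [← Real.rpow_one (T : ℝ)]
    exact Real.rpow_le_rpow_of_exponent_le hT1.le (by linarith)
  have hmge : (T : ℝ) ^ (1 + 13 * δ) ≤ m := Nat.le_ceil _
  have hmle : (m : ℝ) ≤ 2 * (T : ℝ) ^ (1 + 13 * δ) := by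
    have := Nat.ceil_lt_add_one (by positivity : 0 ≤ (T : ℝ) ^ (1 + 13 * δ))
    linarith
  have hTm' : T ≤ m := by exact_mod_cast hTpow.trans hmge
  have hm0 : (0 : ℝ) < m := by linarith
  have hmain := hp T m (by omega) (by omega) (4 * Real.log T) (by positivity)
  have hVm := hm₀ m (hTm.trans hTm')
  have hkc : 0 < κ * c := mul_pos hκ hc
  have hVT : √(V T) * (Real.log (T + 1) + 4) ≤ (T : ℝ) ^ (H + 2 * δ) := by
    have h0 : 0 ≤ Real.log (T + 1) + 4 := by linarith
    calc _ ≤ C * (T : ℝ) ^ (H + δ) * (Real.log (T + 1) + 4) := by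
          gcongr
          exact hup T (by omega)
      _ = (T : ℝ) ^ (H + δ) * (C * (Real.log (T + 1) + 4)) := by ring
      _ ≤ (T : ℝ) ^ (H + δ) * (T : ℝ) ^ δ := by gcongr
      _ = _ := by
          rw [← Real.rpow_add hT0]
          congr 1
          ring
  have hmpow : (T : ℝ) ^ (H + 3 * δ) ≤ (m : ℝ) ^ (H - δ) := by
    calc (T : ℝ) ^ (H + 3 * δ) ≤ (T : ℝ) ^ ((1 + 13 * δ) * (H - δ)) :=
          Real.rpow_le_rpow_of_exponent_le hT1.le (by nlinarith)
      _ = ((T : ℝ) ^ (1 + 13 * δ)) ^ (H - δ) := Real.rpow_mul hT0.le _ _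
      _ ≤ _ := Real.rpow_le_rpow (by positivity) hmge (by linarith)
  have hhalf : (T : ℝ) ^ (H + 2 * δ) ≤ κ * c / 2 * (m : ℝ) ^ (H - δ) := by
    have h1 : (T : ℝ) ^ δ * (T : ℝ) ^ (H + 2 * δ) = (T : ℝ) ^ (H + 3 * δ) := by
      rw [← Real.rpow_add hT0]
      congr 1
      ring
    have h2 : 2 / (κ * c) * (T : ℝ) ^ (H + 2 * δ) ≤ (m : ℝ) ^ (H - δ) := by
      refine le_trans ?_ hmpow
      rw [← h1]
      gcongr
    calc (T : ℝ) ^ (H + 2 * δ) = κ * c / 2 * (2 / (κ * c) * (T : ℝ) ^ (H + 2 * δ)) := by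
          field_simp
      _ ≤ _ := by gcongr
  have he : Real.exp (-(4 * Real.log T)) = (T : ℝ) ^ (-4 : ℝ) := by
    rw [Real.rpow_def_of_pos hT0]
    congr 1
    ring
  have hkey : κ * c / 2 * (m : ℝ) ^ (H - δ) ≤ m * ((T : ℝ) ^ δ * p T + C₁ * (T : ℝ) ^ (-4 : ℝ)) := by
    have h1 : κ * (c * (m : ℝ) ^ (H - δ)) ≤ κ * √(V m) := by gcongr
    have h2 : (m : ℝ) * (4 * Real.log T * p T + C₁ * Real.exp (-(4 * Real.log T))) ≤
        m * ((T : ℝ) ^ δ * p T + C₁ * (T : ℝ) ^ (-4 : ℝ)) := by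
      rw [he]
      have := hp0 T
      gcongr
      linarith
    linarith
  have hmpow2 : (T : ℝ) ^ (H - 1 - 14 * δ) / 4 ≤ (m : ℝ) ^ (H - δ - 1) := by
    have hexp : H - δ - 1 ≤ 0 := by linarith
    calc (T : ℝ) ^ (H - 1 - 14 * δ) / 4
        ≤ (2 : ℝ) ^ (H - δ - 1) * (T : ℝ) ^ ((1 + 13 * δ) * (H - δ - 1)) := by
          have h1 : (1 : ℝ) / 4 ≤ (2 : ℝ) ^ (H - δ - 1) := by
            calc (1 : ℝ) / 4 = (2 : ℝ) ^ (-2 : ℝ) := by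
                  rw [Real.rpow_neg (by norm_num)]; norm_num
              _ ≤ _ := Real.rpow_le_rpow_of_exponent_le (by norm_num) (by linarith)
          have h2 : (T : ℝ) ^ (H - 1 - 14 * δ) ≤ (T : ℝ) ^ ((1 + 13 * δ) * (H - δ - 1)) :=
            Real.rpow_le_rpow_of_exponent_le hT1.le (by nlinarith)
          rw [div_eq_mul_one_div, mul_comm]
          gcongr
      _ = (2 * (T : ℝ) ^ (1 + 13 * δ)) ^ (H - δ - 1) := by
          rw [Real.mul_rpow (by norm_num) (by positivity), ← Real.rpow_mul hT0.le]
      _ ≤ _ := Real.rpow_le_rpow_of_nonpos hm0 hmle hexp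
  have hkey2 : κ * c / 2 * (m : ℝ) ^ (H - δ - 1) ≤
      (T : ℝ) ^ δ * p T + C₁ * (T : ℝ) ^ (-4 : ℝ) := by
    refine le_of_mul_le_mul_left (le_trans (le_of_eq ?_) hkey) hm0
    rw [Real.rpow_sub_one hm0.ne']
    field_simp
  have hkey3 : (1 + C₁) * (T : ℝ) ^ (H - 1 - 15 * δ) ≤ (T : ℝ) ^ δ * p T +
      C₁ * (T : ℝ) ^ (-4 : ℝ) := by
    refine le_trans ?_ hkey2
    have h1 : (T : ℝ) ^ δ * (T : ℝ) ^ (H - 1 - 15 * δ) = (T : ℝ) ^ (H - 1 - 14 * δ) := by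
      rw [← Real.rpow_add hT0]
      congr 1
      ring
    calc (1 + C₁) * (T : ℝ) ^ (H - 1 - 15 * δ)
        = κ * c / 8 * (8 / (κ * c) * (1 + C₁) * (T : ℝ) ^ (H - 1 - 15 * δ)) := by field_simp
      _ ≤ κ * c / 8 * ((T : ℝ) ^ δ * (T : ℝ) ^ (H - 1 - 15 * δ)) := by gcongr
      _ = κ * c / 2 * ((T : ℝ) ^ (H - 1 - 14 * δ) / 4) := by rw [h1]; ring
      _ ≤ _ := by gcongr
  have h4 : (T : ℝ) ^ (-4 : ℝ) ≤ (T : ℝ) ^ (H - 1 - 15 * δ) :=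
    Real.rpow_le_rpow_of_exponent_le hT1.le (by linarith)
  have h5 : (T : ℝ) ^ (H - 1 - 15 * δ) ≤ (T : ℝ) ^ δ * p T := by
    have := mul_le_mul_of_nonneg_left h4 hC₁
    linarith
  have h6 : (T : ℝ) ^ (H - 1 - 15 * δ) = (T : ℝ) ^ δ * (T : ℝ) ^ (H - 1 - 16 * δ) := by
    rw [← Real.rpow_add hT0]
    congr 1
    ring
  rw [h6] at h5
  exact le_of_mul_le_mul_left h5 (by positivity)

end GaussianPersistence

/-- **Statement 7.**
Let `(X_i)_{i ≥ 1}` be a stationary centered Gaussian sequence with `E[X_i²] = 1`,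
nonnegative correlations `r j = E[X_k X_{k+j}]` satisfying
`∑_{i,j=1}^n r(i-j) ~ K n^{2H} ℓ(n)` with `H ∈ [1/2, 1)`, `K > 0` and `ℓ` slowly varying,
and let `Z_n = ∑_{i=1}^n X_i`.  Let `N_T = #{k ∈ {1,…,T} : Z_k > 0}` be the time spent on the positive half-axis, and
let `n : ℕ → ℕ₊` satisfy `log n(T) / log T → 0`.  Then
`P[max_{k=1,…,T} Z_k ≤ 0] ≤ P[N_T < n(T)]` for all `T`, and for every `ε > 0` there is
`T₀` such that `P[N_T < n(T)] ≤ T^ε P[max_{k=1,…,T} Z_k ≤ 0]` for all `T ≥ T₀`. -/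
theorem stmt8
    {Ω : Type*} [MeasurableSpace Ω] (P : Measure Ω) [IsProbabilityMeasure P]
    (X : ℕ → Ω → ℝ) (hXmeas : ∀ i, Measurable (X i))
    (hgauss : ∀ s : Finset ℕ, (∀ i ∈ s, 1 ≤ i) → ∀ c : ℕ → ℝ,
      ∃ v : NNReal,
        Measure.map (fun ω => ∑ i ∈ s, c i * X i ω) P = gaussianReal 0 v)
    (r : ℕ → ℝ) (hrnonneg : ∀ j, 0 ≤ r j) (hr0 : r 0 = 1)
    (hrcov : ∀ k, 1 ≤ k → ∀ j, ∫ ω, X k ω * X (k + j) ω ∂P = r j)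
    (H : ℝ) (hH : H ∈ Set.Ico (1 / 2 : ℝ) 1) (K : ℝ) (hK : 0 < K)
    (ℓ : ℝ → ℝ) (hℓpos : ∀ x > (0 : ℝ), 0 < ℓ x)
    (hℓslow : ∀ lam > (0 : ℝ),
      Tendsto (fun x : ℝ => ℓ (lam * x) / ℓ x) atTop (nhds 1))
    (hlrd : Tendsto
      (fun n : ℕ =>
        (∑ i ∈ Finset.Icc 1 n, ∑ j ∈ Finset.Icc 1 n, r ((i : ℤ) - j).natAbs) /
          (K * (n : ℝ) ^ (2 * H) * ℓ n))
      atTop (nhds 1))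
    (Z : ℕ → Ω → ℝ) (hZ : ∀ n ω, Z n ω = ∑ i ∈ Finset.Icc 1 n, X i ω)
    (N : ℕ → Ω → ℕ)
    (hN : ∀ T ω, N T ω = ((Finset.Icc 1 T).filter fun k => 0 < Z k ω).card)
    (n : ℕ → ℕ) (hn1 : ∀ T, 1 ≤ n T)
    (hn : Tendsto (fun T : ℕ => Real.log (n T) / Real.log T) atTop (nhds 0)) :
    (∀ T : ℕ,
      P {ω | ∀ k ∈ Finset.Icc 1 T, Z k ω ≤ 0} ≤ P {ω | N T ω < n T}) ∧
      ∀ ε > (0 : ℝ), ∃ T₀ : ℕ, ∀ T ≥ T₀,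
        (P {ω | N T ω < n T}).toReal ≤
          (T : ℝ) ^ ε * (P {ω | ∀ k ∈ Finset.Icc 1 T, Z k ω ≤ 0}).toReal := by
  obtain ⟨hH0, hH1⟩ := hH
  have hZsum : ∀ k ω, Z k ω = GaussianPersistence.psum (fun k => X (0 + 1 + k) ω) k := by
    intro k ω
    rw [hZ, GaussianPersistence.psum, ← Finset.Ico_add_one_right_eq_Icc,
      Finset.sum_Ico_eq_sum_range]
    simp
  refine ⟨fun T => measure_mono fun ω hω => ?_, fun ε hε => ?_⟩
  · have hcard : ((Finset.Icc 1 T).filter fun k => 0 < Z k ω) = ∅ :=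
      Finset.filter_eq_empty_iff.2 fun k hk => not_lt.2 (hω k hk)
    rw [Set.mem_ofPred_eq, hN, hcard, Finset.card_empty]
    exact hn1 T
  have hg := GaussianPersistence.isStationaryGaussian_map hXmeas hgauss hrcov 0
  set μ := P.map fun ω k => X (0 + 1 + k) ω with hμ
  have hmeas : Measurable fun ω k => X (0 + 1 + k) ω := by fun_prop
  have hA : ∀ T, (P {ω | N T ω < n T}).toReal =
      μ.real (GaussianPersistence.fewAbove 0 T (n T)) := by
    intro T
    rw [Measure.real, hμ,
      Measure.map_apply hmeas (GaussianPersistence.measurableSet_fewAbove _ _ _)]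
    congr 2
    ext ω
    simp only [Set.mem_ofPred_eq, Set.mem_preimage, GaussianPersistence.fewAbove, hN, hZsum]
  have hB : ∀ T, (P {ω | ∀ k ∈ Finset.Icc 1 T, Z k ω ≤ 0}).toReal =
      μ.real (GaussianPersistence.persist T) := by
    intro T
    rw [Measure.real, hμ,
      Measure.map_apply hmeas (GaussianPersistence.measurableSet_persist _)]
    congr 2
    ext ω
    simp only [Set.mem_ofPred_eq, Set.mem_preimage, GaussianPersistence.persist, hZsum]
  have hlrd' : Tendsto (fun n : ℕ => GaussianPersistence.sumVar r n /
      (K * (n : ℝ) ^ (2 * H) * ℓ n)) atTop (nhds 1) := by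
    convert! hlrd using 3 with n
    simp only [GaussianPersistence.sumVar, GaussianPersistence.covForm,
      ← Finset.Ico_add_one_right_eq_Icc, Finset.sum_Ico_eq_sum_range]
    simp
  have hlim := GaussianPersistence.tendsto_sumVar_two_mul hK hℓpos hℓslow hlrd'
  have hmono := GaussianPersistence.sumVar_mono hrnonneg
  have hpos : ∀ m, 1 ≤ m → 0 < GaussianPersistence.sumVar r m := fun m hm =>
    lt_of_lt_of_le one_pos (GaussianPersistence.one_le_sumVar hrnonneg hr0 hm)
  set δ := min (1 / 40) (ε / 21) with hδdef
  have hδ : 0 < δ := lt_min (by norm_num) (by positivity)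
  have hδ1 : δ ≤ 1 / 40 := min_le_left _ _
  have hδε : δ ≤ ε / 21 := min_le_right _ _
  have hsqrt : ∀ (m : ℕ) (s : ℝ), √((m : ℝ) ^ (2 * s)) = (m : ℝ) ^ s := by
    intro m s
    rw [mul_comm, Real.rpow_mul (by positivity), Real.rpow_two, Real.sqrt_sq (by positivity)]
  obtain ⟨C, hC, hup⟩ := GaussianPersistence.growth_upper hmono hpos hlim
    (β := 2 * (H + δ)) (by linarith) (by linarith)
  obtain ⟨c, hc, hlow⟩ := GaussianPersistence.growth_lower hmono hpos hlim
    (β := 2 * (H - δ)) (by linarith) (by linarith)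
  have hup' : ∀ m : ℕ, 1 ≤ m → √(GaussianPersistence.sumVar r m) ≤ √C * (m : ℝ) ^ (H + δ) := by
    intro m hm
    rw [← hsqrt, ← Real.sqrt_mul hC.le]
    exact Real.sqrt_le_sqrt (hup m hm)
  have hlow' : ∀ᶠ m : ℕ in atTop,
      √c * (m : ℝ) ^ (H - δ) ≤ √(GaussianPersistence.sumVar r m) := by
    filter_upwards [hlow] with m hm
    rw [← hsqrt, ← Real.sqrt_mul hc.le]
    exact Real.sqrt_le_sqrt hm
  have hocc := GaussianPersistence.eventually_occupation_le (V := GaussianPersistence.sumVar r)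
    hH0 hδ (Real.sqrt_pos.2 hC) hup' hn hn1
    (fun T q w hq => hg.fewAbove_zero_le hrnonneg hr0 T (n T) hq w)
    (fun T hT => hg.mul_fewAbove_neg_one_le hrnonneg hr0 hT (n T))
  have hper := GaussianPersistence.eventually_persist_ge (V := GaussianPersistence.sumVar r)
    hH0 hH1 hδ hδ1 hup' (Real.sqrt_pos.2 hc) hlow'
    (κ := (1 - Real.exp (-1 / 2)) / 2) (C₁ := 2 * Real.exp 2)
    (by linarith [Real.exp_lt_one_iff.2 (by norm_num : (-1 / 2 : ℝ) < 0)]) (by positivity)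
    (fun T => measureReal_nonneg)
    (fun T m hT hm w hw => hg.persist_lower hrnonneg hr0 hT hm hw)
  obtain ⟨T₀, hT₀⟩ := eventually_atTop.1 (hocc.and (hper.and (eventually_ge_atTop 1)))
  refine ⟨T₀, fun T hT => ?_⟩
  obtain ⟨h1, h2, h3⟩ := hT₀ T hT
  have hT1 : (1 : ℝ) ≤ T := by exact_mod_cast h3
  rw [hA, hB]
  calc _ ≤ (T : ℝ) ^ (H - 1 + 5 * δ) := h1
    _ ≤ (T : ℝ) ^ (ε + (H - 1 - 16 * δ)) :=
        Real.rpow_le_rpow_of_exponent_le hT1 (by linarith)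
    _ = (T : ℝ) ^ ε * (T : ℝ) ^ (H - 1 - 16 * δ) := Real.rpow_add (by linarith) _ _
    _ ≤ _ := by gcongr
end
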